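/- Let n ≥ 5, p ≥ 1, 1 < s < (n+4)/(n−4), and 0 < R < ∞. Let U = (u_1, …, u_p) be a nonnegative superharmonic C⁴ solution of Δ² u_i = |U|^{s−1} u_i on the punctured ball B_R \ {0} ⊂ ℝ^n whose origin is a non-removable singularity. Then |U(x)| = (1 + O(|x|)) · m(|x|) as x → 0, where m(r) denotes the average of |U| over the sphere of radius r centered at the origin; explicitly, there exist C > 0 and r₀ ∈ (0, R) such that | |U(x)| − m(|x|) | ≤ C |x| m(|x|) for all 0 < |x| < r₀. -/

import Mathlib

open MeasureTheory Metric Filter Topology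

/-- The Euclidean Laplacian: sum of second partial derivatives. -/
noncomputable def lap {n : ℕ} (u : EuclideanSpace ℝ (Fin n) → ℝ)
    (x : EuclideanSpace ℝ (Fin n)) : ℝ :=
  ∑ i : Fin n,
    fderiv ℝ (fun y => fderiv ℝ u y (EuclideanSpace.single i 1)) x
      (EuclideanSpace.single i 1)

/-- The bi-Laplacian Δ² = Δ ∘ Δ. -/
noncomputable def bilap {n : ℕ} (u : EuclideanSpace ℝ (Fin n) → ℝ) :
    EuclideanSpace ℝ (Fin n) → ℝ :=
  lap (lap u)

/-- The pointwise Euclidean norm |U(x)| of a p-map U. -/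
noncomputable def vnorm {n p : ℕ} (U : Fin p → EuclideanSpace ℝ (Fin n) → ℝ)
    (x : EuclideanSpace ℝ (Fin n)) : ℝ :=
  Real.sqrt (∑ i, U i x ^ 2)

/-- The spherical average of `|U|` over the sphere of radius `r` about the
origin, with respect to the `(n-1)`-dimensional Hausdorff measure. -/
noncomputable def sphAvg {n p : ℕ} (U : Fin p → EuclideanSpace ℝ (Fin n) → ℝ)
    (r : ℝ) : ℝ :=
  ⨍ y in Metric.sphere (0 : EuclideanSpace ℝ (Fin n)) r, vnorm U y
    ∂(μH[(n : ℝ) - 1])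


open MeasureTheory Metric Filter Topology

/-- Euclidean space abbreviation. -/
abbrev EE (n : ℕ) := EuclideanSpace ℝ (Fin n)

/-- the i-th standard basis vector. -/
noncomputable abbrev bv {n : ℕ} (i : Fin n) : EE n := EuclideanSpace.single i 1

/-- partial derivative. -/
noncomputable def pd {n : ℕ} (i : Fin n) (u : EE n → ℝ) (x : EE n) : ℝ := fderiv ℝ u x (bv i)

lemma lap_eq {n : ℕ} (u : EE n → ℝ) (x : EE n) : lap u x = ∑ i, pd i (pd i u) x := rfl

lemma pd_congr {n : ℕ} {u v : EE n → ℝ} {x : EE n} (h : u =ᶠ[𝓝 x] v) (i : Fin n) :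
    pd i u =ᶠ[𝓝 x] pd i v := by
  filter_upwards [h.fderiv (𝕜 := ℝ)] with y hy
  simp only [pd, hy]

lemma lap_congr {n : ℕ} {u v : EE n → ℝ} {x : EE n} (h : u =ᶠ[𝓝 x] v) :
    lap u =ᶠ[𝓝 x] lap v := by
  have : ∀ i : Fin n, pd i (pd i u) =ᶠ[𝓝 x] pd i (pd i v) := fun i =>
    pd_congr (pd_congr h i) i
  filter_upwards [eventually_all.2 this] with y hy
  rw [lap_eq, lap_eq]
  exact Finset.sum_congr rfl (fun i _ => hy i)

lemma contDiffAt_pd {n : ℕ} {u : EE n → ℝ} {x : EE n} {m k : WithTop ℕ∞} (hmk : m + 1 ≤ k)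
    (h : ContDiffAt ℝ k u x) (i : Fin n) : ContDiffAt ℝ m (pd i u) x := by
  unfold pd
  exact (h.fderiv_right hmk).clm_apply contDiffAt_const

lemma contDiffAt_lap {n : ℕ} {u : EE n → ℝ} {x : EE n} {m k : WithTop ℕ∞} (hmk : m + 2 ≤ k)
    (h : ContDiffAt ℝ k u x) : ContDiffAt ℝ m (lap u) x := by
  have : lap u = fun x => ∑ i, pd i (pd i u) x := rfl
  rw [this]
  refine ContDiffAt.sum (fun i _ => ?_)
  refine contDiffAt_pd (k := m + 1) le_rfl (contDiffAt_pd (k := k) ?_ h i) i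
  rw [add_assoc]; norm_num; exact hmk

lemma pd_mul {n : ℕ} {u v : EE n → ℝ} {x : EE n} (hu : DifferentiableAt ℝ u x)
    (hv : DifferentiableAt ℝ v x) (i : Fin n) :
    pd i (fun y => u y * v y) x = u x * pd i v x + v x * pd i u x := by
  unfold pd
  rw [fderiv_fun_mul hu hv]
  simp

lemma pd_add {n : ℕ} {u v : EE n → ℝ} {x : EE n} (hu : DifferentiableAt ℝ u x)
    (hv : DifferentiableAt ℝ v x) (i : Fin n) :
    pd i (fun y => u y + v y) x = pd i u x + pd i v x := by
  unfold pd
  rw [fderiv_fun_add hu hv]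
  simp

lemma pd_sub {n : ℕ} {u v : EE n → ℝ} {x : EE n} (hu : DifferentiableAt ℝ u x)
    (hv : DifferentiableAt ℝ v x) (i : Fin n) :
    pd i (fun y => u y - v y) x = pd i u x - pd i v x := by
  unfold pd
  rw [fderiv_fun_sub hu hv]
  simp

lemma ContDiffAt.ev_diff {n : ℕ} {u : EE n → ℝ} {x : EE n} {m : WithTop ℕ∞} (hm : m ≠ 0) (h1 : m ≠ ⊤)
    (h : ContDiffAt ℝ m u x) : ∀ᶠ y in 𝓝 x, DifferentiableAt ℝ u y := by
  have h' : ContDiffAt ℝ 1 u x := h.of_le (by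
    rw [ENat.one_le_iff_ne_zero_withTop]; exact hm)
  filter_upwards [h'.eventually (by simp)] with y hy
  exact hy.differentiableAt (by simp)

lemma lap_mul {n : ℕ} {u v : EE n → ℝ} {x : EE n} (hu : ContDiffAt ℝ 2 u x)
    (hv : ContDiffAt ℝ 2 v x) :
    lap (fun y => u y * v y) x = u x * lap v x + v x * lap u x + 2 * ∑ i, pd i u x * pd i v x := by
  have hud := hu.ev_diff (by simp) (by simp)
  have hvd := hv.ev_diff (by simp) (by simp)
  have key : ∀ i : Fin n, pd i (pd i (fun y => u y * v y)) x =
      u x * pd i (pd i v) x + v x * pd i (pd i u) x + 2 * (pd i u x * pd i v x) := by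
    intro i
    have h1 : pd i (fun y => u y * v y) =ᶠ[𝓝 x] fun y => u y * pd i v y + v y * pd i u y := by
      filter_upwards [hud, hvd] with y h1 h2 using pd_mul h1 h2 i
    have h2 := (pd_congr h1 i).eq_of_nhds
    have du := hud.self_of_nhds
    have dv := hvd.self_of_nhds
    have dpu : DifferentiableAt ℝ (pd i u) x :=
      (contDiffAt_pd (m := 1) (by norm_num) hu i).differentiableAt (by simp)
    have dpv : DifferentiableAt ℝ (pd i v) x :=
      (contDiffAt_pd (m := 1) (by norm_num) hv i).differentiableAt (by simp)
    rw [h2, pd_add (du.fun_mul dpv) (dv.fun_mul dpu), pd_mul du dpv, pd_mul dv dpu]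
    ring
  rw [lap_eq, lap_eq, lap_eq, Finset.sum_congr rfl (fun i _ => key i)]
  rw [Finset.sum_add_distrib, Finset.sum_add_distrib, Finset.mul_sum, Finset.mul_sum,
    Finset.mul_sum]

lemma lap_neg {n : ℕ} (u : EE n → ℝ) (x : EE n) : lap (fun y => - u y) x = - lap u x := by
  have h : ∀ (w : EE n → ℝ) (i : Fin n), pd i (fun y => - w y) = fun y => - pd i w y := by
    intro w i; funext y; unfold pd; rw [fderiv_fun_neg]; simp
  rw [lap_eq, lap_eq, ← Finset.sum_neg_distrib]
  refine Finset.sum_congr rfl (fun i _ => ?_)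
  rw [h, h]

lemma lap_sub_const {n : ℕ} (u : EE n → ℝ) (c : ℝ) (x : EE n) :
    lap (fun y => u y - c) x = lap u x := by
  have h : ∀ (i : Fin n), pd i (fun y => u y - c) = pd i u := by
    intro i; funext y; unfold pd; rw [fderiv_sub_const]
  rw [lap_eq, lap_eq]
  simp only [h]

lemma lap_const_mul {n : ℕ} (u : EE n → ℝ) (c : ℝ) (x : EE n) :
    lap (fun y => c * u y) x = c * lap u x := by
  have h : ∀ (w : EE n → ℝ) (i : Fin n), pd i (fun y => c * w y) = fun y => c * pd i w y := by
    intro w i; funext y; unfold pd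
    have e : (fun y => c * w y) = c • w := rfl
    rw [e, fderiv_const_smul_field]; simp
  rw [lap_eq, lap_eq, Finset.mul_sum]
  refine Finset.sum_congr rfl (fun i _ => ?_)
  rw [h, h]

lemma lap_add {n : ℕ} {u v : EE n → ℝ} {x : EE n} (hu : ContDiffAt ℝ 2 u x)
    (hv : ContDiffAt ℝ 2 v x) : lap (fun y => u y + v y) x = lap u x + lap v x := by
  have hud := hu.ev_diff (by simp) (by simp)
  have hvd := hv.ev_diff (by simp) (by simp)
  have key : ∀ i : Fin n, pd i (pd i (fun y => u y + v y)) x =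
      pd i (pd i u) x + pd i (pd i v) x := by
    intro i
    have h1 : pd i (fun y => u y + v y) =ᶠ[𝓝 x] fun y => pd i u y + pd i v y := by
      filter_upwards [hud, hvd] with y h1 h2 using pd_add h1 h2 i
    have dpu : DifferentiableAt ℝ (pd i u) x :=
      (contDiffAt_pd (m := 1) (by norm_num) hu i).differentiableAt (by simp)
    have dpv : DifferentiableAt ℝ (pd i v) x :=
      (contDiffAt_pd (m := 1) (by norm_num) hv i).differentiableAt (by simp)
    rw [(pd_congr h1 i).eq_of_nhds, pd_add dpu dpv]
  rw [lap_eq, lap_eq, lap_eq, Finset.sum_congr rfl (fun i _ => key i), Finset.sum_add_distrib]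

open MeasureTheory Metric Filter Topology

lemma integral_pd_zero {n : ℕ} {q : EE n → ℝ} (hq : ContDiff ℝ 1 q) (hc : HasCompactSupport q)
    (i : Fin n) : ∫ x, pd i q x = 0 := by
  have h1 : Continuous (fun x => fderiv ℝ q x (bv i)) :=
    (hq.continuous_fderiv (by simp)).clm_apply continuous_const
  have h2 : HasCompactSupport (fun x => fderiv ℝ q x (bv i)) := hc.fderiv_apply (𝕜 := ℝ) _
  have := integral_mul_fderiv_eq_neg_fderiv_mul_of_integrable (μ := (volume : Measure (EE n)))
    (f := fun _ : EE n => (1 : ℝ)) (g := q) (v := bv i) (by simp)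
    (by simpa using h1.integrable_of_hasCompactSupport h2)
    (by simpa using hq.continuous.integrable_of_hasCompactSupport hc)
    (fun x _ => by fun_prop) (fun x _ => hq.differentiable (by simp) x)
  simpa [pd] using this

lemma pd_zero_of_ev {n : ℕ} {u : EE n → ℝ} {x : EE n} (h : u =ᶠ[𝓝 x] 0) (i : Fin n) :
    pd i u =ᶠ[𝓝 x] 0 := by
  have := pd_congr h i
  refine this.trans (Eventually.of_forall fun y => ?_)
  simp only [pd]
  have e : (0 : EE n → ℝ) = fun _ => 0 := rfl
  rw [e]; simp

lemma lap_zero_of_ev {n : ℕ} {u : EE n → ℝ} {x : EE n} (h : u =ᶠ[𝓝 x] 0) :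
    lap u =ᶠ[𝓝 x] 0 := by
  have : ∀ i : Fin n, pd i (pd i u) =ᶠ[𝓝 x] 0 := fun i => pd_zero_of_ev (pd_zero_of_ev h i) i
  filter_upwards [eventually_all.2 this] with y hy
  rw [lap_eq]
  exact Finset.sum_eq_zero (fun i _ => hy i)

lemma contDiffAt_of_ev_zero {n : ℕ} {u : EE n → ℝ} {x : EE n} {m : WithTop ℕ∞}
    (h : u =ᶠ[𝓝 x] 0) : ContDiffAt ℝ m u x :=
  (contDiffAt_const (c := (0 : ℝ))).congr_of_eventuallyEq h

lemma hcs_lap {n : ℕ} {u : EE n → ℝ} (h : HasCompactSupport u) : HasCompactSupport (lap u) := by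
  refine h.mono' ?_
  intro x hx
  by_contra hx2
  exact hx ((lap_zero_of_ev (notMem_tsupport_iff_eventuallyEq.1 hx2)).eq_of_nhds)

lemma hcs_pd {n : ℕ} {u : EE n → ℝ} (h : HasCompactSupport u) (i : Fin n) :
    HasCompactSupport (pd i u) := by
  refine h.mono' ?_
  intro x hx
  by_contra hx2
  exact hx ((pd_zero_of_ev (notMem_tsupport_iff_eventuallyEq.1 hx2) i).eq_of_nhds)

/-- Green identity with a test function vanishing near the singular point. -/
lemma ibp_lap {n : ℕ} {g ψ : EE n → ℝ} (hg : ∀ x ≠ 0, ContDiffAt ℝ 2 g x)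
    (hψ : ∀ x ≠ 0, ContDiffAt ℝ 2 ψ x) (hgc : HasCompactSupport g) (h0 : ψ =ᶠ[𝓝 0] 0) :
    Integrable (fun x => ψ x * lap g x) ∧ Integrable (fun x => g x * lap ψ x) ∧
    ∫ x, ψ x * lap g x = ∫ x, g x * lap ψ x := by
  have c1 : ∀ x, ContDiffAt ℝ 0 (fun x => ψ x * lap g x) x := by
    intro x
    by_cases hx : x = 0
    · subst hx
      refine contDiffAt_of_ev_zero ?_
      filter_upwards [h0] with y hy; simp [hy]
    · exact ((hψ x hx).of_le (by simp)).mul (contDiffAt_lap (k := 2) (by simp) (hg x hx))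
  have c2 : ∀ x, ContDiffAt ℝ 0 (fun x => g x * lap ψ x) x := by
    intro x
    by_cases hx : x = 0
    · subst hx
      refine contDiffAt_of_ev_zero ?_
      filter_upwards [lap_zero_of_ev h0] with y hy; simp [hy]
    · exact ((hg x hx).of_le (by simp)).mul (contDiffAt_lap (k := 2) (by simp) (hψ x hx))
  have i1 : Integrable (fun x => ψ x * lap g x) :=
    (continuous_iff_continuousAt.2 fun x => (c1 x).continuousAt).integrable_of_hasCompactSupport
      (hcs_lap hgc).mul_left
  have i2 : Integrable (fun x => g x * lap ψ x) :=
    (continuous_iff_continuousAt.2 fun x => (c2 x).continuousAt).integrable_of_hasCompactSupport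
      hgc.mul_right
  refine ⟨i1, i2, ?_⟩
  let q : Fin n → EE n → ℝ := fun i x => ψ x * pd i g x - g x * pd i ψ x
  have q1 : ∀ i, ContDiff ℝ 1 (q i) := by
    intro i
    rw [contDiff_iff_contDiffAt]
    intro x
    by_cases hx : x = 0
    · subst hx
      refine contDiffAt_of_ev_zero ?_
      filter_upwards [h0, pd_zero_of_ev h0 i] with y hy hy2; simp [q, hy, hy2]
    · refine ContDiffAt.sub ?_ ?_
      · exact ((hψ x hx).of_le (by norm_num)).mul (contDiffAt_pd (k := 2) (by norm_num) (hg x hx) i)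
      · exact ((hg x hx).of_le (by norm_num)).mul (contDiffAt_pd (k := 2) (by norm_num) (hψ x hx) i)
  have q2 : ∀ i, HasCompactSupport (q i) := fun i =>
    ((hcs_pd hgc i).mul_left).sub hgc.mul_right
  have q3 : ∀ i, Integrable (pd i (q i)) := fun i => by
    have h1 : Continuous (pd i (q i)) :=
      ((q1 i).continuous_fderiv (by simp)).clm_apply continuous_const
    exact h1.integrable_of_hasCompactSupport (hcs_pd (q2 i) i)
  have key : ∀ x, ψ x * lap g x - g x * lap ψ x = ∑ i, pd i (q i) x := by
    intro x
    by_cases hx : x = 0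
    · subst hx
      have : ∀ i, pd i (q i) 0 = 0 := by
        intro i
        refine (pd_zero_of_ev ?_ i).eq_of_nhds
        filter_upwards [h0, pd_zero_of_ev h0 i] with y hy hy2; simp [q, hy, hy2]
      have e1 := h0.eq_of_nhds
      have e2 := (lap_zero_of_ev h0).eq_of_nhds
      simp [this, e1, e2]
    · rw [lap_eq, lap_eq, Finset.mul_sum, Finset.mul_sum, ← Finset.sum_sub_distrib]
      refine Finset.sum_congr rfl (fun i _ => ?_)
      have dg := (hg x hx).differentiableAt (by simp)
      have dψ := (hψ x hx).differentiableAt (by simp)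
      have dpg : DifferentiableAt ℝ (pd i g) x :=
        (contDiffAt_pd (m := 1) (by norm_num) (hg x hx) i).differentiableAt (by simp)
      have dpψ : DifferentiableAt ℝ (pd i ψ) x :=
        (contDiffAt_pd (m := 1) (by norm_num) (hψ x hx) i).differentiableAt (by simp)
      simp only [q]
      rw [pd_sub (dψ.fun_mul dpg) (dg.fun_mul dpψ), pd_mul dψ dpg, pd_mul dg dpψ]
      ring
  rw [← sub_eq_zero, ← integral_sub i1 i2, integral_congr_ae (Eventually.of_forall key),
    integral_finsetSum _ (fun i _ => q3 i)]
  exact Finset.sum_eq_zero (fun i _ => integral_pd_zero (q1 i) (q2 i) i)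

lemma hasFDerivAt_normsq {n : ℕ} (x y : EE n) :
    HasFDerivAt (fun y => ‖y - x‖ ^ 2) (2 • (innerSL ℝ (y - x))) y := by
  have h : HasFDerivAt (fun y : EE n => y - x) (ContinuousLinearMap.id ℝ (EE n)) y :=
    (hasFDerivAt_id y).sub_const x
  have := h.norm_sq
  simpa using this

lemma pd_radial {n : ℕ} {F : ℝ → ℝ} {F1 : ℝ} {x y : EE n} (h : HasDerivAt F F1 (‖y - x‖ ^ 2))
    (i : Fin n) : pd i (fun y => F (‖y - x‖ ^ 2)) y = 2 * F1 * (y i - x i) := by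
  have := (h.comp_hasFDerivAt y (hasFDerivAt_normsq x y)).fderiv
  unfold pd
  have e : (fun y => F (‖y - x‖ ^ 2)) = F ∘ (fun y => ‖y - x‖ ^ 2) := rfl
  rw [e, this]
  simp [bv, EuclideanSpace.inner_single_right]
  ring

lemma pd_coord {n : ℕ} (i : Fin n) (x y : EE n) : pd i (fun y : EE n => y i - x i) y = 1 := by
  unfold pd
  have h : HasFDerivAt (fun y : EE n => y i) (EuclideanSpace.proj (𝕜 := ℝ) i) y :=
    (EuclideanSpace.proj (𝕜 := ℝ) i : EE n →L[ℝ] ℝ).hasFDerivAt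
  rw [(h.sub_const (x i)).fderiv]
  simp [bv]

lemma lap_radial {n : ℕ} {F F' : ℝ → ℝ} {F2 : ℝ} {x y : EE n}
    (h : ∀ᶠ t in 𝓝 (‖y - x‖ ^ 2), HasDerivAt F (F' t) t) (h2 : HasDerivAt F' F2 (‖y - x‖ ^ 2)) :
    lap (fun y => F (‖y - x‖ ^ 2)) y = 4 * ‖y - x‖ ^ 2 * F2 + 2 * n * F' (‖y - x‖ ^ 2) := by
  have hc : Tendsto (fun y => ‖y - x‖ ^ 2) (𝓝 y) (𝓝 (‖y - x‖ ^ 2)) :=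
    (hasFDerivAt_normsq x y).continuousAt
  have key : ∀ i : Fin n, pd i (pd i (fun y => F (‖y - x‖ ^ 2))) y =
      4 * F2 * (y i - x i) ^ 2 + 2 * F' (‖y - x‖ ^ 2) := by
    intro i
    have e : pd i (fun y => F (‖y - x‖ ^ 2)) =ᶠ[𝓝 y]
        fun y => (2 * F' (‖y - x‖ ^ 2)) * (y i - x i) := by
      filter_upwards [hc.eventually h] with z hz using pd_radial hz i
    rw [(pd_congr e i).eq_of_nhds]
    have hd : HasDerivAt (fun t => 2 * F' t) (2 * F2) (‖y - x‖ ^ 2) := h2.const_mul 2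
    have d1 : DifferentiableAt ℝ (fun y : EE n => 2 * F' (‖y - x‖ ^ 2)) y :=
      (HasDerivAt.comp_hasFDerivAt (h₂ := fun t => 2 * F' t) (f := fun y : EE n => ‖y - x‖ ^ 2) y hd
        (hasFDerivAt_normsq x y)).differentiableAt
    have d2 : DifferentiableAt ℝ (fun y : EE n => y i - x i) y := by fun_prop
    rw [pd_mul d1 d2, pd_coord, pd_radial (F := fun t => 2 * F' t) hd i]
    ring
  rw [lap_eq, Finset.sum_congr rfl (fun i _ => key i), Finset.sum_add_distrib, ← Finset.mul_sum,
    EuclideanSpace.real_norm_sq_eq]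
  simp
  ring

lemma second_deriv_nonneg_of_localMin {f : ℝ → ℝ} {a : ℝ} (h : IsLocalMin f a)
    (hc : ContinuousAt f a) : 0 ≤ deriv (deriv f) a := by
  by_contra hneg
  push Not at hneg
  have hmax := isLocalMax_of_deriv_deriv_neg hneg h.deriv_eq_zero hc
  have hconst : f =ᶠ[𝓝 a] fun _ => f a := by
    filter_upwards [h, hmax] with y h1 h2 using le_antisymm h2 h1
  have h1 : deriv f =ᶠ[𝓝 a] fun _ => 0 := by
    have := hconst.deriv
    simpa using this
  have h2 := h1.deriv_eq
  simp at h2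
  linarith

lemma lap_nonneg_of_localMin {n : ℕ} {u : EE n → ℝ} {x : EE n} (hu : ContDiffAt ℝ 2 u x)
    (h : IsLocalMin u x) : 0 ≤ lap u x := by
  rw [lap_eq]
  refine Finset.sum_nonneg (fun i _ => ?_)
  let L : ℝ → EE n := fun t => x + t • bv i
  have L0 : L 0 = x := by simp [L]
  have hL : ∀ t, HasDerivAt L (bv i) t := by
    intro t
    have := ((hasDerivAt_id t).smul_const (bv i)).const_add x
    simpa [L] using this
  have hLc : Tendsto L (𝓝 0) (𝓝 x) := by
    have := (hL 0).continuousAt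
    rwa [ContinuousAt, L0] at this
  have hmin : IsLocalMin (u ∘ L) 0 := by
    have := hLc.eventually h
    simpa [IsLocalMin, IsMinFilter, L0] using this
  have d1 : deriv (u ∘ L) =ᶠ[𝓝 0] (pd i u) ∘ L := by
    filter_upwards [hLc.eventually (hu.ev_diff (by simp) (by simp))] with t ht
    exact (ht.hasFDerivAt.comp_hasDerivAt t (hL t)).deriv
  have dpu : DifferentiableAt ℝ (pd i u) x :=
    (contDiffAt_pd (m := 1) (by norm_num) hu i).differentiableAt (by simp)
  have d2 : deriv (deriv (u ∘ L)) 0 = pd i (pd i u) x := by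
    rw [d1.deriv_eq]
    have hh : HasFDerivAt (pd i u) (fderiv ℝ (pd i u) x) (L 0) := by
      rw [L0]; exact dpu.hasFDerivAt
    exact (hh.comp_hasDerivAt 0 (hL 0)).deriv
  rw [← d2]
  refine second_deriv_nonneg_of_localMin hmin ?_
  refine ContinuousAt.comp ?_ (hL 0).continuousAt
  rw [L0]; exact hu.continuousAt

open MeasureTheory Metric Filter Topology

lemma nontrivEE {n : ℕ} (hn : 5 ≤ n) : Nontrivial (EE n) := by
  have : Nonempty (Fin n) := ⟨⟨0, by omega⟩⟩
  infer_instance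

lemma ae_ne_zero {n : ℕ} (hn : 5 ≤ n) : ∀ᵐ x : EE n, x ≠ 0 := by
  have := nontrivEE hn
  rw [ae_iff]; simp

/-- positive part power. -/
noncomputable def mpow (k : ℕ) (r : ℝ) : ℝ := (max r 0) ^ k

lemma mpow_nonneg (k : ℕ) (r : ℝ) : 0 ≤ mpow k r := by unfold mpow; positivity

lemma hasDerivAt_mpow (k : ℕ) (r : ℝ) :
    HasDerivAt (mpow (k + 2)) ((k + 2) * mpow (k + 1) r) r := by
  rcases lt_trichotomy r 0 with h | h | h
  · have e : mpow (k + 2) =ᶠ[𝓝 r] fun _ => 0 := by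
      filter_upwards [Iio_mem_nhds h] with y hy
      simp [mpow, max_eq_right (le_of_lt (Set.mem_Iio.1 hy))]
    have : (k + 2 : ℝ) * mpow (k + 1) r = 0 := by simp [mpow, max_eq_right h.le]
    rw [this]
    exact (hasDerivAt_const r 0).congr_of_eventuallyEq e
  · subst h
    have : (k + 2 : ℝ) * mpow (k + 1) 0 = 0 := by simp [mpow]
    rw [this, hasDerivAt_iff_isLittleO_nhds_zero]
    have h1 : (fun h : ℝ => h ^ (k + 2)) =o[𝓝 0] fun h => h := by
      have := Asymptotics.isLittleO_pow_id (𝕜 := ℝ) (n := k + 2) (by omega)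
      simpa using this
    refine Asymptotics.IsBigO.trans_isLittleO ?_ h1
    refine Asymptotics.IsBigO.of_bound 1 (Eventually.of_forall fun h => ?_)
    simp only [mpow, zero_add, max_self, norm_pow, one_mul]
    simp only [ne_eq, Nat.add_eq_zero_iff, OfNat.ofNat_ne_zero, and_false, not_false_eq_true,
      zero_pow, sub_zero, smul_zero, norm_pow]
    gcongr
    rcases le_total h 0 with h' | h'
    · rw [max_eq_right h']; simp
    · rw [max_eq_left h']
  · have e : mpow (k + 2) =ᶠ[𝓝 r] fun y => y ^ (k + 2) := by
      filter_upwards [Ioi_mem_nhds h] with y hy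
      simp [mpow, max_eq_left (le_of_lt (Set.mem_Ioi.1 hy))]
    have h2 := (hasDerivAt_pow (k + 2) r).congr_of_eventuallyEq e
    refine h2.congr_deriv ?_
    simp [mpow, max_eq_left h.le]

lemma continuous_mpow (k : ℕ) : Continuous (mpow k) := by unfold mpow; fun_prop

lemma contDiff_mpow3 : ContDiff ℝ 2 (mpow 3) := by
  have d2 : deriv (mpow 2) = fun r => (2 : ℝ) * mpow 1 r := by
    funext r; have := (hasDerivAt_mpow 0 r).deriv; simpa using this
  have d3 : deriv (mpow 3) = fun r => (3 : ℝ) * mpow 2 r := by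
    funext r; rw [(hasDerivAt_mpow 1 r).deriv]; norm_num
  have c2 : ContDiff ℝ 1 (mpow 2) := by
    rw [contDiff_one_iff_deriv]
    refine ⟨fun r => (hasDerivAt_mpow 0 r).differentiableAt, ?_⟩
    rw [d2]; exact continuous_const.mul (continuous_mpow 1)
  have : (2 : WithTop ℕ∞) = 1 + 1 := by norm_num
  rw [this, contDiff_succ_iff_deriv]
  refine ⟨fun r => (hasDerivAt_mpow 1 r).differentiableAt, by simp, ?_⟩
  rw [d3]; exact contDiff_const.mul c2

/-- the profile of the cutoff. -/
noncomputable def cutF (ε t : ℝ) : ℝ := mpow 3 (1 - ε ^ 2 / t)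
noncomputable def cutF1 (ε t : ℝ) : ℝ := 3 * mpow 2 (1 - ε ^ 2 / t) * (ε ^ 2 / t ^ 2)
noncomputable def cutF2 (ε t : ℝ) : ℝ :=
  6 * mpow 1 (1 - ε ^ 2 / t) * (ε ^ 4 / t ^ 4) - 6 * mpow 2 (1 - ε ^ 2 / t) * (ε ^ 2 / t ^ 3)

/-- the cutoff. -/
noncomputable def cut {n : ℕ} (ε : ℝ) (x : EE n) : ℝ := cutF ε (‖x - 0‖ ^ 2)

lemma hasDerivAt_inner {ε t : ℝ} (ht : t ≠ 0) :
    HasDerivAt (fun t => 1 - ε ^ 2 / t) (ε ^ 2 / t ^ 2) t := by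
  have := ((hasDerivAt_inv ht).const_mul (ε ^ 2)).const_sub 1
  refine this.congr_deriv ?_
  field_simp

lemma hasDerivAt_cutF {ε t : ℝ} (ht : t ≠ 0) : HasDerivAt (cutF ε) (cutF1 ε t) t := by
  have := (hasDerivAt_mpow 1 (1 - ε ^ 2 / t)).comp t (hasDerivAt_inner (ε := ε) ht)
  refine this.congr_deriv ?_
  unfold cutF1; push_cast; ring

lemma hasDerivAt_cutF1 {ε t : ℝ} (ht : t ≠ 0) : HasDerivAt (cutF1 ε) (cutF2 ε t) t := by
  have h1 := (hasDerivAt_mpow 0 (1 - ε ^ 2 / t)).comp t (hasDerivAt_inner (ε := ε) ht)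
  have h2 : HasDerivAt (fun t : ℝ => ε ^ 2 / t ^ 2) (-2 * ε ^ 2 / t ^ 3) t := by
    have := ((hasDerivAt_pow 2 t).inv (pow_ne_zero 2 ht)).const_mul (ε ^ 2)
    refine this.congr_deriv ?_
    field_simp
    norm_num
    ring
  have := (h1.const_mul 3).mul h2
  refine this.congr_deriv ?_
  unfold cutF2
  simp
  field_simp
  ring

lemma cut_contDiffAt {n : ℕ} (ε : ℝ) {x : EE n} (hx : x ≠ 0) : ContDiffAt ℝ 2 (cut ε) x := by
  unfold cut cutF
  refine contDiff_mpow3.contDiffAt.comp x ?_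
  refine contDiffAt_const.sub (contDiffAt_const.div ?_ ?_)
  · exact ((contDiff_norm_sq ℝ).comp (contDiff_id.sub contDiff_const)).contDiffAt
  · simpa using hx

lemma nsq_pos {n : ℕ} {x : EE n} (hx : x ≠ 0) : 0 < ‖x - 0‖ ^ 2 := by
  have : 0 < ‖x‖ := norm_pos_iff.2 hx
  simp; positivity

lemma lap_cut {n : ℕ} (ε : ℝ) {x : EE n} (hx : x ≠ 0) :
    lap (cut ε) x = 4 * ‖x - 0‖ ^ 2 * cutF2 ε (‖x - 0‖ ^ 2) + 2 * n * cutF1 ε (‖x - 0‖ ^ 2) := by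
  have ht := nsq_pos hx
  refine lap_radial (F := cutF ε) (F' := cutF1 ε) ?_ (hasDerivAt_cutF1 ht.ne')
  filter_upwards [Ioi_mem_nhds ht] with t h using hasDerivAt_cutF (ne_of_gt h)

lemma pd_cut {n : ℕ} (ε : ℝ) {x : EE n} (hx : x ≠ 0) (i : Fin n) :
    pd i (cut ε) x = 2 * cutF1 ε (‖x‖ ^ 2) * x i := by
  have ht := nsq_pos hx
  have := pd_radial (F := cutF ε) (x := 0) (hasDerivAt_cutF (ε := ε) ht.ne') i
  have e : cut (n := n) ε = fun y => cutF ε (‖y - 0‖ ^ 2) := rfl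
  rw [e, this]; simp

lemma mpow_le_one {k : ℕ} {r : ℝ} (hr : r ≤ 1) : mpow k r ≤ 1 := by
  unfold mpow
  exact pow_le_one₀ (le_max_right _ _) (max_le hr zero_le_one)

lemma cut_nonneg {n : ℕ} (ε : ℝ) (x : EE n) : 0 ≤ cut ε x := mpow_nonneg _ _
lemma cut_le_one {n : ℕ} (ε : ℝ) (x : EE n) : cut ε x ≤ 1 :=
  mpow_le_one (by have : 0 ≤ ε ^ 2 / ‖x - 0‖ ^ 2 := by positivity
                  linarith)

lemma mpow_mul_le {k : ℕ} {ε t : ℝ} (ht : 0 < t) :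
    mpow (k + 1) (1 - ε ^ 2 / t) * (ε ^ 2 / t) ≤ 1 ∧ mpow (k+1) (1 - ε ^ 2 / t) * (ε ^ 2 / t) ≤ ε ^ 2 / t := by
  have h0 : 0 ≤ ε ^ 2 / t := by positivity
  have h1 : mpow (k + 1) (1 - ε ^ 2 / t) ≤ 1 := mpow_le_one (by linarith)
  have h2 := mpow_nonneg (k + 1) (1 - ε ^ 2 / t)
  refine ⟨?_, by nlinarith⟩
  by_cases h : ε ^ 2 / t ≤ 1
  · nlinarith
  · have : mpow (k + 1) (1 - ε ^ 2 / t) = 0 := by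
      unfold mpow; rw [max_eq_right (by linarith)]; simp
    rw [this]; simp

lemma cutF1_nonneg (ε : ℝ) {t : ℝ} : 0 ≤ cutF1 ε t := by
  unfold cutF1; have := mpow_nonneg 2 (1 - ε ^ 2 / t); positivity

lemma cutF1_le (ε : ℝ) {t : ℝ} (ht : 0 < t) :
    cutF1 ε t ≤ 3 / t ∧ cutF1 ε t ≤ 3 * ε ^ 2 / t ^ 2 := by
  have h := mpow_mul_le (k := 1) (ε := ε) ht
  have e : cutF1 ε t = 3 * (mpow 2 (1 - ε ^ 2 / t) * (ε ^ 2 / t)) / t := by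
    unfold cutF1; field_simp
  constructor
  · rw [e]; gcongr; linarith [h.1]
  · rw [e]
    have : 3 * ε ^ 2 / t ^ 2 = 3 * (ε ^ 2 / t) / t := by field_simp
    rw [this]; gcongr; exact h.2

lemma lapcut_bounds {n : ℕ} (hn : 5 ≤ n) (ε : ℝ) {t : ℝ} (ht : 0 < t) :
    0 ≤ 4 * t * cutF2 ε t + 2 * n * cutF1 ε t ∧
    4 * t * cutF2 ε t + 2 * n * cutF1 ε t ≤ (24 + 6 * n) / t ∧
    4 * t * cutF2 ε t + 2 * n * cutF1 ε t ≤ (24 * ε ^ 2 + 6 * n * ε ^ 2) / t ^ 2 := by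
  set a := ε ^ 2 / t with ha
  set m1 := mpow 1 (1 - a) with hm1
  set m2 := mpow 2 (1 - a) with hm2
  have ha0 : 0 ≤ a := by positivity
  have h1 := mpow_mul_le (k := 0) (ε := ε) ht
  have h2 := mpow_mul_le (k := 1) (ε := ε) ht
  simp only [zero_add, one_add_one_eq_two, ← ha, ← hm1, ← hm2] at h1 h2
  have p1 : 0 ≤ m1 := mpow_nonneg _ _
  have p2 : 0 ≤ m2 := mpow_nonneg _ _
  have q1 : m1 ≤ 1 := mpow_le_one (by linarith)
  have e : 4 * t * cutF2 ε t + 2 * n * cutF1 ε t =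
      (24 * m1 * a * a + (6 * n - 24) * (m2 * a)) / t := by
    unfold cutF2 cutF1
    rw [← ha, ← hm1, ← hm2, ha]
    field_simp
    ring
  have hn' : (5 : ℝ) ≤ n := by exact_mod_cast hn
  have k1 : m1 * a * a ≤ 1 ∧ m1 * a * a ≤ a := by
    by_cases h : a ≤ 1
    · have : m1 * a * a ≤ 1 * a := by gcongr; exact h1.1
      constructor <;> nlinarith
    · have : m1 = 0 := by
        rw [hm1]; unfold mpow; rw [max_eq_right (by linarith)]; simp
      rw [this]; simp [ha0]
  rw [e]
  refine ⟨?_, ?_, ?_⟩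
  · have : 0 ≤ (6 * n - 24 : ℝ) := by linarith
    positivity
  · apply div_le_div_of_nonneg_right _ ht.le
    have : (6 * n - 24 : ℝ) * (m2 * a) ≤ (6 * n - 24) * 1 :=
      mul_le_mul_of_nonneg_left h2.1 (by linarith)
    nlinarith [k1.1, h2.1]
  · have : (24 * ε ^ 2 + 6 * n * ε ^ 2) / t ^ 2 = (24 * a + 6 * n * a) / t := by
      rw [ha]; field_simp
    rw [this]; apply div_le_div_of_nonneg_right _ ht.le
    have : (6 * n - 24 : ℝ) * (m2 * a) ≤ (6 * n - 24) * a :=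
      mul_le_mul_of_nonneg_left h2.2 (by linarith)
    nlinarith [k1.2, h2.2]

lemma lap_cut_bounds {n : ℕ} (hn : 5 ≤ n) (ε : ℝ) {x : EE n} (hx : x ≠ 0) :
    0 ≤ lap (cut ε) x ∧ lap (cut ε) x ≤ (24 + 6 * n) / ‖x‖ ^ 2 ∧
    lap (cut ε) x ≤ (24 * ε ^ 2 + 6 * n * ε ^ 2) / (‖x‖ ^ 2) ^ 2 := by
  have ht := nsq_pos hx
  rw [lap_cut ε hx]
  have := lapcut_bounds hn ε ht
  simpa using this

lemma cut_ev_zero {n : ℕ} {ε : ℝ} (hε : 0 < ε) : cut (n := n) ε =ᶠ[𝓝[≠] 0] 0 := by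
  have : ball (0 : EE n) ε ∈ 𝓝 (0 : EE n) := ball_mem_nhds _ hε
  rw [EventuallyEq, eventually_nhdsWithin_iff]
  filter_upwards [this] with x hx hx0
  have hx1 : ‖x‖ < ε := by simpa using hx
  have hx2 : 0 < ‖x‖ := norm_pos_iff.2 hx0
  have : 1 ≤ ε ^ 2 / ‖x - 0‖ ^ 2 := by
    rw [one_le_div (nsq_pos hx0)]; simp; gcongr
  simp only [cut, cutF, mpow]
  rw [max_eq_right (by linarith)]; simp

/-- the sequence of parameters. -/
noncomputable def es (k : ℕ) : ℝ := 1 / ((k : ℝ) + 1)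
lemma es_pos (k : ℕ) : 0 < es k := by unfold es; positivity
lemma es_tendsto : Tendsto es atTop (𝓝 0) := tendsto_one_div_add_atTop_nhds_zero_nat

lemma cut_tendsto {n : ℕ} (x : EE n) : Tendsto (fun k => cut (es k) x) atTop (𝓝 1) := by
  have h1 : Tendsto (fun k => 1 - es k ^ 2 / ‖x - 0‖ ^ 2) atTop (𝓝 (1 - 0 ^ 2 / ‖x - 0‖ ^ 2)) :=
    tendsto_const_nhds.sub ((es_tendsto.pow 2).div_const _)
  have := ((continuous_mpow 3).tendsto _).comp h1
  simp [mpow] at this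
  simpa [cut, cutF, mpow, Function.comp_def] using this

lemma ibp_lap' {n : ℕ} (hn : 5 ≤ n) {g ψ : EE n → ℝ} (hg : ∀ x ≠ 0, ContDiffAt ℝ 2 g x)
    (hψ : ∀ x ≠ 0, ContDiffAt ℝ 2 ψ x) (hgc : HasCompactSupport g) (h0 : ψ =ᶠ[𝓝[≠] 0] 0) :
    Integrable (fun x => ψ x * lap g x) ∧ Integrable (fun x => g x * lap ψ x) ∧
    ∫ x, ψ x * lap g x = ∫ x, g x * lap ψ x := by
  let ψ' := Function.update ψ 0 0
  have hev : ∀ x ≠ 0, ψ' =ᶠ[𝓝 x] ψ := by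
    intro x hx
    filter_upwards [isOpen_ne.mem_nhds hx] with y hy
    exact Function.update_of_ne hy _ _
  have h0' : ψ' =ᶠ[𝓝 0] 0 := by
    rw [EventuallyEq, eventually_nhdsWithin_iff] at h0
    filter_upwards [h0] with y hy
    by_cases h : y = 0
    · subst h; simp [ψ']
    · rw [← hy h]; exact Function.update_of_ne h _ _
  obtain ⟨a, b, c⟩ := ibp_lap hg (ψ := ψ') (fun x hx => (hψ x hx).congr_of_eventuallyEq (hev x hx))
    hgc h0'
  have e1 : (fun x => ψ' x * lap g x) =ᵐ[volume] fun x => ψ x * lap g x := by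
    filter_upwards [ae_ne_zero hn] with x hx
    rw [(hev x hx).eq_of_nhds]
  have e2 : (fun x => g x * lap ψ' x) =ᵐ[volume] fun x => g x * lap ψ x := by
    filter_upwards [ae_ne_zero hn] with x hx
    rw [(lap_congr (hev x hx)).eq_of_nhds]
  exact ⟨a.congr e1, b.congr e2, by rw [← integral_congr_ae e1, ← integral_congr_ae e2, c]⟩

open MeasureTheory Metric Filter Topology

lemma fatou_int {α : Type*} [MeasurableSpace α] {μ : Measure α} {G : ℕ → α → ℝ} {f : α → ℝ} {C : ℝ}
    (hlim : ∀ᵐ x ∂μ, Tendsto (fun k => G k x) atTop (𝓝 (f x)))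
    (hG : ∀ k, Integrable (G k) μ) (h0 : ∀ k, 0 ≤ᵐ[μ] G k) (hC : ∀ k, ∫ x, G k x ∂μ ≤ C) :
    Integrable f μ ∧ ∫ x, f x ∂μ ≤ C := by
  have hm : AEStronglyMeasurable f μ := aestronglyMeasurable_of_tendsto_ae _ (fun k => (hG k).1) hlim
  have hC0 : 0 ≤ C := le_trans (integral_nonneg_of_ae (h0 0)) (hC 0)
  have hf0 : 0 ≤ᵐ[μ] f := by
    filter_upwards [hlim, ae_all_iff.2 h0] with x h1 h2
    exact ge_of_tendsto' h1 h2
  have key : ∫⁻ x, ENNReal.ofReal (f x) ∂μ ≤ ENNReal.ofReal C := by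
    have e : ∫⁻ x, ENNReal.ofReal (f x) ∂μ = ∫⁻ x, liminf (fun k => ENNReal.ofReal (G k x)) atTop ∂μ := by
      refine lintegral_congr_ae ?_
      filter_upwards [hlim] with x hx
      exact ((ENNReal.tendsto_ofReal hx).liminf_eq).symm
    rw [e]
    refine (lintegral_liminf_le' (fun k => (hG k).1.aemeasurable.ennreal_ofReal)).trans ?_
    refine liminf_le_of_frequently_le' (Eventually.frequently (Eventually.of_forall fun k => ?_))
    rw [← ofReal_integral_eq_lintegral_ofReal (hG k) (h0 k)]
    exact ENNReal.ofReal_le_ofReal (hC k)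
  have hi : Integrable f μ := by
    refine ⟨hm, ?_⟩
    rw [hasFiniteIntegral_iff_ofReal hf0]
    exact key.trans_lt ENNReal.ofReal_lt_top
  refine ⟨hi, ?_⟩
  rw [integral_eq_lintegral_of_nonneg_ae hf0 hm]
  exact ENNReal.toReal_le_of_le_ofReal hC0 key

lemma aesm_of_cont {n : ℕ} (hn : 5 ≤ n) {f : EE n → ℝ} (hf : ∀ x ≠ 0, ContinuousAt f x) :
    AEStronglyMeasurable f volume := by
  have h1 : AEStronglyMeasurable f (volume.restrict ({0}ᶜ : Set (EE n))) :=
    ContinuousOn.aestronglyMeasurable (fun x hx => (hf x hx).continuousWithinAt)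
      (measurableSet_singleton 0).compl
  have e : (volume : Measure (EE n)).restrict ({0}ᶜ : Set (EE n)) = volume := by
    rw [Measure.restrict_eq_self_of_ae_mem]
    exact ae_ne_zero hn
  rwa [e] at h1

lemma offInt {n : ℕ} {f : EE n → ℝ} (hf : ∀ x ≠ 0, ContinuousAt f x) (hc : HasCompactSupport f)
    {ρ : ℝ} (hρ : 0 < ρ) : IntegrableOn f (ball 0 ρ)ᶜ := by
  have hK : IsCompact (tsupport f ∩ (ball (0 : EE n) ρ)ᶜ) := hc.isCompact.inter_right isOpen_ball.isClosed_compl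
  have h1 : IntegrableOn f (tsupport f ∩ (ball (0 : EE n) ρ)ᶜ) := by
    have hco : ContinuousOn f (tsupport f ∩ (ball (0 : EE n) ρ)ᶜ) := by
      intro x hx
      refine (hf x ?_).continuousWithinAt
      rintro rfl
      exact hx.2 (mem_ball_self hρ)
    exact hco.integrableOn_compact hK
  refine h1.of_forall_sdiff_eq_zero isOpen_ball.measurableSet.compl ?_
  intro x hx
  by_contra h
  exact hx.2 ⟨subset_tsupport f h, hx.1⟩

/-- functions superharmonic near the puncture. -/
structure SHC {n : ℕ} (g : EE n → ℝ) (ρ : ℝ) : Prop where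
  cd : ∀ x ≠ 0, ContDiffAt ℝ 2 g x
  cs : HasCompactSupport g
  ρpos : 0 < ρ
  nn : ∀ x ≠ 0, ‖x‖ < ρ → 0 ≤ g x
  sh : ∀ x ≠ 0, ‖x‖ < ρ → lap g x ≤ 0

noncomputable def NN {n : ℕ} (y : EE n) : ℝ := (fun t => 1 + Real.sqrt t) (‖y - 0‖ ^ 2)

lemma NN_eq {n : ℕ} (y : EE n) : NN y = 1 + ‖y‖ := by
  simp [NN, Real.sqrt_sq (norm_nonneg y)]

lemma NNd {t : ℝ} (ht : 0 < t) : HasDerivAt (fun t => 1 + Real.sqrt t) (1 / (2 * Real.sqrt t)) t :=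
  (Real.hasDerivAt_sqrt ht.ne').const_add 1

lemma NNd2 {t : ℝ} (ht : 0 < t) :
    HasDerivAt (fun t => 1 / (2 * Real.sqrt t)) (-1 / (4 * t * Real.sqrt t)) t := by
  have hs : 0 < Real.sqrt t := Real.sqrt_pos.2 ht
  have := ((Real.hasDerivAt_sqrt ht.ne').const_mul 2).inv (by positivity)
  refine (this.congr_of_eventuallyEq (Eventually.of_forall fun y => ?_)).congr_deriv ?_
  · simp
  · have e : t = Real.sqrt t ^ 2 := (Real.sq_sqrt ht.le).symm
    field_simp
    rw [← e]
    ring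

lemma pd_NN {n : ℕ} {x : EE n} (hx : x ≠ 0) (i : Fin n) : pd i NN x = x i / ‖x‖ := by
  have := pd_radial (x := 0) (NNd (nsq_pos hx)) i
  have h : 0 < ‖x‖ := norm_pos_iff.2 hx
  have e : (NN (n := n)) = fun y => (fun t => 1 + Real.sqrt t) (‖y - 0‖ ^ 2) := rfl
  rw [e, this]
  simp [Real.sqrt_sq (norm_nonneg x)]
  field_simp

lemma lap_NN {n : ℕ} {x : EE n} (hx : x ≠ 0) : lap NN x = (n - 1) / ‖x‖ := by
  have ht := nsq_pos hx
  have h : 0 < ‖x‖ := norm_pos_iff.2 hx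
  have := lap_radial (F := fun t => 1 + Real.sqrt t) (F' := fun t => 1 / (2 * Real.sqrt t)) (x := 0) (y := x)
    (by filter_upwards [Ioi_mem_nhds ht] with t h using NNd h) (NNd2 ht)
  have e : (NN (n := n)) = fun y => (fun t => 1 + Real.sqrt t) (‖y - 0‖ ^ 2) := rfl
  rw [e, this]
  simp [Real.sqrt_sq (norm_nonneg x)]
  field_simp
  ring

lemma NN_cd {n : ℕ} {x : EE n} (hx : x ≠ 0) : ContDiffAt ℝ 2 NN x := by
  have e : (NN (n := n)) = fun y => 1 + ‖y‖ := by funext y; exact NN_eq y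
  rw [e]
  exact contDiffAt_const.add (contDiffAt_norm ℝ hx)

lemma lap_psi {n : ℕ} (hn : 5 ≤ n) (ε : ℝ) {x : EE n} (hx : x ≠ 0) :
    cut ε x * ((n - 1) / ‖x‖) ≤ lap (fun y => NN y * cut ε y) x ∧
    lap (fun y => NN y * cut ε y) x ≤ (1 + ‖x‖) * ((24 + 6 * n) / ‖x‖ ^ 2) + (n - 1) / ‖x‖ + 12 / ‖x‖ := by
  have h : 0 < ‖x‖ := norm_pos_iff.2 hx
  rw [lap_mul (NN_cd hx) (cut_contDiffAt ε hx), lap_NN hx, NN_eq]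
  have e : ∑ i, pd i NN x * pd i (cut ε) x = 2 * cutF1 ε (‖x‖ ^ 2) * ‖x‖ := by
    have : ∀ i, pd i NN x * pd i (cut ε) x = 2 * cutF1 ε (‖x‖ ^ 2) / ‖x‖ * (x i) ^ 2 := by
      intro i; rw [pd_NN hx, pd_cut ε hx]; field_simp
    rw [Finset.sum_congr rfl (fun i _ => this i), ← Finset.mul_sum, ← EuclideanSpace.real_norm_sq_eq]
    field_simp
  rw [e]
  obtain ⟨b1, b2, -⟩ := lap_cut_bounds hn ε hx
  have c1 := cutF1_nonneg ε (t := ‖x‖ ^ 2)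
  have c2 := (cutF1_le ε (t := ‖x‖ ^ 2) (by positivity)).1
  have hn' : (5 : ℝ) ≤ n := by exact_mod_cast hn
  have d1 := cut_nonneg ε x
  have d2 := cut_le_one ε x
  constructor
  · have : 0 ≤ (1 + ‖x‖) * lap (cut ε) x := by positivity
    have : 0 ≤ 2 * (2 * cutF1 ε (‖x‖ ^ 2) * ‖x‖) := by positivity
    linarith
  · have e1 : (1 + ‖x‖) * lap (cut ε) x ≤ (1 + ‖x‖) * ((24 + 6 * n) / ‖x‖ ^ 2) := by gcongr
    have e2 : cut ε x * ((n - 1) / ‖x‖) ≤ 1 * ((n - 1) / ‖x‖) := by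
      have : 0 ≤ (n - 1 : ℝ) / ‖x‖ := div_nonneg (by linarith) h.le
      gcongr
    have e3 : 2 * (2 * cutF1 ε (‖x‖ ^ 2) * ‖x‖) ≤ 12 / ‖x‖ := by
      calc 2 * (2 * cutF1 ε (‖x‖ ^ 2) * ‖x‖) ≤ 2 * (2 * (3 / ‖x‖ ^ 2) * ‖x‖) := by gcongr
        _ = 12 / ‖x‖ := by field_simp; norm_num
    linarith

namespace SHC
variable {n : ℕ} {g : EE n → ℝ} {ρ : ℝ}

lemma contg (h : SHC g ρ) : ∀ x ≠ 0, ContinuousAt g x := fun x hx => (h.cd x hx).continuousAt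
lemma contlap (h : SHC g ρ) : ∀ x ≠ 0, ContinuousAt (lap g) x := fun x hx =>
  (contDiffAt_lap (m := 0) (k := 2) (by simp) (h.cd x hx)).continuousAt

lemma int_main (hn : 5 ≤ n) (h : SHC g ρ) :
    Integrable (fun x => g x / ‖x‖) ∧ Integrable (lap g) := by
  have hn' : (5 : ℝ) ≤ n := by exact_mod_cast hn
  let D : EE n → ℝ := fun x => (1 + ‖x‖) * |lap g x| +
    ((1 + ‖x‖) * ((24 + 6 * n) / ‖x‖ ^ 2) + (n - 1) / ‖x‖ + 12 / ‖x‖) * |g x|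
  have Dint : IntegrableOn D (ball 0 ρ)ᶜ := by
    refine offInt (fun x hx => ?_) ?_ h.ρpos
    · have h1 := h.contg x hx
      have h2 := h.contlap x hx
      have : ‖x‖ ≠ 0 := norm_ne_zero_iff.2 hx
      have h3 : ContinuousAt (fun x : EE n => ‖x‖) x := continuous_norm.continuousAt
      refine ContinuousAt.add ((continuousAt_const.add h3).mul h2.abs) (ContinuousAt.mul ?_ h1.abs)
      refine ((((continuousAt_const.add h3).mul (continuousAt_const.div (h3.pow 2) ?_))).add
        (continuousAt_const.div h3 this)).add (continuousAt_const.div h3 this)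
      exact pow_ne_zero 2 this
    · refine HasCompactSupport.add ?_ ?_
      · exact ((hcs_lap h.cs).norm).mul_left
      · exact (h.cs.norm).mul_left
  let Y : EE n → ℝ := fun x => (n - 1) * (g x / ‖x‖) - lap g x
  have Y0 : ∀ x ∈ ball (0 : EE n) ρ, x ≠ 0 → 0 ≤ Y x := by
    intro x hx hx0
    have hx' : ‖x‖ < ρ := by simpa using hx
    have := h.nn x hx0 hx'
    have h2 := h.sh x hx0 hx'
    have : 0 ≤ (n - 1 : ℝ) * (g x / ‖x‖) := mul_nonneg (by linarith) (by positivity)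
    simp only [Y]; linarith
  have Ym : AEStronglyMeasurable Y volume := by
    refine aesm_of_cont hn (fun x hx => ?_)
    have : ‖x‖ ≠ 0 := norm_ne_zero_iff.2 hx
    exact (continuousAt_const.mul ((h.contg x hx).div continuous_norm.continuousAt this)).sub
      (h.contlap x hx)
  have cutm : ∀ ε, AEStronglyMeasurable (cut (n := n) ε) volume := fun ε =>
    aesm_of_cont hn (fun x hx => (cut_contDiffAt ε hx).continuousAt)
  have step : ∀ k, IntegrableOn (fun x => cut (es k) x * Y x) (ball 0 ρ) ∧
      ∫ x in ball 0 ρ, cut (es k) x * Y x ≤ ∫ x in (ball 0 ρ)ᶜ, D x := by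
    intro k
    set ε := es k
    have hz : (fun y : EE n => NN y * cut ε y) =ᶠ[𝓝[≠] 0] 0 := by
      filter_upwards [cut_ev_zero (n := n) (es_pos k)] with y hy
      simp [ε, hy]
    obtain ⟨i1, i2, i3⟩ := ibp_lap' hn h.cd (ψ := fun y => NN y * cut ε y)
      (fun x hx => (NN_cd hx).mul (cut_contDiffAt ε hx)) h.cs hz
    let X : EE n → ℝ := fun x => g x * lap (fun y => NN y * cut ε y) x - (NN x * cut ε x) * lap g x
    have Xi : Integrable X := i2.sub i1
    have X0 : ∫ x, X x = 0 := by
      simp only [X]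
      rw [integral_sub i2 i1, i3, sub_self]
    have split := integral_add_compl (μ := volume) (s := ball (0 : EE n) ρ) isOpen_ball.measurableSet Xi
    have YX : ∀ x ∈ ball (0 : EE n) ρ, x ≠ 0 → cut ε x * Y x ≤ X x := by
      intro x hx hx0
      have hx' : ‖x‖ < ρ := by simpa using hx
      have a1 := h.nn x hx0 hx'
      have a2 := h.sh x hx0 hx'
      have a3 := (lap_psi hn ε hx0).1
      have a4 := mul_le_mul_of_nonneg_left a3 a1
      have a5 : cut ε x * (-lap g x) ≤ NN x * cut ε x * (- lap g x) := by
        have : cut ε x ≤ NN x * cut ε x := by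
          rw [NN_eq]; nlinarith [cut_nonneg ε x, norm_nonneg x]
        exact mul_le_mul_of_nonneg_right this (by linarith)
      have e : cut ε x * Y x = g x * (cut ε x * ((n - 1) / ‖x‖)) + cut ε x * (-lap g x) := by
        simp only [Y]; ring
      rw [e]; simp only [X]; linarith
    have aeb : ∀ᵐ x ∂(volume.restrict (ball (0 : EE n) ρ)), x ∈ ball (0 : EE n) ρ ∧ x ≠ 0 := by
      filter_upwards [ae_restrict_mem (μ := volume) (isOpen_ball (x := (0 : EE n)) (ε := ρ)).measurableSet,
        ae_restrict_of_ae (ae_ne_zero hn)] with x h1 h2 using ⟨h1, h2⟩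
    have Yi : IntegrableOn (fun x => cut ε x * Y x) (ball 0 ρ) := by
      refine Integrable.mono' (Xi.restrict (s := ball 0 ρ)) ((cutm ε).mul Ym).restrict ?_
      filter_upwards [aeb] with x hx
      rw [Real.norm_of_nonneg (mul_nonneg (cut_nonneg _ _) (Y0 x hx.1 hx.2))]
      exact YX x hx.1 hx.2
    refine ⟨Yi, ?_⟩
    calc ∫ x in ball 0 ρ, cut ε x * Y x ≤ ∫ x in ball 0 ρ, X x := by
          refine integral_mono_ae Yi (Xi.restrict) ?_
          filter_upwards [aeb] with x hx using YX x hx.1 hx.2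
      _ = ∫ x in (ball 0 ρ)ᶜ, - X x := by rw [integral_neg]; linarith
      _ ≤ ∫ x in (ball 0 ρ)ᶜ, D x := by
          refine integral_mono_ae (Xi.restrict.neg) Dint ?_
          filter_upwards [ae_restrict_of_ae (ae_ne_zero hn)] with x hx
          have b1 := (lap_psi hn ε hx)
          have b2 : |lap (fun y => NN y * cut ε y) x| ≤
            (1 + ‖x‖) * ((24 + 6 * n) / ‖x‖ ^ 2) + (n - 1) / ‖x‖ + 12 / ‖x‖ := by
            rw [abs_of_nonneg]
            · exact b1.2
            · refine le_trans ?_ b1.1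
              exact mul_nonneg (cut_nonneg _ _) (div_nonneg (by linarith) (norm_nonneg _))
          have b3 : |NN x * cut ε x| ≤ 1 + ‖x‖ := by
            rw [NN_eq, abs_of_nonneg (mul_nonneg (by positivity) (cut_nonneg _ _))]
            exact mul_le_of_le_one_right (by positivity) (cut_le_one _ _)
          simp only [Pi.neg_apply, X, D]
          refine (le_abs_self _).trans ?_
          rw [abs_neg]
          refine (abs_sub _ _).trans ?_
          rw [abs_mul, abs_mul, add_comm]
          refine add_le_add (mul_le_mul_of_nonneg_right b3 (abs_nonneg _)) ?_
          rw [mul_comm]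
          exact mul_le_mul_of_nonneg_right b2 (abs_nonneg _)
  have aeb : ∀ᵐ x ∂(volume.restrict (ball (0 : EE n) ρ)), x ∈ ball (0 : EE n) ρ ∧ x ≠ 0 := by
      filter_upwards [ae_restrict_mem (μ := volume) (isOpen_ball (x := (0 : EE n)) (ε := ρ)).measurableSet,
        ae_restrict_of_ae (ae_ne_zero hn)] with x h1 h2 using ⟨h1, h2⟩
  have hY : IntegrableOn Y (ball 0 ρ) := by
    refine (fatou_int (G := fun k x => cut (es k) x * Y x) (C := ∫ x in (ball 0 ρ)ᶜ, D x) ?_ (fun k => (step k).1) ?_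
      (fun k => (step k).2)).1
    · refine Eventually.of_forall fun x => ?_
      have := (cut_tendsto x).mul_const (Y x)
      simpa using this
    · intro k
      filter_upwards [aeb] with x hx
      exact mul_nonneg (cut_nonneg _ _) (Y0 x hx.1 hx.2)
  have m1 : ∀ x ≠ 0, ContinuousAt (fun x => g x / ‖x‖) x := fun x hx =>
    (h.contg x hx).div continuous_norm.continuousAt (norm_ne_zero_iff.2 hx)
  have cs1 : HasCompactSupport (fun x => g x / ‖x‖) := by
    simp only [div_eq_mul_inv]; exact h.cs.mul_right
  constructor
  · rw [← integrableOn_univ, ← Set.union_compl_self (ball (0 : EE n) ρ), integrableOn_union]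
    refine ⟨?_, offInt m1 cs1 h.ρpos⟩
    refine Integrable.mono' hY (aesm_of_cont hn m1).restrict ?_
    filter_upwards [aeb] with x hx
    have hx' : ‖x‖ < ρ := by simpa using hx.1
    have a1 := h.nn x hx.2 hx'
    have a2 := h.sh x hx.2 hx'
    have a3 : 0 ≤ g x / ‖x‖ := by positivity
    rw [Real.norm_of_nonneg a3]
    simp only [Y]; nlinarith
  · rw [← integrableOn_univ, ← Set.union_compl_self (ball (0 : EE n) ρ), integrableOn_union]
    refine ⟨?_, offInt h.contlap (hcs_lap h.cs) h.ρpos⟩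
    refine Integrable.mono' hY (aesm_of_cont hn h.contlap).restrict ?_
    filter_upwards [aeb] with x hx
    have hx' : ‖x‖ < ρ := by simpa using hx.1
    have a1 := h.nn x hx.2 hx'
    have a2 := h.sh x hx.2 hx'
    have a3 : 0 ≤ g x / ‖x‖ := by positivity
    rw [Real.norm_of_nonpos a2]
    simp only [Y]; nlinarith
end SHC

open MeasureTheory Metric Filter Topology

lemma cmul_int {n : ℕ} {f c : EE n → ℝ} (hf : Integrable f) (hc : HasCompactSupport f)
    (hcc : Continuous c) : Integrable (fun x => c x * f x) := by
  have h1 : IntegrableOn (fun x => c x * f x) (tsupport f) :=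
    hf.integrableOn.continuousOn_mul hcc.continuousOn hc.isCompact
  have := h1.of_forall_sdiff_eq_zero (t := Set.univ) MeasurableSet.univ (fun x hx => by
    rw [image_eq_zero_of_notMem_tsupport hx.2, mul_zero])
  rwa [integrableOn_univ] at this

lemma cont_lap_of_contDiff {n : ℕ} {P : EE n → ℝ} (hP : ContDiff ℝ 2 P) : Continuous (lap P) :=
  continuous_iff_continuousAt.2 fun x =>
    (contDiffAt_lap (m := 0) (k := 2) (by simp) hP.contDiffAt).continuousAt

namespace SHC
variable {n : ℕ} {g : EE n → ℝ} {ρ : ℝ}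

lemma int_g (hn : 5 ≤ n) (h : SHC g ρ) : Integrable g := by
  have h1 := (h.int_main hn).1
  have cs1 : HasCompactSupport (fun x => g x / ‖x‖) := by
    simp only [div_eq_mul_inv]; exact h.cs.mul_right
  refine (cmul_int h1 cs1 continuous_norm).congr ?_
  filter_upwards [ae_ne_zero hn] with x hx
  have : ‖x‖ ≠ 0 := norm_ne_zero_iff.2 hx
  field_simp

lemma lapint_nonneg (hn : 5 ≤ n) (h : SHC g ρ) : 0 ≤ ∫ x, lap g x := by
  have hL := (h.int_main hn).2
  have h1 : Tendsto (fun k => ∫ x, cut (es k) x * lap g x) atTop (𝓝 (∫ x, lap g x)) := by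
    refine tendsto_integral_of_dominated_convergence (fun x => |lap g x|) ?_ hL.abs ?_ ?_
    · intro k
      exact (aesm_of_cont hn (fun x hx => (cut_contDiffAt _ hx).continuousAt)).mul hL.1
    · intro k
      refine Eventually.of_forall fun x => ?_
      rw [norm_mul, Real.norm_of_nonneg (cut_nonneg _ _), Real.norm_eq_abs]
      exact mul_le_of_le_one_left (abs_nonneg _) (cut_le_one _ _)
    · refine Eventually.of_forall fun x => ?_
      simpa using (cut_tendsto x).mul_const (lap g x)
  have hb : IntegrableOn (fun x => |g x| * ((24 + 6 * n) / (‖x‖ ^ 2) ^ 2)) (ball 0 ρ)ᶜ := by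
    refine offInt (fun x hx => ?_) (h.cs.norm.mul_right) h.ρpos
    refine (h.contg x hx).abs.mul (continuousAt_const.div ?_ ?_)
    · exact (continuous_norm.continuousAt.pow 2).pow 2
    · have : ‖x‖ ≠ 0 := norm_ne_zero_iff.2 hx
      positivity
  set A := ∫ x in (ball 0 ρ)ᶜ, |g x| * ((24 + 6 * n) / (‖x‖ ^ 2) ^ 2)
  have h2 : ∀ k, - (es k) ^ 2 * A ≤ ∫ x, cut (es k) x * lap g x := by
    intro k
    obtain ⟨i1, i2, i3⟩ := ibp_lap' hn h.cd (ψ := cut (es k))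
      (fun x hx => cut_contDiffAt _ hx) h.cs (cut_ev_zero (es_pos k))
    rw [i3, ← integral_add_compl (μ := volume) (s := ball (0 : EE n) ρ) isOpen_ball.measurableSet i2]
    have p1 : 0 ≤ ∫ x in ball 0 ρ, g x * lap (cut (es k)) x := by
      refine integral_nonneg_of_ae ?_
      filter_upwards [ae_restrict_mem (μ := volume) (isOpen_ball (x := (0 : EE n)) (ε := ρ)).measurableSet,
        ae_restrict_of_ae (ae_ne_zero hn)] with x h1 h2
      exact mul_nonneg (h.nn x h2 (by simpa using h1)) (lap_cut_bounds hn _ h2).1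
    have p2 : - (es k) ^ 2 * A ≤ ∫ x in (ball 0 ρ)ᶜ, g x * lap (cut (es k)) x := by
      rw [← integral_const_mul]
      refine integral_mono_ae (hb.const_mul _) i2.restrict ?_
      filter_upwards [ae_restrict_of_ae (ae_ne_zero hn)] with x hx
      obtain ⟨b1, -, b2⟩ := lap_cut_bounds hn (es k) hx
      have : |g x * lap (cut (es k)) x| ≤ (es k) ^ 2 * (|g x| * ((24 + 6 * n) / (‖x‖ ^ 2) ^ 2)) := by
        rw [abs_mul, abs_of_nonneg b1]
        calc |g x| * lap (cut (es k)) x ≤ |g x| * ((24 * es k ^ 2 + 6 * n * es k ^ 2) / (‖x‖ ^ 2) ^ 2) := by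
              gcongr
          _ = _ := by ring
      have := neg_abs_le (g x * lap (cut (es k)) x)
      linarith
    linarith
  have h3 : Tendsto (fun k => - (es k) ^ 2 * A) atTop (𝓝 0) := by
    have := ((es_tendsto.pow 2).neg).mul_const A
    simpa using this
  exact le_of_tendsto_of_tendsto' h3 h1 h2

lemma test (hn : 5 ≤ n) (h : SHC g ρ) {P : EE n → ℝ} (hP : ContDiff ℝ 2 P) :
    Integrable (fun x => P x * lap g x) ∧ Integrable (fun x => g x * lap P x) ∧
    ∫ x, P x * lap g x = (∫ x, g x * lap P x) + P 0 * ∫ x, lap g x := by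
  obtain ⟨hgr, hL⟩ := h.int_main hn
  have hg := h.int_g hn
  have cs1 : HasCompactSupport (fun x => g x / ‖x‖) := by
    simp only [div_eq_mul_inv]; exact h.cs.mul_right
  have I1 : Integrable (fun x => P x * lap g x) := cmul_int hL (hcs_lap h.cs) hP.continuous
  have I2 : Integrable (fun x => g x * lap P x) := by
    have := cmul_int hg h.cs (cont_lap_of_contDiff hP)
    simpa [mul_comm] using this
  refine ⟨I1, I2, ?_⟩
  let Q : EE n → ℝ := fun x => P x - P 0
  have hQ : ContDiff ℝ 2 Q := hP.sub contDiff_const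
  have lapQ : ∀ x, lap Q x = lap P x := fun x => lap_sub_const P (P 0) x
  have J1 : Integrable (fun x => Q x * lap g x) := cmul_int hL (hcs_lap h.cs) hQ.continuous
  -- bounds
  obtain ⟨M, hM⟩ : ∃ M, tsupport g ⊆ closedBall 0 M := h.cs.isCompact.isBounded.subset_closedBall 0
  obtain ⟨A, hA⟩ := (isCompact_closedBall (0 : EE n) M).exists_bound_of_continuousOn
    (hQ.continuous_fderiv (by simp)).continuousOn
  obtain ⟨B, hB⟩ := (isCompact_closedBall (0 : EE n) M).exists_bound_of_continuousOn
    (cont_lap_of_contDiff hQ).continuousOn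
  have Qb : ∀ x ∈ closedBall (0 : EE n) M, |Q x| ≤ A * ‖x‖ := by
    intro x hx
    have hM0 : 0 ≤ M := by
      have := hx
      rw [mem_closedBall, dist_zero_right] at this
      exact (norm_nonneg x).trans this
    have := (convex_closedBall (0 : EE n) M).norm_image_sub_le_of_norm_fderiv_le (𝕜 := ℝ) (f := Q)
      (C := A) (x := 0) (y := x) (fun y _ => hQ.differentiable (by simp) y) hA (mem_closedBall_self hM0) hx
    simpa [Q] using this
  have pb : ∀ x ∈ closedBall (0 : EE n) M, ∀ i, |pd i Q x| ≤ A := by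
    intro x hx i
    refine (((fderiv ℝ Q x).le_opNorm (bv i))).trans ?_
    simpa [bv] using hA x hx
  let T : ℝ → EE n → ℝ := fun ε x => Q x * lap (cut ε) x + cut ε x * lap Q x +
    2 * ∑ i, pd i Q x * pd i (cut ε) x
  have hibp : ∀ k, ∫ x, (Q x * cut (es k) x) * lap g x = ∫ x, g x * T (es k) x := by
    intro k
    have hz : (fun y : EE n => Q y * cut (es k) y) =ᶠ[𝓝[≠] 0] 0 := by
      filter_upwards [cut_ev_zero (n := n) (es_pos k)] with y hy
      simp [hy]
    obtain ⟨i1, i2, i3⟩ := ibp_lap' hn h.cd (ψ := fun y => Q y * cut (es k) y)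
      (fun x hx => hQ.contDiffAt.mul (cut_contDiffAt _ hx)) h.cs hz
    rw [i3]
    refine integral_congr_ae ?_
    filter_upwards [ae_ne_zero hn] with x hx
    rw [lap_mul hQ.contDiffAt (cut_contDiffAt _ hx)]
  have L1 : Tendsto (fun k => ∫ x, (Q x * cut (es k) x) * lap g x) atTop (𝓝 (∫ x, Q x * lap g x)) := by
    refine tendsto_integral_of_dominated_convergence (fun x => |Q x * lap g x|) ?_ J1.abs ?_ ?_
    · intro k
      exact (hQ.continuous.aestronglyMeasurable.mul
        (aesm_of_cont hn (fun x hx => (cut_contDiffAt _ hx).continuousAt))).mul hL.1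
    · intro k
      refine Eventually.of_forall fun x => ?_
      have : Q x * cut (es k) x * lap g x = cut (es k) x * (Q x * lap g x) := by ring
      rw [this, norm_mul, Real.norm_of_nonneg (cut_nonneg _ _), Real.norm_eq_abs]
      exact mul_le_of_le_one_left (abs_nonneg _) (cut_le_one _ _)
    · refine Eventually.of_forall fun x => ?_
      have := ((cut_tendsto x).const_mul (Q x)).mul_const (lap g x)
      simpa using this
  have pdcut : ∀ k (x : EE n), x ≠ 0 → ∀ i, |pd i (cut (es k)) x| ≤ 6 / ‖x‖ ∧
      |pd i (cut (es k)) x| ≤ 6 * es k ^ 2 / ‖x‖ ^ 3 := by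
    intro k x hx i
    have hx0 : 0 < ‖x‖ := norm_pos_iff.2 hx
    have hxi : |x i| ≤ ‖x‖ := by simpa using EuclideanSpace.norm_eq x ▸ (PiLp.norm_apply_le x i)
    have c1 := cutF1_nonneg (es k) (t := ‖x‖ ^ 2)
    obtain ⟨c2, c3⟩ := cutF1_le (es k) (t := ‖x‖ ^ 2) (by positivity)
    rw [pd_cut _ hx, abs_mul, abs_of_nonneg (by positivity)]
    constructor
    · calc 2 * cutF1 (es k) (‖x‖ ^ 2) * |x i| ≤ 2 * (3 / ‖x‖ ^ 2) * ‖x‖ := by gcongr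
        _ = 6 / ‖x‖ := by field_simp; norm_num
    · calc 2 * cutF1 (es k) (‖x‖ ^ 2) * |x i| ≤ 2 * (3 * es k ^ 2 / (‖x‖ ^ 2) ^ 2) * ‖x‖ := by gcongr
        _ = _ := by field_simp; ring
  have L2 : Tendsto (fun k => ∫ x, g x * T (es k) x) atTop (𝓝 (∫ x, g x * lap P x)) := by
    let C0 : ℝ := A * (24 + 6 * n) + 2 * (n * (A * 6))
    refine tendsto_integral_of_dominated_convergence (fun x => C0 * |g x / ‖x‖| + B * |g x|) ?_
      ((hgr.abs.const_mul _).add (hg.abs.const_mul _)) ?_ ?_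
    · intro k
      refine hg.1.mul (aesm_of_cont hn (fun x hx => ?_))
      have q1 := cut_contDiffAt (n := n) (es k) hx
      have q2 := (contDiffAt_lap (m := 0) (k := 2) (by simp) q1).continuousAt
      refine ((hQ.continuous.continuousAt.mul q2).add (q1.continuousAt.mul
        (cont_lap_of_contDiff hQ).continuousAt)).add (continuousAt_const.mul ?_)
      refine tendsto_finsetSum _ (fun i _ => ?_)
      exact (contDiffAt_pd (m := 1) (k := 2) (by norm_num) hQ.contDiffAt i).continuousAt.mul
        (contDiffAt_pd (m := 1) (k := 2) (by norm_num) q1 i).continuousAt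
    · intro k
      filter_upwards [ae_ne_zero hn] with x hx
      have hx0 : 0 < ‖x‖ := norm_pos_iff.2 hx
      by_cases hxs : x ∈ tsupport g
      swap
      · rw [image_eq_zero_of_notMem_tsupport hxs]; simp
      have hxM := hM hxs
      obtain ⟨b1, b2, -⟩ := lap_cut_bounds hn (es k) hx
      have t1 : |Q x * lap (cut (es k)) x| ≤ A * (24 + 6 * n) / ‖x‖ := by
        rw [abs_mul, abs_of_nonneg b1]
        calc _ ≤ (A * ‖x‖) * ((24 + 6 * n) / ‖x‖ ^ 2) :=
              mul_le_mul (Qb x hxM) b2 b1 ((abs_nonneg _).trans (Qb x hxM))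
          _ = _ := by field_simp
      have t2 : |cut (es k) x * lap Q x| ≤ B := by
        rw [abs_mul, abs_of_nonneg (cut_nonneg _ _)]
        exact (mul_le_of_le_one_left (abs_nonneg _) (cut_le_one _ _)).trans (hB x hxM)
      have t3 : |∑ i, pd i Q x * pd i (cut (es k)) x| ≤ n * (A * (6 / ‖x‖)) := by
        refine (Finset.abs_sum_le_sum_abs _ _).trans ?_
        refine (Finset.sum_le_card_nsmul _ _ (A * (6 / ‖x‖)) (fun i _ => ?_)).trans ?_
        · rw [abs_mul]
          exact mul_le_mul (pb x hxM i) (pdcut k x hx i).1 (abs_nonneg _) ((abs_nonneg _).trans (pb x hxM i))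
        · simp
      have tt : |T (es k) x| ≤ C0 / ‖x‖ + B := by
        have : C0 / ‖x‖ + B = A * (24 + 6 * n) / ‖x‖ + B + 2 * (n * (A * (6 / ‖x‖))) := by
          simp only [C0]; ring
        rw [this]
        refine (abs_add_le _ _).trans (add_le_add ((abs_add_le _ _).trans (add_le_add t1 t2)) ?_)
        rw [abs_mul, abs_two]
        linarith
      rw [Real.norm_eq_abs, abs_mul]
      calc |g x| * |T (es k) x| ≤ |g x| * (C0 / ‖x‖ + B) := by gcongr
        _ = C0 * |g x / ‖x‖| + B * |g x| := by
          rw [abs_div, abs_of_pos hx0]; ring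
    · filter_upwards [ae_ne_zero hn] with x hx
      have hx0 : 0 < ‖x‖ := norm_pos_iff.2 hx
      have s0 : Tendsto (fun k => es k ^ 2) atTop (𝓝 0) := by simpa using es_tendsto.pow 2
      have t1 : Tendsto (fun k => lap (cut (es k)) x) atTop (𝓝 0) := by
        refine squeeze_zero (fun k => (lap_cut_bounds hn (es k) hx).1)
          (fun k => (lap_cut_bounds hn (es k) hx).2.2) ?_
        have := ((s0.const_mul (24 : ℝ)).add (s0.const_mul (6 * n : ℝ))).div_const ((‖x‖ ^ 2) ^ 2)
        simpa using this
      have t3 : ∀ i, Tendsto (fun k => pd i (cut (es k)) x) atTop (𝓝 0) := by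
        intro i
        refine squeeze_zero_norm (fun k => (pdcut k x hx i).2) ?_
        have := (s0.const_mul (6 : ℝ)).div_const (‖x‖ ^ 3)
        simpa using this
      have t4 : Tendsto (fun k => ∑ i, pd i Q x * pd i (cut (es k)) x) atTop (𝓝 (∑ i : Fin n, pd i Q x * 0)) :=
        tendsto_finsetSum _ (fun i _ => (t3 i).const_mul _)
      have := (((t1.const_mul (Q x)).add ((cut_tendsto x).mul_const (lap Q x))).add (t4.const_mul 2)).const_mul (g x)
      simpa [T, lapQ] using this
  have key : ∫ x, Q x * lap g x = ∫ x, g x * lap P x :=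
    tendsto_nhds_unique L1 (by simpa only [hibp] using L2)
  have e : ∫ x, Q x * lap g x = (∫ x, P x * lap g x) - P 0 * ∫ x, lap g x := by
    rw [← integral_const_mul, ← integral_sub I1 (hL.const_mul _)]
    congr 1; funext x; simp only [Q]; ring
  linarith
end SHC

open MeasureTheory Metric Filter Topology

/-- Riesz kernel of biharmonic type. -/
noncomputable def rker {n : ℕ} (z : EE n) : ℝ := (‖z‖ ^ (n - 4))⁻¹

lemma ker_nonneg {n : ℕ} (z : EE n) : 0 ≤ rker z := by unfold rker; positivity

lemma ker_pos {n : ℕ} {z : EE n} (hz : z ≠ 0) : 0 < rker z := by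
  have : 0 < ‖z‖ := norm_pos_iff.2 hz
  unfold rker; positivity

lemma ker_sub_comm {n : ℕ} (x y : EE n) : rker (x - y) = rker (y - x) := by
  unfold rker; rw [norm_sub_rev]

lemma ker_meas {n : ℕ} : Measurable (rker : EE n → ℝ) := by unfold rker; fun_prop

lemma ker_le {n : ℕ} {z : EE n} {σ : ℝ} (hσ : 0 < σ) (h : σ ≤ ‖z‖) : rker z ≤ (σ ^ (n - 4))⁻¹ := by
  unfold rker; gcongr

lemma ker_int_ball {n : ℕ} (hn : 5 ≤ n) (r : ℝ) : IntegrableOn (rker : EE n → ℝ) (ball 0 r) := by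
  refine integrableOn_ball_of_norm_le_rpow (C := 1) (α := ((n - 4 : ℕ) : ℝ)) (by simp; omega) ?_ ?_
    ker_meas.aestronglyMeasurable
  · simp; omega
  · refine Eventually.of_forall fun x => ?_
    rw [Real.norm_of_nonneg (ker_nonneg x), Real.rpow_neg (norm_nonneg x), Real.rpow_natCast, one_mul]
    rfl

/-- constant. -/
noncomputable def c1 (n : ℕ) : ℝ := ∫ z in ball (0 : EE n) 1, rker z

lemma c1_nonneg (n : ℕ) : 0 ≤ c1 n := integral_nonneg (fun z => ker_nonneg z)

open scoped Pointwise in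
lemma ker_integral_ball0 {n : ℕ} (hn : 5 ≤ n) {σ : ℝ} (hσ : 0 < σ) :
    ∫ z in ball (0 : EE n) σ, rker z = c1 n * σ ^ 4 := by
  have h := Measure.setIntegral_comp_smul_of_pos (μ := (volume : Measure (EE n))) (fun z => rker z) (ball 0 1) hσ
  have e : σ • ball (0 : EE n) 1 = ball 0 σ := by
    rw [_root_.smul_ball hσ.ne']; simp [abs_of_pos hσ]
  rw [e] at h
  have e2 : ∀ z : EE n, rker (σ • z) = (σ ^ (n - 4))⁻¹ * rker z := by
    intro z; unfold rker; rw [norm_smul, Real.norm_of_nonneg hσ.le, mul_pow, mul_inv]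
  simp only [e2] at h
  rw [integral_const_mul] at h
  have hf : Module.finrank ℝ (EE n) = (n - 4) + 4 := by simp; omega
  rw [hf] at h
  have p : σ ^ (n - 4) ≠ 0 := by positivity
  unfold c1
  simp only [smul_eq_mul] at h
  rw [pow_add] at h
  field_simp at h
  linarith

lemma ker_int_ball_sub {n : ℕ} (hn : 5 ≤ n) (x : EE n) (r : ℝ) :
    IntegrableOn (fun y => rker (x - y)) (ball x r) := by
  have h := (integrable_indicator_iff (isOpen_ball (x := (0 : EE n)) (ε := r)).measurableSet).2
    (ker_int_ball hn r)
  have h2 := h.comp_sub_left x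
  rw [← integrable_indicator_iff isOpen_ball.measurableSet]
  refine h2.congr (Eventually.of_forall fun y => ?_)
  have : (x - y ∈ ball (0 : EE n) r) ↔ (y ∈ ball x r) := by
    simp [dist_eq_norm, norm_sub_rev]
  show (ball 0 r).indicator rker (x - y) = _
  by_cases h : y ∈ ball x r
  · rw [Set.indicator_of_mem h, Set.indicator_of_mem (this.2 h)]
  · rw [Set.indicator_of_notMem h, Set.indicator_of_notMem (fun h' => h (this.1 h'))]

lemma ker_integral_ball {n : ℕ} (hn : 5 ≤ n) (x : EE n) {σ : ℝ} (hσ : 0 < σ) :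
    ∫ y in ball x σ, rker (x - y) = c1 n * σ ^ 4 := by
  rw [← ker_integral_ball0 hn hσ, ← integral_indicator isOpen_ball.measurableSet,
    ← integral_indicator isOpen_ball.measurableSet,
    ← integral_sub_left_eq_self (fun z => (ball (0 : EE n) σ).indicator (fun z => rker z) z) volume x]
  congr 1; funext y
  have : (x - y ∈ ball (0 : EE n) σ) ↔ (y ∈ ball x σ) := by
    simp [dist_eq_norm, norm_sub_rev]
  by_cases h : y ∈ ball x σ
  · rw [Set.indicator_of_mem h, Set.indicator_of_mem (this.2 h)]
  · rw [Set.indicator_of_notMem h, Set.indicator_of_notMem (fun h' => h (this.1 h'))]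

lemma ker_mul_bound {n : ℕ} {G : EE n → ℝ} {x : EE n} {σ B : ℝ} (hσ : 0 < σ) (hB : 0 ≤ B)
    (hG : ∀ y ∈ ball x σ, y ≠ 0 → |G y| ≤ B) (y : EE n) (hy : y ≠ 0) :
    |rker (x - y) * G y| ≤ B * (ball x σ).indicator (fun y => rker (x - y)) y + (σ ^ (n - 4))⁻¹ * |G y| := by
  rw [abs_mul, abs_of_nonneg (ker_nonneg _)]
  have h2 : 0 ≤ (σ ^ (n - 4))⁻¹ * |G y| := by positivity
  by_cases h : y ∈ ball x σ
  · rw [Set.indicator_of_mem h]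
    have := mul_le_mul_of_nonneg_left (hG y h hy) (ker_nonneg (x - y))
    linarith
  · rw [Set.indicator_of_notMem h]
    have : σ ≤ ‖x - y‖ := by
      rw [mem_ball, not_lt, dist_comm, dist_eq_norm] at h; exact h
    have := mul_le_mul_of_nonneg_right (ker_le hσ this) (abs_nonneg (G y))
    linarith

lemma ker_mul_int {n : ℕ} (hn : 5 ≤ n) {G : EE n → ℝ} (hGi : Integrable G) {x : EE n} {σ B : ℝ}
    (hσ : 0 < σ) (hB : 0 ≤ B) (hG : ∀ y ∈ ball x σ, y ≠ 0 → |G y| ≤ B) :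
    Integrable (fun y => rker (x - y) * G y) ∧
    ∫ y, |rker (x - y) * G y| ≤ B * (c1 n * σ ^ 4) + (σ ^ (n - 4))⁻¹ * ∫ y, |G y| := by
  have I1 : Integrable ((ball x σ).indicator (fun y => rker (x - y))) :=
    (integrable_indicator_iff isOpen_ball.measurableSet).2 (ker_int_ball_sub hn x σ)
  have I2 : Integrable (fun y => B * (ball x σ).indicator (fun y => rker (x - y)) y + (σ ^ (n - 4))⁻¹ * |G y|) :=
    (I1.const_mul _).add (hGi.abs.const_mul _)
  have hae : ∀ᵐ y, |rker (x - y) * G y| ≤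
      B * (ball x σ).indicator (fun y => rker (x - y)) y + (σ ^ (n - 4))⁻¹ * |G y| := by
    filter_upwards [ae_ne_zero hn] with y hy using ker_mul_bound hσ hB hG y hy
  have I3 : Integrable (fun y => rker (x - y) * G y) :=
    I2.mono' ((ker_meas.comp (measurable_const.sub measurable_id)).aestronglyMeasurable.mul hGi.1) hae
  refine ⟨I3, ?_⟩
  refine (integral_mono_ae I3.abs I2 hae).trans (le_of_eq ?_)
  rw [integral_add (I1.const_mul _) (hGi.abs.const_mul _), integral_const_mul, integral_const_mul,
    integral_indicator isOpen_ball.measurableSet, ker_integral_ball hn x hσ]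

/-- regularised power. -/
noncomputable def TF (η m t : ℝ) : ℝ := (t + η ^ 2) ^ (-m)

lemma hasDerivAt_TF {η m t : ℝ} (h : 0 < t + η ^ 2) :
    HasDerivAt (TF η m) (-m * TF η (m + 1) t) t := by
  have h1 : HasDerivAt (fun t : ℝ => t + η ^ 2) 1 t := (hasDerivAt_id t).add_const _
  have := h1.rpow_const (p := -m) (Or.inl h.ne')
  refine this.congr_deriv ?_
  unfold TF
  rw [show -m - 1 = -(m + 1) by ring]; ring

/-- regularised kernel. -/
noncomputable def KE {n : ℕ} (η m : ℝ) (x y : EE n) : ℝ := TF η m (‖y - x‖ ^ 2)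

lemma KE_base_pos {n : ℕ} {η : ℝ} (hη : 0 < η) (x y : EE n) : 0 < ‖y - x‖ ^ 2 + η ^ 2 := by positivity

lemma lap_KE {n : ℕ} {η : ℝ} (hη : 0 < η) (m : ℝ) (x y : EE n) :
    lap (KE η m x) y = (4 * m * (m + 1) - 2 * n * m) * KE η (m + 1) x y
      - 4 * m * (m + 1) * η ^ 2 * KE η (m + 2) x y := by
  have hp := KE_base_pos hη x y
  have hc : ∀ᶠ t in 𝓝 (‖y - x‖ ^ 2), 0 < t + η ^ 2 :=
    (continuous_id.add continuous_const).continuousAt.eventually (lt_mem_nhds hp)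
  have h2 : HasDerivAt (fun t => -m * TF η (m + 1) t) (-m * (-(m + 1) * TF η (m + 1 + 1) (‖y - x‖ ^ 2)))
    (‖y - x‖ ^ 2) := (hasDerivAt_TF hp).const_mul (-m)
  have := lap_radial (F := TF η m) (F' := fun t => -m * TF η (m + 1) t) (x := x) (y := y)
    (hc.mono fun t ht => hasDerivAt_TF ht) h2
  have e : KE η m x = fun y => TF η m (‖y - x‖ ^ 2) := rfl
  rw [e, this]
  simp only [KE]
  have k : TF η (m + 1) (‖y - x‖ ^ 2) = (‖y - x‖ ^ 2 + η ^ 2) * TF η (m + 2) (‖y - x‖ ^ 2) := by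
    unfold TF
    rw [show -(m + 1) = 1 + -(m + 2) by ring, Real.rpow_add hp, Real.rpow_one]
  rw [show m + 1 + 1 = m + 2 by ring, k]
  ring

lemma KE_cd {n : ℕ} {η : ℝ} (hη : 0 < η) (m : ℝ) (x : EE n) {k : WithTop ℕ∞} (hk : k ≠ ⊤) : ContDiff ℝ k (KE η m x) := by
  unfold KE TF
  refine contDiff_iff_contDiffAt.2 fun y => ?_
  refine ContDiffAt.rpow_const_of_ne ?_ (KE_base_pos hη x y).ne'
  exact (((contDiff_norm_sq ℝ).comp (contDiff_id.sub contDiff_const)).add contDiff_const).contDiffAt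

lemma bilap_KE {n : ℕ} (hn : 5 ≤ n) {η k : ℝ} (hη : 0 < η) (hk : (n : ℝ) = 2 * k + 4) (x y : EE n) :
    lap (lap (KE η k x)) y = 16 * k * (k + 1) * (k + 2) * (k + 3) * η ^ 4 * KE η (k + 4) x y := by
  have e : lap (KE η k x) = fun y => (-4 * k) * KE η (k + 1) x y +
      (- 4 * k * (k + 1) * η ^ 2) * KE η (k + 2) x y := by
    funext y; rw [lap_KE hη, hk]; ring
  rw [e, lap_add, lap_const_mul, lap_const_mul]
  · rw [lap_KE hη, lap_KE hη, hk]
    rw [show k + 1 + 1 = k + 2 by ring, show k + 1 + 2 = k + 3 by ring, show k + 2 + 1 = k + 3 by ring,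
      show k + 2 + 2 = k + 4 by ring]
    ring
  · exact (contDiff_const.mul (KE_cd hη _ x (by simp))).contDiffAt
  · exact (contDiff_const.mul (KE_cd hη _ x (by simp))).contDiffAt

open MeasureTheory Metric Filter Topology

/-- the profile of the peak. -/
noncomputable def phi {n : ℕ} (z : EE n) : ℝ := (1 + ‖z‖ ^ 2) ^ (-((n : ℝ) + 4) / 2)

lemma phi_pos {n : ℕ} (z : EE n) : 0 < phi z := by unfold phi; positivity

lemma phi_int {n : ℕ} : Integrable (phi : EE n → ℝ) :=
  integrable_rpow_neg_one_add_norm_sq (E := EE n) (r := (n : ℝ) + 4) (by simp)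

/-- mass of the profile. -/
noncomputable def Iphi (n : ℕ) : ℝ := ∫ z : EE n, phi z

lemma Iphi_pos {n : ℕ} : 0 < Iphi n := by
  unfold Iphi
  rw [integral_pos_iff_support_of_nonneg (fun z => (phi_pos z).le) phi_int]
  have : Function.support (phi : EE n → ℝ) = Set.univ := by
    ext z; simp [(phi_pos z).ne']
  rw [this]
  exact isOpen_univ.measure_pos _ Set.univ_nonempty

lemma phi_decay {n : ℕ} : Tendsto (fun z : EE n => ‖z‖ ^ n * phi z) (Bornology.cobounded (EE n)) (𝓝 0) := by
  have h1 : Tendsto (fun z : EE n => (‖z‖ ^ 4)⁻¹) (Bornology.cobounded (EE n)) (𝓝 0) :=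
    tendsto_inv_atTop_zero.comp ((tendsto_pow_atTop (by norm_num)).comp tendsto_norm_cobounded_atTop)
  refine squeeze_zero' (Eventually.of_forall fun z => by have := phi_pos z; positivity) ?_ h1
  filter_upwards [tendsto_norm_cobounded_atTop.eventually (eventually_gt_atTop 0)] with z hz
  have : phi z ≤ (‖z‖ ^ (n + 4))⁻¹ := by
    unfold phi
    have e : (‖z‖ ^ (n + 4))⁻¹ = (‖z‖ ^ 2) ^ (-((n : ℝ) + 4) / 2) := by
      rw [← Real.rpow_natCast ‖z‖ 2, ← Real.rpow_mul hz.le, ← Real.rpow_natCast, ← Real.rpow_neg hz.le]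
      congr 1; push_cast; ring
    rw [e]
    exact Real.rpow_le_rpow_of_nonpos (by positivity) (by linarith) (by
      have : (0 : ℝ) ≤ n := by positivity
      linarith)
  calc ‖z‖ ^ n * phi z ≤ ‖z‖ ^ n * (‖z‖ ^ (n + 4))⁻¹ := by gcongr
    _ = (‖z‖ ^ 4)⁻¹ := by rw [pow_add]; field_simp

lemma peak_KE {n : ℕ} {c : ℝ} (hc : 0 < c) (x y : EE n) :
    (c⁻¹) ^ 4 * KE c⁻¹ (((n : ℝ) - 4) / 2 + 4) x y = c ^ n * phi (c • (y - x)) := by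
  unfold KE TF phi
  rw [norm_smul, Real.norm_of_nonneg hc.le]
  have e : ‖y - x‖ ^ 2 + c⁻¹ ^ 2 = (c ^ 2)⁻¹ * (1 + (c * ‖y - x‖) ^ 2) := by field_simp; ring
  rw [e, Real.mul_rpow (by positivity) (by positivity)]
  have e2 : ((c ^ 2)⁻¹) ^ (-(((n : ℝ) - 4) / 2 + 4)) = c ^ (n + 4) := by
    rw [← Real.rpow_natCast c 2, ← Real.rpow_neg hc.le, ← Real.rpow_mul hc.le, ← Real.rpow_natCast]
    congr 1; push_cast; ring
  rw [e2, show -(((n : ℝ) - 4) / 2 + 4) = -((n : ℝ) + 4) / 2 by ring, pow_add]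
  field_simp

lemma peak {n : ℕ} {g : EE n → ℝ} (hg : Integrable g) {x : EE n} (hx : ContinuousAt g x) :
    Tendsto (fun c : ℝ => ∫ y, g y * ((c⁻¹) ^ 4 * KE c⁻¹ (((n : ℝ) - 4) / 2 + 4) x y)) atTop
      (𝓝 (Iphi n * g x)) := by
  have h := tendsto_integral_comp_smul_smul_of_integrable (μ := (volume : Measure (EE n)))
    (φ := fun z => (Iphi n)⁻¹ * phi z) (fun z => by have := phi_pos z; have := Iphi_pos (n := n); positivity)
    (by rw [integral_const_mul]; exact inv_mul_cancel₀ Iphi_pos.ne')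
    (by
      have := (phi_decay (n := n)).const_mul (Iphi n)⁻¹
      rw [mul_zero] at this
      refine this.congr fun z => ?_
      simp; ring)
    (g := fun z => g (z + x)) (hg.comp_add_right x) (by
      have : ContinuousAt g (0 + x) := by rwa [zero_add]
      exact this.comp (f := fun z => z + x) (by fun_prop))
  have h2 := h.const_mul (Iphi n)
  simp only [zero_add] at h2
  refine h2.congr' ?_
  filter_upwards [eventually_gt_atTop 0] with c hc
  rw [← integral_const_mul, ← integral_add_right_eq_self (fun y => g y * ((c⁻¹) ^ 4 * KE c⁻¹ (((n : ℝ) - 4) / 2 + 4) x y)) x]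
  congr 1; funext y
  rw [peak_KE hc, add_sub_cancel_right]
  have := (Iphi_pos (n := n)).ne'
  simp
  field_simp

lemma rker_eq {n : ℕ} (hn : 5 ≤ n) (x y : EE n) : rker (x - y) = (‖y - x‖ ^ 2) ^ (-(((n : ℝ) - 4) / 2)) := by
  unfold rker
  rw [norm_sub_rev]
  have h := norm_nonneg (y - x)
  rw [Real.rpow_neg (by positivity), ← Real.rpow_natCast ‖y - x‖ 2, ← Real.rpow_mul h, ← Real.rpow_natCast]
  congr 2
  rw [Nat.cast_sub (by omega)]; push_cast; ring

lemma KE_le {n : ℕ} (hn : 5 ≤ n) {η : ℝ} {x y : EE n} (hxy : y ≠ x) :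
    KE η (((n : ℝ) - 4) / 2) x y ≤ rker (x - y) := by
  rw [rker_eq hn]
  unfold KE TF
  have hn' : (5 : ℝ) ≤ n := by exact_mod_cast hn
  have : 0 < ‖y - x‖ := norm_pos_iff.2 (sub_ne_zero.2 hxy)
  exact Real.rpow_le_rpow_of_nonpos (by positivity) (by nlinarith [sq_nonneg η]) (by linarith)

lemma KE_nonneg {n : ℕ} (η m : ℝ) (x y : EE n) : 0 ≤ KE η m x y := by unfold KE TF; positivity

lemma KE_tendsto {n : ℕ} (m : ℝ) {x y : EE n} (hxy : y ≠ x) :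
    Tendsto (fun c : ℝ => KE c⁻¹ m x y) atTop (𝓝 ((‖y - x‖ ^ 2) ^ (-m))) := by
  unfold KE TF
  have : 0 < ‖y - x‖ := norm_pos_iff.2 (sub_ne_zero.2 hxy)
  have h1 : Tendsto (fun c : ℝ => ‖y - x‖ ^ 2 + c⁻¹ ^ 2) atTop (𝓝 (‖y - x‖ ^ 2 + 0 ^ 2)) :=
    tendsto_const_nhds.add (tendsto_inv_atTop_zero.pow 2)
  rw [show ‖y - x‖ ^ 2 + (0 : ℝ) ^ 2 = ‖y - x‖ ^ 2 by ring] at h1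
  exact h1.rpow_const (Or.inl (by positivity))

lemma ae_ne {n : ℕ} (hn : 5 ≤ n) (x : EE n) : ∀ᵐ y : EE n, y ≠ x := by
  haveI := nontrivEE hn
  exact Measure.ae_ne volume x

lemma rep_abs {n : ℕ} (hn : 5 ≤ n) {g : EE n → ℝ} {ρ : ℝ} (hg : SHC g ρ) (hv : SHC (fun x => -lap g x) ρ)
    {x : EE n} (hx : x ≠ 0) (hi : Integrable (fun y => rker (x - y) * lap (lap g) y)) :
    ((n : ℝ) - 4) * (n - 2) * n * (n + 2) * Iphi n * g x = (∫ y, rker (x - y) * lap (lap g) y)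
      + rker x * (∫ y, lap (fun x => -lap g x) y)
      + 2 * (n - 4) * (rker x / ‖x‖ ^ 2) * ∫ y, lap g y := by
  set k : ℝ := ((n : ℝ) - 4) / 2 with hk
  have hn' : (5 : ℝ) ≤ n := by exact_mod_cast hn
  have hxp : 0 < ‖x‖ := norm_pos_iff.2 hx
  have e1 : ∀ y, lap (fun x => -lap g x) y = - lap (lap g) y := fun y => lap_neg _ _
  set a := ∫ y, lap (fun x => -lap g x) y
  set b := ∫ y, lap g y
  have key : ∀ c : ℝ, 0 < c → ∫ y, g y * lap (lap (KE c⁻¹ k x)) y =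
      (∫ y, KE c⁻¹ k x y * lap (lap g) y) + KE c⁻¹ k x 0 * a - lap (KE c⁻¹ k x) 0 * b := by
    intro c hc
    have cd4 : ContDiff ℝ 4 (KE c⁻¹ k x) := KE_cd (by positivity) _ _ (by decide)
    have cd2 : ContDiff ℝ 2 (KE c⁻¹ k x) := cd4.of_le (by norm_num)
    have cdl : ContDiff ℝ 2 (lap (KE c⁻¹ k x)) := contDiff_iff_contDiffAt.2 fun y =>
      contDiffAt_lap (m := 2) (k := 4) (by norm_num) cd4.contDiffAt
    obtain ⟨_, _, t1⟩ := hv.test hn cd2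
    obtain ⟨_, _, t2⟩ := hg.test hn cdl
    simp only [e1, mul_neg, neg_mul, integral_neg] at t1
    have : ∫ y, lap g y * lap (KE c⁻¹ k x) y = ∫ y, lap (KE c⁻¹ k x) y * lap g y := by
      congr 1; funext y; ring
    have ha : a = -∫ y, lap (lap g) y := by
      simp only [a, e1, integral_neg]
    rw [this] at t1
    rw [ha]
    linarith
  have L1 : Tendsto (fun c : ℝ => ∫ y, g y * lap (lap (KE c⁻¹ k x)) y) atTop
      (𝓝 (((n : ℝ) - 4) * (n - 2) * n * (n + 2) * (Iphi n * g x))) := by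
    have := (peak (hg.int_g hn) (hg.contg x hx)).const_mul (((n : ℝ) - 4) * (n - 2) * n * (n + 2))
    refine this.congr' ?_
    filter_upwards [eventually_gt_atTop 0] with c hc
    rw [← integral_const_mul]
    congr 1; funext y
    rw [bilap_KE hn (inv_pos.2 hc) (k := k) (by rw [hk]; ring)]
    rw [hk]; ring
  have L2 : Tendsto (fun c : ℝ => ∫ y, KE c⁻¹ k x y * lap (lap g) y) atTop
      (𝓝 (∫ y, rker (x - y) * lap (lap g) y)) := by
    refine tendsto_integral_filter_of_dominated_convergence (fun y => |rker (x - y) * lap (lap g) y|) ?_ ?_ hi.abs ?_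
    · filter_upwards [eventually_gt_atTop 0] with c hc
      refine (KE_cd (k := 0) (inv_pos.2 hc) k x (by simp)).continuous.aestronglyMeasurable.mul ?_
      have := (hv.int_main hn).2.1.neg
      refine this.congr (Eventually.of_forall fun y => ?_)
      simp [e1]
    · refine Eventually.of_forall fun c => ?_
      filter_upwards [ae_ne hn x] with y hy
      rw [norm_mul, Real.norm_of_nonneg (KE_nonneg _ _ _ _), abs_mul, abs_of_nonneg (ker_nonneg _),
        Real.norm_eq_abs]
      exact mul_le_mul_of_nonneg_right (KE_le hn hy) (abs_nonneg _)
    · filter_upwards [ae_ne hn x] with y hy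
      rw [rker_eq hn]
      exact (KE_tendsto _ hy).mul_const _
  have L3 : Tendsto (fun c : ℝ => KE c⁻¹ k x 0) atTop (𝓝 (rker x)) := by
    have := KE_tendsto k (Ne.symm hx : (0 : EE n) ≠ x)
    rwa [hk, ← rker_eq hn, sub_zero] at this
  have L4 : Tendsto (fun c : ℝ => lap (KE c⁻¹ k x) 0) atTop (𝓝 (-(2 * (n - 4) * (rker x / ‖x‖ ^ 2)))) := by
    have h1 := KE_tendsto (k + 1) (Ne.symm hx : (0 : EE n) ≠ x)
    have h2 := KE_tendsto (k + 2) (Ne.symm hx : (0 : EE n) ≠ x)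
    have h3 : Tendsto (fun c : ℝ => c⁻¹ ^ 2) atTop (𝓝 (0 ^ 2)) := tendsto_inv_atTop_zero.pow 2
    have h4 := (h1.const_mul (4 * k * (k + 1) - 2 * n * k)).sub ((h3.mul h2).const_mul (4 * k * (k + 1)))
    have e : (4 * k * (k + 1) - 2 * n * k) * (‖0 - x‖ ^ 2) ^ (-(k + 1)) -
        4 * k * (k + 1) * (0 ^ 2 * (‖0 - x‖ ^ 2) ^ (-(k + 2))) = -(2 * (n - 4) * (rker x / ‖x‖ ^ 2)) := by
      have := rker_eq hn x 0
      rw [sub_zero] at this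
      rw [this, ← hk, zero_sub, norm_neg, neg_add, Real.rpow_add (by positivity), Real.rpow_neg_one, hk]
      field_simp
      ring
    rw [e] at h4
    refine h4.congr' ?_
    filter_upwards [eventually_gt_atTop 0] with c hc
    rw [lap_KE (inv_pos.2 hc)]
    ring
  have L := ((L2.add (L3.mul_const a)).sub (L4.mul_const b))
  have LL := L1.congr' (by filter_upwards [eventually_gt_atTop 0] with c hc using key c hc)
  have := tendsto_nhds_unique LL L
  linarith

open MeasureTheory Metric Filter Topology

/-- normalising constant -/
noncomputable def kap (n : ℕ) : ℝ := (((n : ℝ) - 4) * (n - 2) * n * (n + 2) * Iphi n)⁻¹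

lemma kap_pos {n : ℕ} (hn : 5 ≤ n) : 0 < kap n := by
  unfold kap
  have hn' : (5 : ℝ) ≤ n := by exact_mod_cast hn
  have := Iphi_pos (n := n)
  have h1 : 0 < (n : ℝ) - 4 := by linarith
  have h2 : 0 < (n : ℝ) - 2 := by linarith
  positivity

lemma bdd_off {n : ℕ} {f : EE n → ℝ} (hf : ∀ x ≠ 0, ContinuousAt f x) (hc : HasCompactSupport f)
    {τ : ℝ} (hτ : 0 < τ) : ∃ B, 0 ≤ B ∧ ∀ y, τ ≤ ‖y‖ → |f y| ≤ B := by
  have hK : IsCompact (tsupport f ∩ (ball (0 : EE n) τ)ᶜ) :=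
    hc.isCompact.inter_right isOpen_ball.isClosed_compl
  have hco : ContinuousOn f (tsupport f ∩ (ball (0 : EE n) τ)ᶜ) := by
    intro x hx
    refine (hf x ?_).continuousWithinAt
    rintro rfl
    exact hx.2 (mem_ball_self hτ)
  obtain ⟨B, hB⟩ := hK.exists_bound_of_continuousOn hco
  refine ⟨max B 0, le_max_right _ _, fun y hy => ?_⟩
  by_cases h : y ∈ tsupport f
  · exact (hB y ⟨h, by simpa using hy⟩).trans (le_max_left _ _)
  · rw [image_eq_zero_of_notMem_tsupport h, abs_zero]; exact le_max_right _ _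

lemma ball_cd {n : ℕ} {R : ℝ} {u : EE n → ℝ} (hC4 : ContDiffOn ℝ 4 u (ball (0 : EE n) R \ {0}))
    {x : EE n} (hx : x ≠ 0) (hR : ‖x‖ < R) : ContDiffAt ℝ 4 u x := by
  refine hC4.contDiffAt ((isOpen_ball.sdiff isClosed_singleton).mem_nhds ⟨by simpa using hR, hx⟩)

theorem RT {n : ℕ} (hn : 5 ≤ n) {R : ℝ} (hR : 0 < R) {u : EE n → ℝ}
    (hnn : ∀ x ∈ ball (0 : EE n) R \ {0}, 0 ≤ u x)
    (hC4 : ContDiffOn ℝ 4 u (ball (0 : EE n) R \ {0}))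
    (hsup : ∀ x ∈ ball (0 : EE n) R \ {0}, 0 < -lap u x)
    (hbi : ∀ x ∈ ball (0 : EE n) R \ {0}, 0 ≤ bilap u x) :
    ∃ a b : ℝ, 0 ≤ a ∧ 0 ≤ b ∧ ∃ G : EE n → ℝ, Integrable G ∧
      (∀ x ≠ 0, ContinuousAt G x) ∧
      (∀ x ≠ 0, ‖x‖ < R / 2 → G x = kap n * bilap u x) ∧
      (∀ τ > 0, ∃ B, 0 ≤ B ∧ ∀ y, τ ≤ ‖y‖ → |G y| ≤ B) ∧
      ∀ x ≠ 0, ‖x‖ < R / 2 → Integrable (fun y => rker (x - y) * G y) ∧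
        u x = a * rker x + b * (rker x / ‖x‖ ^ 2) + ∫ y, rker (x - y) * G y := by
  have hn' : (5 : ℝ) ≤ n := by exact_mod_cast hn
  let χ : ContDiffBump (0 : EE n) := ⟨R / 2, 3 * R / 4, by positivity, by linarith⟩
  let g : EE n → ℝ := fun x => χ x * u x
  have χz : ∀ x : EE n, 3 * R / 4 ≤ ‖x‖ → χ x = 0 := fun x hx => by
    apply χ.zero_of_le_dist; rw [dist_zero_right]; exact hx
  have gcd : ∀ x ≠ 0, ContDiffAt ℝ 4 g x := by
    intro x hx
    by_cases h : ‖x‖ < R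
    · exact χ.contDiffAt.mul (ball_cd hC4 hx h)
    · have : ∀ᶠ y in 𝓝 x, g y = 0 := by
        have : ∀ᶠ y in 𝓝 x, 3 * R / 4 < ‖y‖ :=
          continuous_norm.continuousAt.eventually (lt_mem_nhds (by push Not at h; linarith))
        filter_upwards [this] with y hy
        simp only [g]; rw [χz y hy.le, zero_mul]
      exact contDiffAt_of_ev_zero this
  have gcs : HasCompactSupport g := χ.hasCompactSupport.mul_right
  have geq : ∀ x : EE n, ‖x‖ < R / 2 → g =ᶠ[𝓝 x] u := by
    intro x hx
    have : ∀ᶠ y in 𝓝 x, ‖y‖ < R / 2 := continuous_norm.continuousAt.eventually (gt_mem_nhds hx)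
    filter_upwards [this] with y hy
    simp only [g]; rw [χ.one_of_mem_closedBall (by simpa using hy.le), one_mul]
  have leq : ∀ x : EE n, ‖x‖ < R / 2 → lap g =ᶠ[𝓝 x] lap u := by
    intro x hx
    have : ∀ᶠ y in 𝓝 x, ‖y‖ < R / 2 := continuous_norm.continuousAt.eventually (gt_mem_nhds hx)
    filter_upwards [this] with y hy
    exact (lap_congr (geq y hy)).eq_of_nhds
  have lleq : ∀ x : EE n, ‖x‖ < R / 2 → lap (lap g) x = bilap u x := fun x hx => (lap_congr (leq x hx)).eq_of_nhds
  have mem : ∀ x : EE n, x ≠ 0 → ‖x‖ < R / 2 → x ∈ ball (0 : EE n) R \ {0} := by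
    intro x hx h; refine ⟨?_, hx⟩; rw [mem_ball_zero_iff]; linarith
  have hg : SHC g (R / 2) := by
    refine ⟨fun x hx => (gcd x hx).of_le (by norm_num), gcs, by positivity, fun x hx h => ?_, fun x hx h => ?_⟩
    · rw [(geq x h).eq_of_nhds]; exact hnn x (mem x hx h)
    · rw [(leq x h).eq_of_nhds]; have := hsup x (mem x hx h); linarith
  have lcd : ∀ x ≠ 0, ContDiffAt ℝ 2 (lap g) x := fun x hx =>
    contDiffAt_lap (m := 2) (k := 4) (by norm_num) (gcd x hx)
  have hv : SHC (fun x => -lap g x) (R / 2) := by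
    refine ⟨fun x hx => (lcd x hx).neg, (hcs_lap gcs).comp_left (g := fun t : ℝ => -t) (by simp), by positivity, fun x hx h => ?_, fun x hx h => ?_⟩
    · show 0 ≤ - lap g x
      rw [(leq x h).eq_of_nhds]; exact (hsup x (mem x hx h)).le
    · rw [lap_neg, lleq x h]; have := hbi x (mem x hx h); linarith
  have llc : ∀ x ≠ 0, ContinuousAt (lap (lap g)) x := fun x hx =>
    (contDiffAt_lap (m := 0) (k := 2) (by norm_num) (lcd x hx)).continuousAt
  have lli : Integrable (lap (lap g)) := by
    refine (hv.int_main hn).2.neg.congr (Eventually.of_forall fun y => ?_)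
    simp [lap_neg]
  have llcs : HasCompactSupport (lap (lap g)) := hcs_lap (hcs_lap gcs)
  have kp := kap_pos hn
  refine ⟨kap n * ∫ y, lap (fun x => -lap g x) y, kap n * (2 * (n - 4) * ∫ y, lap g y), ?_, ?_,
    fun x => kap n * lap (lap g) x, lli.const_mul _, fun x hx => (llc x hx).const_mul _, fun x hx h => ?_, ?_, ?_⟩
  · exact mul_nonneg kp.le (hv.lapint_nonneg hn)
  · have h1 := hg.lapint_nonneg hn
    have h2 : 0 ≤ (n : ℝ) - 4 := by linarith
    positivity
  · simp only [lleq x h]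
  · intro τ hτ
    exact bdd_off (fun x hx => (llc x hx).const_mul _) llcs.mul_left hτ
  · intro x hx h
    have hxp : 0 < ‖x‖ := norm_pos_iff.2 hx
    obtain ⟨B, hB, hB2⟩ := bdd_off llc llcs (half_pos hxp)
    have hi : Integrable (fun y => rker (x - y) * lap (lap g) y) :=
      (ker_mul_int hn lli (half_pos hxp) hB (fun y hy _ => hB2 y (by
        rw [mem_ball, dist_eq_norm] at hy
        have := norm_sub_norm_le x y
        rw [norm_sub_rev] at this
        linarith))).1
    have e : ∀ y, rker (x - y) * (kap n * lap (lap g) y) = kap n * (rker (x - y) * lap (lap g) y) := fun y => by ring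
    simp only [e]
    refine ⟨hi.const_mul _, ?_⟩
    have := rep_abs hn hg hv hx hi
    rw [(geq x h).eq_of_nhds] at this
    rw [integral_const_mul]
    have k2 : kap n * (((n : ℝ) - 4) * (n - 2) * n * (n + 2) * Iphi n * u x) = u x := by
      rw [← mul_assoc, kap, inv_mul_cancel₀, one_mul]
      have := kp.ne'
      unfold kap at this
      exact fun h => this (by rw [h, inv_zero])
    rw [this] at k2
    rw [← k2]; ring

open MeasureTheory Metric Filter Topology

theorem minp {n : ℕ} (hn : 5 ≤ n) {R : ℝ} (hR : 0 < R) {u : EE n → ℝ}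
    (hnn : ∀ x ∈ ball (0 : EE n) R \ {0}, 0 ≤ u x)
    (hC4 : ContDiffOn ℝ 4 u (ball (0 : EE n) R \ {0}))
    (hsup : ∀ x ∈ ball (0 : EE n) R \ {0}, 0 < -lap u x) :
    ∃ m0 > 0, ∀ x ≠ 0, ‖x‖ ≤ R / 2 → m0 ≤ u x := by
  have hn' : (5 : ℝ) ≤ n := by exact_mod_cast hn
  haveI := nontrivEE hn
  have op : IsOpen (ball (0 : EE n) R \ {0}) := isOpen_ball.sdiff isClosed_singleton
  have mem : ∀ x : EE n, x ≠ 0 → ‖x‖ ≤ R / 2 → x ∈ ball (0 : EE n) R \ {0} := by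
    intro x hx h; refine ⟨?_, hx⟩; rw [mem_ball_zero_iff]; linarith
  have cd : ∀ x : EE n, x ≠ 0 → ‖x‖ ≤ R / 2 → ContDiffAt ℝ 2 u x := fun x hx h =>
    (ball_cd hC4 hx (by linarith)).of_le (by norm_num)
  have upos : ∀ x ∈ ball (0 : EE n) R \ {0}, 0 < u x := by
    intro x hx
    rcases (hnn x hx).lt_or_eq with h | h
    · exact h
    · exfalso
      have hm : IsLocalMin u x := by
        filter_upwards [op.mem_nhds hx] with y hy
        rw [← h]; exact hnn y hy
      have := lap_nonneg_of_localMin ((ball_cd hC4 hx.2 (by simpa using hx.1)).of_le (by norm_num)) hm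
      have := hsup x hx
      linarith
  have hR2 : 0 < R / 2 := by positivity
  have co : ∀ r, 0 < r → ContinuousOn u (closedBall (0 : EE n) (R / 2) ∩ (ball 0 r)ᶜ) := by
    intro r hr x hx
    have hx0 : x ≠ 0 := by rintro rfl; exact hx.2 (mem_ball_self hr)
    exact (cd x hx0 (by simpa using hx.1)).continuousAt.continuousWithinAt
  obtain ⟨z, hz, hzm⟩ := (isCompact_sphere (0 : EE n) (R / 2)).exists_isMinOn
    (NormedSpace.sphere_nonempty.2 hR2.le) (f := u) ((co (R / 2) hR2).mono (by
      intro x hx; rw [mem_sphere_zero_iff_norm] at hx; exact ⟨by simp [hx], by simp [hx]⟩))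
  rw [mem_sphere_zero_iff_norm] at hz
  have hz0 : z ≠ 0 := by rintro rfl; simp at hz; linarith
  set m1 := u z with hm1
  have m1p : 0 < m1 := upos z (mem z hz0 hz.le)
  set m : ℝ := ((n : ℝ) - 2) / 2 with hm
  have mp : 0 < m := by rw [hm]; linarith
  have claim : ∀ x ≠ 0, ‖x‖ ≤ R / 2 → ∀ η, 0 < η → η < ‖x‖ →
      m1 ≤ u x + m1 * (2 * η ^ 2 / ‖x‖ ^ 2) ^ m := by
    intro x hx hxR η hη hηx
    set δ := m1 * (2 * η ^ 2) ^ m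
    let W : EE n → ℝ := fun y => u y + δ * KE η m 0 y
    have kcd : ∀ k : WithTop ℕ∞, k ≠ ⊤ → ContDiff ℝ k (fun y : EE n => δ * KE η m 0 y) := fun k hk =>
      contDiff_const.mul (KE_cd hη m 0 hk)
    have hK : IsCompact (closedBall (0 : EE n) (R / 2) ∩ (ball 0 η)ᶜ) :=
      (isCompact_closedBall _ _).inter_right isOpen_ball.isClosed_compl
    have hxK : x ∈ closedBall (0 : EE n) (R / 2) ∩ (ball 0 η)ᶜ := ⟨by simpa using hxR, by simpa using hηx.le⟩
    obtain ⟨y, hy, hym⟩ := hK.exists_isMinOn ⟨x, hxK⟩ (f := W)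
      ((co η hη).add (kcd 0 (by simp)).continuous.continuousOn)
    have hy1 : ‖y‖ ≤ R / 2 := by simpa using hy.1
    have hy2 : η ≤ ‖y‖ := by simpa using hy.2
    have hy0 : y ≠ 0 := by rintro rfl; simp at hy2; linarith
    have δp : 0 < δ := by positivity
    have Wy : m1 ≤ W y := by
      by_contra hcon
      push Not at hcon
      have knn := KE_nonneg η m (0 : EE n) y
      have n1 : ‖y‖ ≠ R / 2 := by
        intro h
        have : m1 ≤ u y := hzm (by simpa using h)
        have : 0 ≤ δ * KE η m 0 y := by positivity
        simp only [W] at hcon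
        linarith
      have n2 : ‖y‖ ≠ η := by
        intro h
        have e : δ * KE η m 0 y = m1 := by
          simp only [δ, KE, TF, sub_zero, h]
          rw [← two_mul, mul_assoc, ← Real.rpow_add (by positivity), add_neg_cancel, Real.rpow_zero, mul_one]
        have := hnn y (mem y hy0 hy1)
        simp only [W] at hcon
        linarith
      have lm : IsLocalMin W y := by
        have h1 : ∀ᶠ w in 𝓝 y, ‖w‖ < R / 2 :=
          continuous_norm.continuousAt.eventually (gt_mem_nhds (lt_of_le_of_ne hy1 n1))
        have h2 : ∀ᶠ w in 𝓝 y, η < ‖w‖ :=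
          continuous_norm.continuousAt.eventually (lt_mem_nhds (lt_of_le_of_ne hy2 n2.symm))
        filter_upwards [h1, h2] with w a b
        exact hym ⟨by simpa using a.le, by simpa using b.le⟩
      have k2 := (kcd 2 (by decide)).contDiffAt (x := y)
      have l1 := lap_nonneg_of_localMin ((cd y hy0 hy1).add k2) lm
      have l2 : lap W y = lap u y + lap (fun y => δ * KE η m 0 y) y := lap_add (cd y hy0 hy1) k2
      rw [lap_const_mul, lap_KE hη] at l2
      have e : 4 * m * (m + 1) - 2 * n * m = 0 := by rw [hm]; ring
      rw [e] at l2
      have := KE_nonneg η (m + 2) (0 : EE n) y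
      have h3 : 0 ≤ δ * (4 * m * (m + 1) * η ^ 2 * KE η (m + 2) 0 y) := by positivity
      have h4 := hsup y (mem y hy0 hy1)
      have l1' : 0 ≤ lap W y := l1
      linarith
    have h5 : W y ≤ W x := hym hxK
    have h6 : δ * KE η m 0 x ≤ m1 * (2 * η ^ 2 / ‖x‖ ^ 2) ^ m := by
      have hxp : 0 < ‖x‖ := norm_pos_iff.2 hx
      have : KE η m 0 x ≤ (‖x‖ ^ 2) ^ (-m) := by
        simp only [KE, TF, sub_zero]
        exact Real.rpow_le_rpow_of_nonpos (by positivity) (by nlinarith) (by linarith)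
      rw [Real.div_rpow (by positivity) (by positivity), div_eq_mul_inv, ← Real.rpow_neg (by positivity), ← mul_assoc]
      exact mul_le_mul_of_nonneg_left this δp.le
    simp only [W] at h5 Wy
    linarith
  refine ⟨m1, m1p, fun x hx hxR => ?_⟩
  have hxp : 0 < ‖x‖ := norm_pos_iff.2 hx
  have lim : Tendsto (fun η : ℝ => u x + m1 * (2 * η ^ 2 / ‖x‖ ^ 2) ^ m) (𝓝[>] 0) (𝓝 (u x)) := by
    have : Tendsto (fun η : ℝ => (2 * η ^ 2 / ‖x‖ ^ 2)) (𝓝 0) (𝓝 (2 * 0 ^ 2 / ‖x‖ ^ 2)) :=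
      ((tendsto_id.pow 2).const_mul 2).div_const _
    have h2 := (this.rpow_const (p := m) (Or.inr mp.le)).const_mul m1
    have h3 := (h2.const_add (u x)).mono_left (nhdsWithin_le_nhds (s := Set.Ioi 0))
    simpa [Real.zero_rpow mp.ne'] using h3
  refine ge_of_tendsto lim ?_
  filter_upwards [Ioo_mem_nhdsGT hxp] with η hη
  exact claim x hx hxR η hη.1 hη.2

open MeasureTheory Metric Filter Topology

/-- power kernel -/
noncomputable def pw {n : ℕ} (α : ℝ) (z : EE n) : ℝ := ‖z‖ ^ (α - n)

lemma pw_nonneg {n : ℕ} (α : ℝ) (z : EE n) : 0 ≤ pw α z := by unfold pw; positivity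

lemma pw_meas {n : ℕ} (α : ℝ) : Measurable (pw α : EE n → ℝ) := by unfold pw; fun_prop

lemma pw_int {n : ℕ} (hn : 5 ≤ n) {α : ℝ} (hα : 0 < α) (r : ℝ) :
    IntegrableOn (pw α : EE n → ℝ) (ball 0 r) := by
  refine integrableOn_ball_of_norm_le_rpow (C := 1) (α := (n : ℝ) - α) (by simp; omega) ?_ ?_
    (pw_meas α).aestronglyMeasurable
  · simp; linarith
  · refine Eventually.of_forall fun x => ?_
    rw [Real.norm_of_nonneg (pw_nonneg _ x), one_mul, neg_sub]
    rfl

open scoped Pointwise in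
lemma pw_integral {n : ℕ} (α : ℝ) {σ : ℝ} (hσ : 0 < σ) :
    ∫ z in ball (0 : EE n) σ, pw α z = (∫ z in ball (0 : EE n) 1, pw α z) * σ ^ α := by
  have h := Measure.setIntegral_comp_smul_of_pos (μ := (volume : Measure (EE n))) (fun z => pw α z) (ball 0 1) hσ
  have e : σ • ball (0 : EE n) 1 = ball 0 σ := by
    rw [_root_.smul_ball hσ.ne']; simp [abs_of_pos hσ]
  rw [e] at h
  have e2 : ∀ z : EE n, pw α (σ • z) = σ ^ (α - n) * pw α z := by
    intro z; unfold pw; rw [norm_smul, Real.norm_of_nonneg hσ.le, Real.mul_rpow hσ.le (norm_nonneg z)]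
  simp only [e2] at h
  rw [integral_const_mul] at h
  have hf : Module.finrank ℝ (EE n) = n := by simp
  rw [hf, Real.rpow_sub hσ, Real.rpow_natCast] at h
  have p : σ ^ n ≠ 0 := by positivity
  simp only [smul_eq_mul] at h
  field_simp at h
  linarith

lemma pw_small {n : ℕ} {α : ℝ} (hα : 0 < α) {ε : ℝ} (hε : 0 < ε) :
    ∃ τ0 > 0, ∀ τ, 0 < τ → τ ≤ τ0 → ∫ z in ball (0 : EE n) τ, pw α z ≤ ε := by
  have : Tendsto (fun σ : ℝ => (∫ z in ball (0 : EE n) 1, pw α z) * σ ^ α) (𝓝 0)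
      (𝓝 ((∫ z in ball (0 : EE n) 1, pw α z) * 0 ^ α)) :=
    (tendsto_id.rpow_const (Or.inr hα.le)).const_mul _
  rw [Real.zero_rpow hα.ne', mul_zero] at this
  obtain ⟨δ, hδ, h⟩ := Metric.eventually_nhds_iff.1 (this.eventually (gt_mem_nhds hε))
  refine ⟨δ / 2, by positivity, fun τ h1 h2 => ?_⟩
  rw [pw_integral α h1]
  refine (h ?_).le
  rw [dist_zero_right, Real.norm_of_nonneg h1.le]; linarith

lemma prod_le {n : ℕ} (hn : 5 ≤ n) {α A B : ℝ} (hα4 : α ≤ 4) (hA : 0 < A) (hB : 0 < B) :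
    (A ^ (n - 4))⁻¹ * B ^ (α - 4) ≤ A ^ (α - n) + B ^ (α - n) := by
  have eA : ∀ C : ℝ, 0 < C → (C ^ (n - 4))⁻¹ = C ^ (4 - (n : ℝ)) := fun C hC => by
    rw [← Real.rpow_natCast, ← Real.rpow_neg hC.le, Nat.cast_sub (by omega)]; congr 1; push_cast; ring
  have eC : ∀ C : ℝ, 0 < C → (C ^ (n - 4))⁻¹ * C ^ (α - 4) = C ^ (α - n) := fun C hC => by
    rw [eA C hC, ← Real.rpow_add hC]; congr 1; ring
  have pA : 0 < A ^ (α - n) := by positivity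
  have pB : 0 < B ^ (α - n) := by positivity
  rcases le_total B A with h | h
  · have : (A ^ (n - 4))⁻¹ ≤ (B ^ (n - 4))⁻¹ := by gcongr
    have := mul_le_mul_of_nonneg_right this (by positivity : 0 ≤ B ^ (α - 4))
    rw [eC B hB] at this; linarith
  · have : B ^ (α - 4) ≤ A ^ (α - 4) := Real.rpow_le_rpow_of_nonpos hA h (by linarith)
    have := mul_le_mul_of_nonneg_left this (by positivity : 0 ≤ (A ^ (n - 4))⁻¹)
    rw [eC A hA] at this; linarith

lemma kern_pt {n : ℕ} (hn : 5 ≤ n) {α η : ℝ} (hα4 : α ≤ 4) (hη : 0 < η) {x y : EE n}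
    (hx : x ≠ 0) (hy : y ≠ 0) (hxy : y ≠ x) :
    rker (x - y) * (‖y‖ ^ (α - 4) * (1 + η * rker y)) ≤
      2 ^ n * (1 + η * rker x) * (pw α (x - y) + pw α y) := by
  have px : 0 < ‖x‖ := norm_pos_iff.2 hx
  have py : 0 < ‖y‖ := norm_pos_iff.2 hy
  have pxy : 0 < ‖x - y‖ := norm_pos_iff.2 (sub_ne_zero.2 hxy.symm)
  have h1 := prod_le hn hα4 pxy py
  have tri : ‖x‖ ^ (n - 4) ≤ 2 ^ (n - 4) * (‖x - y‖ ^ (n - 4) + ‖y‖ ^ (n - 4)) := by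
    have t : ‖x‖ ≤ ‖x - y‖ + ‖y‖ := by
      have := norm_add_le (x - y) y; rwa [sub_add_cancel] at this
    calc ‖x‖ ^ (n - 4) ≤ (‖x - y‖ + ‖y‖) ^ (n - 4) := by gcongr
      _ ≤ 2 ^ (n - 4 - 1) * (‖x - y‖ ^ (n - 4) + ‖y‖ ^ (n - 4)) := add_pow_le (by positivity) (by positivity) _
      _ ≤ _ := mul_le_mul_of_nonneg_right (pow_le_pow_right₀ (by norm_num) (by omega)) (by positivity)
  have eB : (‖y‖ ^ (n - 4))⁻¹ * ‖y‖ ^ (α - 4) = ‖y‖ ^ (α - n) := by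
    rw [← Real.rpow_natCast, ← Real.rpow_neg py.le, ← Real.rpow_add py, Nat.cast_sub (by omega)]; congr 1; push_cast; ring
  unfold rker pw at *
  set X := ‖x‖ ^ (n - 4)
  set Y := ‖y‖ ^ (n - 4)
  set Z := ‖x - y‖ ^ (n - 4)
  set W := ‖y‖ ^ (α - 4)
  set Φ := ‖x - y‖ ^ (α - n) + ‖y‖ ^ (α - n) with hΦ
  have pX : 0 < X := by positivity
  have pY : 0 < Y := by positivity
  have pZ : 0 < Z := by positivity
  have pW : 0 < W := by positivity
  have hle : ‖y‖ ^ (α - n) ≤ Φ := by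
    have : 0 ≤ ‖x - y‖ ^ (α - n) := by positivity
    linarith
  have pΦ : 0 < Φ := lt_of_lt_of_le (by positivity) hle
  have h2 : Z⁻¹ * W * Y⁻¹ ≤ 2 ^ (n - 4) * (Φ + Φ) * X⁻¹ := by
    rw [le_mul_inv_iff₀ pX]
    calc Z⁻¹ * W * Y⁻¹ * X ≤ Z⁻¹ * W * Y⁻¹ * (2 ^ (n - 4) * (Z + Y)) := by gcongr
      _ = 2 ^ (n - 4) * (Y⁻¹ * W + Z⁻¹ * W) := by field_simp
      _ ≤ _ := by
        gcongr
        rw [eB]; exact hle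
  have e24 : (2 : ℝ) ^ n = 2 ^ (n - 4) * 16 := by
    rw [show (16 : ℝ) = 2 ^ 4 by norm_num, ← pow_add]; congr 1; omega
  have one : (1 : ℝ) ≤ 2 ^ (n - 4) := one_le_pow₀ (by norm_num)
  have h3 : Z⁻¹ * (W * (1 + η * Y⁻¹)) = Z⁻¹ * W + η * (Z⁻¹ * W * Y⁻¹) := by ring
  rw [h3, e24]
  have h4 := mul_le_mul_of_nonneg_left h2 hη.le
  have pi : 0 < X⁻¹ := by positivity
  have h5 : 0 ≤ 2 ^ (n - 4) * Φ * η * X⁻¹ := by positivity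
  have h6 : Φ ≤ 2 ^ (n - 4) * Φ := by nlinarith
  have h7 : 0 ≤ 2 ^ (n - 4) * Φ := by positivity
  nlinarith

lemma kern_int {n : ℕ} (hn : 5 ≤ n) {α η τ : ℝ} (hα : 0 < α) (hα4 : α ≤ 4) (hη : 0 < η) {x : EE n}
    (hx : x ≠ 0) (hxτ : ‖x‖ < τ) :
    IntegrableOn (fun y => rker (x - y) * (‖y‖ ^ (α - 4) * (1 + η * rker y))) (ball 0 τ) ∧
    ∫ y in ball (0 : EE n) τ, rker (x - y) * (‖y‖ ^ (α - 4) * (1 + η * rker y)) ≤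
      2 ^ n * (1 + η * rker x) * (2 * ∫ z in ball (0 : EE n) (2 * τ), pw α z) := by
  have τp : 0 < τ := lt_of_le_of_lt (norm_nonneg x) hxτ
  have I2 : IntegrableOn (pw α : EE n → ℝ) (ball 0 τ) := pw_int hn hα τ
  have I0 := (integrable_indicator_iff (isOpen_ball (x := (0 : EE n)) (ε := 2 * τ)).measurableSet).2
    (pw_int hn hα (2 * τ))
  have I1' := I0.comp_sub_left x
  have sub : ∀ y ∈ ball (0 : EE n) τ, (ball (0 : EE n) (2 * τ)).indicator (pw α) (x - y) = pw α (x - y) := by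
    intro y hy
    apply Set.indicator_of_mem
    rw [mem_ball_zero_iff] at hy ⊢
    have := norm_sub_le x y
    linarith
  have I1 : IntegrableOn (fun y => pw α (x - y)) (ball 0 τ) :=
    I1'.integrableOn.congr_fun sub isOpen_ball.measurableSet
  have J1 : ∫ y in ball (0 : EE n) τ, pw α (x - y) ≤ ∫ z in ball (0 : EE n) (2 * τ), pw α z := by
    rw [← setIntegral_congr_fun isOpen_ball.measurableSet sub]
    refine (setIntegral_le_integral I1' (Eventually.of_forall fun y => ?_)).trans (le_of_eq ?_)
    · exact Set.indicator_nonneg (fun z _ => pw_nonneg α z) _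
    · rw [integral_sub_left_eq_self (fun z => (ball (0 : EE n) (2 * τ)).indicator (pw α) z) volume x,
        integral_indicator isOpen_ball.measurableSet]
  have J2 : ∫ y in ball (0 : EE n) τ, pw α y ≤ ∫ z in ball (0 : EE n) (2 * τ), pw α z :=
    setIntegral_mono_set (pw_int hn hα _) (Eventually.of_forall fun z => pw_nonneg α z)
      (ball_subset_ball (by linarith)).eventuallyLE
  have ID : IntegrableOn (fun y => 2 ^ n * (1 + η * rker x) * (pw α (x - y) + pw α y)) (ball 0 τ) :=
    (I1.add I2).const_mul _
  have hae : ∀ᵐ y : EE n ∂(volume.restrict (ball 0 τ)), rker (x - y) * (‖y‖ ^ (α - 4) * (1 + η * rker y)) ≤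
      2 ^ n * (1 + η * rker x) * (pw α (x - y) + pw α y) := by
    apply ae_restrict_of_ae
    filter_upwards [ae_ne hn x, ae_ne_zero hn] with y h1 h2
    exact kern_pt hn hα4 hη hx h2 h1
  have II : IntegrableOn (fun y => rker (x - y) * (‖y‖ ^ (α - 4) * (1 + η * rker y))) (ball 0 τ) := by
    refine ID.mono' ?_ ?_
    · have := (ker_meas (n := n))
      apply Measurable.aestronglyMeasurable
      fun_prop
    · filter_upwards [hae] with y hy
      rw [Real.norm_of_nonneg]
      · exact hy
      · have := ker_nonneg (x - y); have := ker_nonneg y; positivity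
  refine ⟨II, (integral_mono_ae II ID hae).trans ?_⟩
  rw [integral_const_mul, integral_add I1 I2]
  have := ker_nonneg x
  gcongr
  linarith

open MeasureTheory Metric Filter Topology

lemma lemL {n p : ℕ} (hn : 5 ≤ n) {α B : ℝ} (hα : 0 < α) (hα4 : α ≤ 4) (hB : 0 ≤ B) :
    ∃ τ0 > 0, ∀ τ, 0 < τ → τ ≤ τ0 → ∀ L M C1 : ℝ, 0 ≤ M → ∀ w H : Fin p → EE n → ℝ,
      (∀ i, Integrable (H i)) → (∀ i, ∫ y, |H i y| ≤ L) → (∀ i y, τ ≤ ‖y‖ → |H i y| ≤ M) →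
      (∀ i, ∀ y ≠ 0, ‖y‖ < τ → |H i y| ≤ B * (‖y‖ ^ (α - 4) * ∑ j, |w j y|)) →
      (∀ y ≠ 0, ‖y‖ < τ → ∑ j, |w j y| ≤ C1 * rker y) →
      (∀ i, ∀ x ≠ 0, ‖x‖ < τ → |w i x| ≤ ∫ y, rker (x - y) * |H i y|) →
      ∀ x ≠ 0, ‖x‖ < τ → ∑ j, |w j x| ≤ 2 * (p * (M * c1 n + L)) := by
  obtain ⟨τ1, hτ1, hsm⟩ := pw_small (n := n) hα (ε := (4 * 2 ^ n * (p * B + 1))⁻¹) (by positivity)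
  refine ⟨τ1 / 2, by positivity, ?_⟩
  intro τ τp hτ L M C1 hM w H Hi HL HM Hw hC1 hrep
  set A : ℝ := p * (M * c1 n + L) with hA
  -- one step
  have step : ∀ S η : ℝ, 0 ≤ S → 0 < η → (∀ y ≠ 0, ‖y‖ < τ → ∑ j, |w j y| ≤ S * (1 + η * rker y)) →
      ∀ x ≠ 0, ‖x‖ < τ → ∑ j, |w j x| ≤ A + S / 2 * (1 + η * rker x) := by
    intro S η hS hη hyp x hx hxτ
    obtain ⟨KI, KB⟩ := kern_int hn hα hα4 hη hx hxτ
    have hs := hsm (2 * τ) (by positivity) (by linarith)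
    have each : ∀ i, |w i x| ≤ (M * c1 n + L) + B * S * ∫ y in ball (0 : EE n) τ, rker (x - y) * (‖y‖ ^ (α - 4) * (1 + η * rker y)) := by
      intro i
      refine (hrep i x hx hxτ).trans ?_
      let Ho : EE n → ℝ := (ball (0 : EE n) τ)ᶜ.indicator (fun y => |H i y|)
      have HoI : Integrable Ho := (Hi i).abs.indicator isOpen_ball.measurableSet.compl
      have Ho0 : ∀ y, 0 ≤ Ho y := fun y => Set.indicator_nonneg (fun _ _ => abs_nonneg _) _
      have Hole : ∀ y, Ho y ≤ |H i y| := fun y => Set.indicator_le_self' (fun _ _ => abs_nonneg _) _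
      have HoM : ∀ y, |Ho y| ≤ M := by
        intro y
        rw [abs_of_nonneg (Ho0 y)]
        by_cases h : y ∈ (ball (0 : EE n) τ)ᶜ
        · rw [show Ho y = |H i y| from Set.indicator_of_mem h _]
          exact HM i y (by simpa using h)
        · rw [show Ho y = 0 from Set.indicator_of_notMem h _]; exact hM
      obtain ⟨I1, I2⟩ := ker_mul_int hn HoI (x := x) (σ := 1) one_pos hM (fun y _ _ => HoM y)
      have I3 : ∫ y, rker (x - y) * Ho y ≤ M * c1 n + L := by
        refine (integral_mono I1 I1.abs fun y => le_abs_self _).trans (I2.trans ?_)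
        simp only [one_pow, mul_one, inv_one, one_mul]
        have : ∫ y, |Ho y| ≤ ∫ y, |H i y| := by
          refine integral_mono HoI.abs (Hi i).abs fun y => ?_
          simp only [abs_of_nonneg (Ho0 y)]; exact Hole y
        linarith [HL i]
      have KI' : Integrable ((ball (0 : EE n) τ).indicator
        (fun y => rker (x - y) * (‖y‖ ^ (α - 4) * (1 + η * rker y)))) :=
          (integrable_indicator_iff isOpen_ball.measurableSet).2 KI
      have hae : ∀ᵐ y, rker (x - y) * |H i y| ≤ rker (x - y) * Ho y + B * S * (ball (0 : EE n) τ).indicator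
        (fun y => rker (x - y) * (‖y‖ ^ (α - 4) * (1 + η * rker y))) y := by
        filter_upwards [ae_ne_zero hn] with y hy
        by_cases h : y ∈ ball (0 : EE n) τ
        · have hy' : ‖y‖ < τ := by simpa using h
          rw [Set.indicator_of_mem h, show Ho y = 0 from Set.indicator_of_notMem (by simpa using hy') _]
          have h1 := (Hw i y hy hy').trans (mul_le_mul_of_nonneg_left (mul_le_mul_of_nonneg_left (hyp y hy hy')
            (by positivity)) hB)
          have h2 := mul_le_mul_of_nonneg_left h1 (ker_nonneg (x - y))
          linarith
        · rw [Set.indicator_of_notMem h, show Ho y = |H i y| from Set.indicator_of_mem h _]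
          linarith
      have Itot := I1.add (KI'.const_mul (B * S))
      refine (integral_mono_of_nonneg (Eventually.of_forall fun y => mul_nonneg (ker_nonneg _) (abs_nonneg _)) Itot hae).trans ?_
      simp only [Pi.add_apply]
      rw [integral_add I1 (KI'.const_mul (B * S)), integral_const_mul, integral_indicator isOpen_ball.measurableSet]
      linarith
    have tot := Finset.sum_le_sum fun i (_ : i ∈ Finset.univ) => each i
    refine tot.trans ?_
    rw [Finset.sum_const, Finset.card_univ, Fintype.card_fin, nsmul_eq_mul]
    have kx := ker_nonneg x
    set J := ∫ y in ball (0 : EE n) τ, rker (x - y) * (‖y‖ ^ (α - 4) * (1 + η * rker y))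
    set Q := ∫ z in ball (0 : EE n) (2 * τ), pw α z
    have h1 : p * B * (2 ^ n * (2 * Q)) ≤ 1 / 2 := by
      have e : (p : ℝ) * B * (2 ^ n * (2 * Q)) ≤ p * B * (2 ^ n * (2 * (4 * 2 ^ n * (p * B + 1))⁻¹)) := by gcongr
      refine e.trans ?_
      have : (p : ℝ) * B * (2 ^ n * (2 * (4 * 2 ^ n * (p * B + 1))⁻¹)) = (p * B) / (p * B + 1) / 2 := by
        field_simp; norm_num
      rw [this]
      have : (p * B) / (p * B + 1) ≤ 1 := by
        rw [div_le_one (by positivity)]; linarith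
      linarith
    have h2 : p * B * J ≤ 1 / 2 * (1 + η * rker x) := by
      calc p * B * J ≤ p * B * (2 ^ n * (1 + η * rker x) * (2 * Q)) := by gcongr
        _ = p * B * (2 ^ n * (2 * Q)) * (1 + η * rker x) := by ring
        _ ≤ _ := by gcongr
    have h3 := mul_le_mul_of_nonneg_left h2 hS
    rw [hA]
    linarith
  have A0 : 0 ≤ A ∨ p = 0 := by
    rcases Nat.eq_zero_or_pos p with h | h
    · exact Or.inr h
    · left
      have : 0 ≤ L := (integral_nonneg fun y => abs_nonneg _).trans (HL ⟨0, h⟩)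
      have := c1_nonneg n
      positivity
  rcases A0 with A0 | p0
  swap
  · subst p0; simp [hA]
  -- sup argument
  have fin : ∀ η : ℝ, 0 < η → ∀ x ≠ 0, ‖x‖ < τ → ∑ j, |w j x| ≤ 2 * A * (1 + η * rker x) := by
    intro η hη
    let T : Set ℝ := {S | 0 ≤ S ∧ ∀ y ≠ 0, ‖y‖ < τ → ∑ j, |w j y| ≤ S * (1 + η * rker y)}
    have Tne : T.Nonempty := by
      refine ⟨|C1| / η, by positivity, fun y hy hyτ => (hC1 y hy hyτ).trans ?_⟩
      have := ker_nonneg y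
      have e : |C1| / η * (1 + η * rker y) = |C1| / η + |C1| * rker y := by field_simp
      rw [e]
      have : 0 ≤ |C1| / η := by positivity
      have := mul_le_mul_of_nonneg_right (le_abs_self C1) (ker_nonneg y)
      linarith
    have Tbd : BddBelow T := ⟨0, fun S hS => hS.1⟩
    set S := sInf T with hS
    have S0 : 0 ≤ S := le_csInf Tne fun S hS => hS.1
    have ST : ∀ y ≠ 0, ‖y‖ < τ → ∑ j, |w j y| ≤ S * (1 + η * rker y) := by
      intro y hy hyτ
      have := ker_nonneg y
      have p1 : 0 < 1 + η * rker y := by positivity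
      rw [← div_le_iff₀ p1]
      refine le_csInf Tne fun S' hS' => ?_
      rw [div_le_iff₀ p1]
      exact hS'.2 y hy hyτ
    have : A + S / 2 ∈ T := by
      refine ⟨by positivity, fun y hy hyτ => (step S η S0 hη ST y hy hyτ).trans ?_⟩
      have := ker_nonneg y
      have : 0 ≤ A * (η * rker y) := by positivity
      linarith
    have h1 : S ≤ A + S / 2 := csInf_le Tbd this
    intro x hx hxτ
    refine (ST x hx hxτ).trans ?_
    have := ker_nonneg x
    gcongr
    linarith
  intro x hx hxτ
  have lim : Tendsto (fun η : ℝ => 2 * A * (1 + η * rker x)) (𝓝[>] 0) (𝓝 (2 * A * (1 + 0 * rker x))) := by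
    refine Tendsto.mono_left ?_ (nhdsWithin_le_nhds (s := Set.Ioi 0))
    exact (((tendsto_id.mul_const _).const_add 1).const_mul _)
  rw [zero_mul, add_zero, mul_one] at lim
  refine ge_of_tendsto lim ?_
  filter_upwards [self_mem_nhdsWithin] with η hη using fin η hη x hx hxτ

open MeasureTheory Metric Filter Topology

/-- the vector of values -/
noncomputable def vv {n p : ℕ} (U : Fin p → EE n → ℝ) (x : EE n) : EuclideanSpace ℝ (Fin p) :=
  WithLp.toLp 2 (fun i => U i x)

lemma vnorm_eq {n p : ℕ} (U : Fin p → EE n → ℝ) (x : EE n) : vnorm U x = ‖vv U x‖ := by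
  rw [EuclideanSpace.norm_eq]; unfold vnorm vv; simp

lemma vnorm_nonneg {n p : ℕ} (U : Fin p → EE n → ℝ) (x : EE n) : 0 ≤ vnorm U x := Real.sqrt_nonneg _

lemma eu_norm_le_sum {p : ℕ} (v : EuclideanSpace ℝ (Fin p)) : ‖v‖ ≤ ∑ i, |v i| := by
  rw [EuclideanSpace.norm_eq]
  apply Real.sqrt_le_iff.2
  refine ⟨Finset.sum_nonneg fun i _ => abs_nonneg _, ?_⟩
  simp only [Real.norm_eq_abs]
  exact Finset.sum_sq_le_sq_sum_of_nonneg (fun i _ => abs_nonneg (v i))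

lemma vnorm_le_sum {n p : ℕ} (U : Fin p → EE n → ℝ) (x : EE n) : vnorm U x ≤ ∑ i, |U i x| := by
  rw [vnorm_eq]; exact eu_norm_le_sum _

lemma abs_le_vnorm {n p : ℕ} (U : Fin p → EE n → ℝ) (i : Fin p) (x : EE n) : |U i x| ≤ vnorm U x := by
  rw [vnorm_eq]; exact PiLp.norm_apply_le (vv U x) i

lemma vnorm_sub_le {n p : ℕ} (U : Fin p → EE n → ℝ) (x y : EE n) :
    |vnorm U x - vnorm U y| ≤ ∑ i, |U i x - U i y| := by
  rw [vnorm_eq, vnorm_eq]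
  exact (abs_norm_sub_norm_le _ _).trans (eu_norm_le_sum _)

/-- everything we know about the solution near the origin. -/
structure Dat {n p : ℕ} (s ρ m0 : ℝ) (U : Fin p → EE n → ℝ) (a b : Fin p → ℝ) (G : Fin p → EE n → ℝ) : Prop where
  hn : 5 ≤ n
  hp : 1 ≤ p
  hs1 : 1 < s
  hs2 : s * ((n : ℝ) - 4) < n + 4
  ρpos : 0 < ρ
  m0pos : 0 < m0
  low : ∀ i, ∀ x ≠ 0, ‖x‖ < ρ → m0 ≤ U i x
  cd : ∀ i, ∀ x ≠ 0, ‖x‖ < ρ → ContDiffAt ℝ 1 (U i) x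
  a0 : ∀ i, 0 ≤ a i
  b0 : ∀ i, 0 ≤ b i
  Gi : ∀ i, Integrable (G i)
  Gc : ∀ i, ∀ x ≠ 0, ContinuousAt (G i) x
  Geq : ∀ i, ∀ x ≠ 0, ‖x‖ < ρ → G i x = kap n * ((vnorm U x) ^ (s - 1) * U i x)
  Gb : ∀ i, ∀ τ > 0, ∃ B, 0 ≤ B ∧ ∀ y, τ ≤ ‖y‖ → |G i y| ≤ B
  rep : ∀ i, ∀ x ≠ 0, ‖x‖ < ρ → Integrable (fun y => rker (x - y) * G i y) ∧
    U i x = a i * rker x + b i * (rker x / ‖x‖ ^ 2) + ∫ y, rker (x - y) * G i y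

namespace Dat
variable {n p : ℕ} {s ρ m0 : ℝ} {U : Fin p → EE n → ℝ} {a b : Fin p → ℝ} {G : Fin p → EE n → ℝ}

lemma upos (h : Dat s ρ m0 U a b G) (i : Fin p) {x : EE n} (hx : x ≠ 0) (hr : ‖x‖ < ρ) : 0 < U i x :=
  h.m0pos.trans_le (h.low i x hx hr)

lemma vpos (h : Dat s ρ m0 U a b G) {x : EE n} (hx : x ≠ 0) (hr : ‖x‖ < ρ) : 0 < vnorm U x :=
  (h.upos ⟨0, h.hp⟩ hx hr).trans_le ((le_abs_self _).trans (abs_le_vnorm U _ x))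

lemma ule (_h : Dat s ρ m0 U a b G) (i : Fin p) (x : EE n) : U i x ≤ vnorm U x :=
  (le_abs_self _).trans (abs_le_vnorm U _ x)

lemma vle (h : Dat s ρ m0 U a b G) {x : EE n} (hx : x ≠ 0) (hr : ‖x‖ < ρ) : vnorm U x ≤ ∑ i, U i x := by
  refine (vnorm_le_sum U x).trans (le_of_eq ?_)
  exact Finset.sum_congr rfl fun i _ => abs_of_pos (h.upos i hx hr)

lemma ucont (h : Dat s ρ m0 U a b G) (i : Fin p) {x : EE n} (hx : x ≠ 0) (hr : ‖x‖ < ρ) :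
    ContinuousAt (U i) x := (h.cd i x hx hr).continuousAt

lemma vcont (h : Dat s ρ m0 U a b G) {x : EE n} (hx : x ≠ 0) (hr : ‖x‖ < ρ) :
    ContinuousAt (vnorm U) x := by
  unfold vnorm
  have : ∀ i, ContinuousAt (U i) x := fun i => h.ucont i hx hr
  fun_prop

lemma Gpos (h : Dat s ρ m0 U a b G) (i : Fin p) {x : EE n} (hx : x ≠ 0) (hr : ‖x‖ < ρ) : 0 < G i x := by
  rw [h.Geq i x hx hr]
  have := kap_pos h.hn
  have := h.vpos hx hr
  have := h.upos i hx hr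
  positivity

lemma Gle (h : Dat s ρ m0 U a b G) (i : Fin p) {x : EE n} (hx : x ≠ 0) (hr : ‖x‖ < ρ) :
    G i x ≤ kap n * vnorm U x ^ s := by
  rw [h.Geq i x hx hr]
  have := kap_pos h.hn
  have v := h.vpos hx hr
  have e : vnorm U x ^ s = vnorm U x ^ (s - 1) * vnorm U x := by
    rw [← Real.rpow_add_one v.ne']; congr 1; ring
  rw [e]
  gcongr
  exact h.ule i x

end Dat

lemma scal {s A c L : ℝ} {q β : ℕ} (hs : 1 < s) (hA : 0 ≤ A) (hc : 0 < c) (hL : 0 ≤ L) (hq : (s - 1) * q < 4)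
    (hβ : q ≤ β) : ∃ C, 0 ≤ C ∧ ∀ M d : ℝ, 0 < M → 0 < d → d ≤ 1 →
      (∀ σ, 0 < σ → σ ≤ d / 2 → M ≤ A * (d ^ β)⁻¹ + c * M ^ s * σ ^ 4 + L * (σ ^ q)⁻¹) →
      M * d ^ β ≤ C := by
  set θ : ℝ := (s - 1) * q / 4 with hθ
  have θ1 : 0 < 1 - θ := by rw [hθ]; linarith
  set D : ℝ := 4 * L * (2 * c) ^ ((q : ℝ) / 4) with hD
  have D0 : 0 ≤ D := by positivity
  refine ⟨4 * A + 2 ^ (q + 1) * L + D ^ (1 / (1 - θ)), by positivity, ?_⟩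
  intro M d hM hd hd1 H
  set σ0 : ℝ := (2 * c * M ^ (s - 1)) ^ (-(1 / 4) : ℝ) with hσ0
  have σp : 0 < σ0 := by positivity
  have e4 : σ0 ^ 4 = (2 * c * M ^ (s - 1))⁻¹ := by
    rw [hσ0, ← Real.rpow_natCast, ← Real.rpow_mul (by positivity)]
    norm_num
    rw [Real.rpow_neg_one]; simp
  have eM : M ^ s = M ^ (s - 1) * M := by
    rw [← Real.rpow_add_one hM.ne']; congr 1; ring
  have half : c * M ^ s * σ0 ^ 4 = M / 2 := by
    rw [e4, eM]
    have : M ^ (s - 1) ≠ 0 := by positivity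
    field_simp
  have dβ : 0 < d ^ β := by positivity
  have dβ1 : d ^ β ≤ 1 := pow_le_one₀ hd.le hd1
  have P2 : 0 ≤ D ^ (1 / (1 - θ)) := by positivity
  have P3 : 0 ≤ 2 ^ (q + 1) * L := by positivity
  rcases le_or_gt (d / 2) σ0 with h | h
  · have h1 := H (d / 2) (by positivity) le_rfl
    have h2 : c * M ^ s * (d / 2) ^ 4 ≤ M / 2 := by
      rw [← half]; gcongr
    have h3 : M ≤ 2 * A * (d ^ β)⁻¹ + 2 * L * ((d / 2) ^ q)⁻¹ := by linarith
    have h4 : ((d / 2) ^ q)⁻¹ * d ^ β ≤ 2 ^ q := by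
      have : d ^ β ≤ d ^ q := pow_le_pow_of_le_one hd.le hd1 hβ
      calc ((d / 2) ^ q)⁻¹ * d ^ β ≤ ((d / 2) ^ q)⁻¹ * d ^ q := by gcongr
        _ = 2 ^ q := by rw [div_pow]; field_simp
    calc M * d ^ β ≤ (2 * A * (d ^ β)⁻¹ + 2 * L * ((d / 2) ^ q)⁻¹) * d ^ β := by gcongr
      _ = 2 * A + 2 * L * (((d / 2) ^ q)⁻¹ * d ^ β) := by field_simp
      _ ≤ 2 * A + 2 * L * 2 ^ q := by gcongr
      _ = 2 * A + 2 ^ (q + 1) * L := by rw [pow_succ]; ring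
      _ ≤ _ := by linarith
  · have h1 := H σ0 σp h.le
    rw [half] at h1
    have h5 : L * (σ0 ^ q)⁻¹ = D / 4 * M ^ θ := by
      rw [hσ0, ← Real.rpow_natCast, ← Real.rpow_mul (by positivity), ← Real.rpow_neg (by positivity)]
      rw [show -(-(1 / 4) * (q : ℝ)) = (q : ℝ) / 4 by ring, Real.mul_rpow (by positivity) (by positivity),
        ← Real.rpow_mul hM.le, hD, hθ]
      rw [show (s - 1) * ((q : ℝ) / 4) = (s - 1) * q / 4 by ring]
      ring
    rw [h5] at h1
    rcases le_or_gt (D * M ^ θ) M with h6 | h6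
    · have h3 : M ≤ 4 * A * (d ^ β)⁻¹ := by linarith
      calc M * d ^ β ≤ (4 * A * (d ^ β)⁻¹) * d ^ β := by gcongr
        _ = 4 * A := by field_simp
        _ ≤ _ := by linarith
    · have h7 : M ^ (1 - θ) ≤ D := by
        rw [Real.rpow_sub hM, Real.rpow_one, div_le_iff₀ (by positivity)]
        exact h6.le
      have h8 : M ≤ D ^ (1 / (1 - θ)) := by
        have := Real.rpow_le_rpow (by positivity) h7 (by positivity : 0 ≤ 1 / (1 - θ))
        rwa [← Real.rpow_mul hM.le, mul_one_div_cancel θ1.ne', Real.rpow_one] at this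
      calc M * d ^ β ≤ M * 1 := by gcongr
        _ ≤ _ := by linarith

open MeasureTheory Metric Filter Topology

namespace Dat
variable {n p : ℕ} {s ρ m0 : ℝ} {U : Fin p → EE n → ℝ} {a b : Fin p → ℝ} {G : Fin p → EE n → ℝ}

lemma ptbound (h : Dat s ρ m0 U a b G) (hs : s * ((n : ℝ) - 4) < n) {β : ℕ} (hβ : n - 4 ≤ β) {A : ℝ} (hA : 0 ≤ A)
    (hAb : ∀ i, ∀ x : EE n, x ≠ 0 → ‖x‖ < ρ → ‖x‖ ≤ 1 → a i * rker x + b i * (rker x / ‖x‖ ^ 2) ≤ A * (‖x‖ ^ β)⁻¹) :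
    ∃ C, 0 ≤ C ∧ ∀ x : EE n, x ≠ 0 → ‖x‖ < ρ / 2 → ‖x‖ ≤ 1 / 2 → vnorm U x ≤ C * (‖x‖ ^ β)⁻¹ := by
  have kp := kap_pos h.hn
  have c0 := c1_nonneg n
  have hn' : (5 : ℝ) ≤ n := by exact_mod_cast h.hn
  set L := ∑ i, ∫ y, |G i y| with hL
  have L0 : 0 ≤ L := Finset.sum_nonneg fun i _ => integral_nonneg fun y => abs_nonneg _
  set c : ℝ := p * (kap n * ((2 : ℝ) ^ β) ^ s * c1 n) + 1 with hc
  have cp : 0 < c := by positivity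
  obtain ⟨C, C0, hC⟩ := scal (s := s) (A := p * A) (c := c) (L := L) (q := n - 4) (β := β) h.hs1
    (by positivity) cp L0 (by
      rw [Nat.cast_sub (by have := h.hn; omega)]; push_cast; linarith) hβ
  refine ⟨C * 2 ^ β, by positivity, ?_⟩
  intro x hx hxρ hx1
  set r := ‖x‖ with hr
  have rp : 0 < r := norm_pos_iff.2 hx
  have inb : ∀ y ∈ closedBall x (r / 2), r / 2 ≤ ‖y‖ ∧ ‖y‖ ≤ 3 * r / 2 := by
    intro y hy
    rw [mem_closedBall, dist_eq_norm] at hy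
    have h1 := norm_sub_norm_le y x
    have h2 := norm_sub_norm_le x y
    rw [norm_sub_rev] at h2
    constructor <;> linarith
  have inb' : ∀ y ∈ closedBall x (r / 2), y ≠ 0 ∧ ‖y‖ < ρ ∧ ‖y‖ ≤ 1 := by
    intro y hy
    obtain ⟨h1, h2⟩ := inb y hy
    refine ⟨norm_pos_iff.1 (by linarith), by linarith, by linarith⟩
  let ψ : EE n → ℝ := fun y => vnorm U y * (r / 2 - ‖y - x‖) ^ β
  have ψc : ContinuousOn ψ (closedBall x (r / 2)) := by
    intro y hy
    obtain ⟨h1, h2, _⟩ := inb' y hy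
    refine ((h.vcont h1 h2).mul ?_).continuousWithinAt
    fun_prop
  have hxin : x ∈ closedBall x (r / 2) := mem_closedBall_self (by positivity)
  obtain ⟨y0, hy0, hmax⟩ := (isCompact_closedBall x (r / 2)).exists_isMaxOn ⟨x, hxin⟩ ψc
  obtain ⟨z1, z2, z3⟩ := inb' y0 hy0
  obtain ⟨z4, z5⟩ := inb y0 hy0
  set M := vnorm U y0 with hM
  have Mp : 0 < M := h.vpos z1 z2
  set d := r / 2 - ‖y0 - x‖ with hd
  have d0 : 0 ≤ d := by rw [mem_closedBall, dist_eq_norm] at hy0; linarith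
  have e1 : ψ x = vnorm U x * (r / 2) ^ β := by simp [ψ]
  have m1 : vnorm U x * (r / 2) ^ β ≤ M * d ^ β := by rw [← e1]; exact hmax hxin
  have vx := h.vpos hx (by linarith)
  have dp : 0 < d := by
    rcases d0.lt_or_eq with h0 | h0
    · exact h0
    · exfalso
      have bp : β ≠ 0 := by have := h.hn; omega
      rw [← h0, zero_pow bp, mul_zero] at m1
      have : 0 < vnorm U x * (r / 2) ^ β := by positivity
      linarith
  have dr : d ≤ r / 2 := by have := norm_nonneg (y0 - x); linarith
  have inn : ∀ y ∈ ball y0 (d / 2), vnorm U y ≤ 2 ^ β * M ∧ y ∈ closedBall x (r / 2) := by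
    intro y hy
    rw [mem_ball, dist_eq_norm] at hy
    have t : ‖y - x‖ ≤ ‖y - y0‖ + ‖y0 - x‖ := norm_sub_le_norm_sub_add_norm_sub y y0 x
    have hyin : y ∈ closedBall x (r / 2) := by
      rw [mem_closedBall, dist_eq_norm]; linarith
    refine ⟨?_, hyin⟩
    have m2 : ψ y ≤ M * d ^ β := hmax hyin
    have m3 : vnorm U y * (d / 2) ^ β ≤ M * d ^ β := by
      refine le_trans ?_ m2
      have := vnorm_nonneg U y
      simp only [ψ]
      gcongr
      linarith
    rw [div_pow, mul_div_assoc', div_le_iff₀ (by positivity)] at m3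
    have : 0 < d ^ β := by positivity
    nlinarith
  have key := hC M d Mp dp (by linarith) (fun σ σp hσ => by
    have each : ∀ i, U i y0 ≤ A * (d ^ β)⁻¹ + kap n * ((2 : ℝ) ^ β) ^ s * c1 n * M ^ s * σ ^ 4 +
        (∫ y, |G i y|) * (σ ^ (n - 4))⁻¹ := by
      intro i
      obtain ⟨I, e⟩ := h.rep i y0 z1 z2
      obtain ⟨_, bd⟩ := ker_mul_int h.hn (h.Gi i) (x := y0) (σ := σ) (B := kap n * (2 ^ β * M) ^ s) σp (by positivity)
        (fun y hy _ => by
          obtain ⟨v1, v2⟩ := inn y (ball_subset_ball hσ hy)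
          obtain ⟨w1, w2, _⟩ := inb' y v2
          rw [abs_of_pos (h.Gpos i w1 w2)]
          refine (h.Gle i w1 w2).trans ?_
          have := vnorm_nonneg U y
          have := h.hs1
          gcongr)
      have h1 := hAb i y0 z1 z2 z3
      have h2 : A * (‖y0‖ ^ β)⁻¹ ≤ A * (d ^ β)⁻¹ := by
        gcongr; linarith
      have h3 : ∫ y, rker (y0 - y) * G i y ≤ ∫ y, |rker (y0 - y) * G i y| :=
        integral_mono I I.abs fun y => le_abs_self _
      rw [Real.mul_rpow (by positivity) Mp.le] at bd
      rw [e]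
      linarith
    have s1 := (h.vle z1 z2).trans (Finset.sum_le_sum fun i (_ : i ∈ Finset.univ) => each i)
    rw [Finset.sum_add_distrib, ← Finset.sum_mul, Finset.sum_const, Finset.card_univ, Fintype.card_fin,
      nsmul_eq_mul] at s1
    have : 0 ≤ M ^ s * σ ^ 4 := by positivity
    rw [hc, ← hM] at *
    linarith)
  have fin : vnorm U x * (r / 2) ^ β ≤ C := m1.trans key
  rw [div_pow, mul_div_assoc', div_le_iff₀ (by positivity)] at fin
  rw [le_mul_inv_iff₀ (by positivity)]
  exact fin

end Dat

open MeasureTheory Metric Filter Topology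

lemma nonint {n : ℕ} (hn : 5 ≤ n) {γ c r : ℝ} (hc : 0 < c) (hr : 0 < r) {f : EE n → ℝ}
    (hf : IntegrableOn f (ball 0 r)) (hl : ∀ x : EE n, x ≠ 0 → ‖x‖ < r → c * ‖x‖ ^ (-γ) ≤ f x) : γ < n := by
  haveI := nontrivEE hn
  have I : IntegrableOn (fun x : EE n => ‖x‖ ^ (-γ)) (ball 0 r) := by
    have m : Measurable (fun x : EE n => ‖x‖ ^ (-γ)) := by fun_prop
    refine Integrable.mono' (hf.const_mul c⁻¹) m.aestronglyMeasurable ?_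
    rw [ae_restrict_iff' measurableSet_ball]
    filter_upwards [ae_ne_zero hn] with x hx hxr
    rw [mem_ball_zero_iff] at hxr
    have := hl x hx hxr
    rw [Real.norm_of_nonneg (by positivity), inv_mul_eq_div, le_div_iff₀ hc, mul_comm]
    exact this
  rw [integrableOn_fun_norm_addHaar (volume : Measure (EE n)) (f := fun t : ℝ => t ^ (-γ))] at I
  have I2 : IntegrableOn (fun y : ℝ => y ^ ((n : ℝ) - 1 - γ)) (Set.Ioo 0 r) := by
    refine I.congr_fun (fun y hy => ?_) measurableSet_Ioo
    have hy0 : 0 < y := hy.1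
    simp only [finrank_euclideanSpace, Fintype.card_fin, smul_eq_mul]
    rw [← Real.rpow_natCast, ← Real.rpow_add hy0, Nat.cast_sub (by omega)]
    push_cast; ring_nf
  rw [intervalIntegral.integrableOn_Ioo_rpow_iff hr] at I2
  linarith

/-- the conclusion in two-point form -/
def Concl {n p : ℕ} (U : Fin p → EE n → ℝ) : Prop :=
  ∃ C : ℝ, 0 ≤ C ∧ ∃ r0 : ℝ, 0 < r0 ∧ ∀ x y : EE n, x ≠ 0 → ‖x‖ = ‖y‖ → ‖x‖ < r0 →
    vnorm U x ≤ (1 + C * ‖x‖) * vnorm U y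

lemma concl_of {n p : ℕ} {U : Fin p → EE n → ℝ} {D c r0 : ℝ} {α β : ℕ} (hαβ : α + 1 ≤ β) (hD : 0 ≤ D) (hc : 0 < c)
    (hr : 0 < r0)
    (h1 : ∀ i, ∀ x y : EE n, x ≠ 0 → ‖x‖ = ‖y‖ → ‖x‖ < r0 → |U i x - U i y| ≤ D * (‖x‖ ^ α)⁻¹)
    (h2 : ∀ y : EE n, y ≠ 0 → ‖y‖ < r0 → c * (‖y‖ ^ β)⁻¹ ≤ vnorm U y) : Concl U := by
  refine ⟨p * D / c, by positivity, min r0 1, by positivity, ?_⟩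
  intro x y hx hxy hxr
  have hr1 : ‖x‖ < r0 := hxr.trans_le (min_le_left _ _)
  have hr2 : ‖x‖ < 1 := hxr.trans_le (min_le_right _ _)
  have xp : 0 < ‖x‖ := norm_pos_iff.2 hx
  have hy : y ≠ 0 := norm_pos_iff.1 (hxy ▸ xp)
  have A := (le_abs_self _).trans (vnorm_sub_le U x y)
  have B : ∑ i, |U i x - U i y| ≤ p * (D * (‖x‖ ^ α)⁻¹) := by
    refine (Finset.sum_le_sum fun i _ => h1 i x y hx hxy hr1).trans (le_of_eq ?_)
    simp
  have C := h2 y hy (hxy ▸ hr1)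
  rw [← hxy] at C
  have E : (‖x‖ ^ α)⁻¹ ≤ ‖x‖ * (‖x‖ ^ β)⁻¹ := by
    have : ‖x‖ ^ β ≤ ‖x‖ ^ (α + 1) := pow_le_pow_of_le_one xp.le hr2.le hαβ
    calc (‖x‖ ^ α)⁻¹ = ‖x‖ * (‖x‖ ^ (α + 1))⁻¹ := by rw [pow_succ]; field_simp
      _ ≤ _ := by gcongr
  have F : p * (D * (‖x‖ ^ α)⁻¹) ≤ p * D / c * ‖x‖ * vnorm U y := by
    calc p * (D * (‖x‖ ^ α)⁻¹) ≤ p * (D * (‖x‖ * (‖x‖ ^ β)⁻¹)) := by gcongr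
      _ = p * D / c * ‖x‖ * (c * (‖x‖ ^ β)⁻¹) := by field_simp
      _ ≤ _ := by gcongr
  linarith

lemma rker_norm {n : ℕ} {x y : EE n} (h : ‖x‖ = ‖y‖) : rker x = rker y := by unfold rker; rw [h]

namespace Dat
variable {n p : ℕ} {s ρ m0 : ℝ} {U : Fin p → EE n → ℝ} {a b : Fin p → ℝ} {G : Fin p → EE n → ℝ}

lemma Gge (h : Dat s ρ m0 U a b G) (i : Fin p) {x : EE n} (hx : x ≠ 0) (hr : ‖x‖ < ρ) :
    kap n * U i x ^ s ≤ G i x := by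
  rw [h.Geq i x hx hr]
  have := kap_pos h.hn
  have v := h.upos i hx hr
  have e : U i x ^ s = U i x ^ (s - 1) * U i x := by
    rw [← Real.rpow_add_one v.ne']; congr 1; ring
  have := h.hs1
  rw [e]
  gcongr
  exact h.ule i x

lemma lowk (h : Dat s ρ m0 U a b G) (i : Fin p) : ∃ C, 0 ≤ C ∧ ∀ x : EE n, x ≠ 0 → ‖x‖ < ρ / 2 →
    a i * rker x + b i * (rker x / ‖x‖ ^ 2) - C ≤ U i x := by
  have ρp := h.ρpos
  refine ⟨((ρ / 2) ^ (n - 4))⁻¹ * ∫ y, |G i y|, mul_nonneg (by positivity) (integral_nonneg fun y => abs_nonneg _), ?_⟩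
  intro x hx hxr
  obtain ⟨I, e⟩ := h.rep i x hx (by linarith)
  have : ∫ y, -(((ρ / 2) ^ (n - 4))⁻¹ * |G i y|) ≤ ∫ y, rker (x - y) * G i y := by
    refine integral_mono_ae ((h.Gi i).abs.const_mul _).neg I ?_
    filter_upwards [ae_ne_zero h.hn] with y hy
    rcases lt_or_ge ‖y‖ ρ with hr | hr
    · have := h.Gpos i hy hr
      have k0 := ker_nonneg (x - y)
      have : 0 ≤ ((ρ / 2) ^ (n - 4))⁻¹ * |G i y| := by positivity
      have : 0 ≤ rker (x - y) * G i y := by positivity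
      linarith
    · have k0 := ker_nonneg (x - y)
      have : rker (x - y) ≤ ((ρ / 2) ^ (n - 4))⁻¹ := by
        apply ker_le (by positivity)
        have := norm_sub_norm_le y x
        rw [norm_sub_rev] at this
        linarith
      have h1 := neg_abs_le (G i y)
      nlinarith [abs_nonneg (G i y)]
  rw [integral_neg, integral_const_mul] at this
  linarith

lemma sβ (h : Dat s ρ m0 U a b G) (i : Fin p) {c r : ℝ} {β : ℕ} (hc : 0 < c) (hr : 0 < r) (hrρ : r ≤ ρ)
    (hl : ∀ x : EE n, x ≠ 0 → ‖x‖ < r → c * (‖x‖ ^ β)⁻¹ ≤ U i x) : s * β < n := by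
  have kp := kap_pos h.hn
  have s1 := h.hs1
  refine nonint (c := kap n * c ^ s) h.hn (by positivity) hr ((h.Gi i).integrableOn) ?_
  intro x hx hxr
  have xp : 0 < ‖x‖ := norm_pos_iff.2 hx
  refine le_trans ?_ (h.Gge i hx (by linarith))
  have e : c ^ s * ‖x‖ ^ (-(s * β)) = (c * (‖x‖ ^ β)⁻¹) ^ s := by
    rw [Real.mul_rpow hc.le (by positivity), ← Real.rpow_natCast, ← Real.rpow_neg xp.le, ← Real.rpow_mul xp.le]
    congr 2; ring
  rw [mul_assoc, e]
  gcongr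
  exact hl x hx hxr

/-- eventually half -/
lemma half {c C r1 : ℝ} {β : ℕ} (hβ : 1 ≤ β) (hc : 0 < c) (hr : 0 < r1) (hC : 0 ≤ C) : ∃ r, 0 < r ∧ r ≤ r1 ∧
    ∀ x : EE n, x ≠ 0 → ‖x‖ < r → c / 2 * (‖x‖ ^ β)⁻¹ ≤ c * (‖x‖ ^ β)⁻¹ - C := by
  refine ⟨min r1 (min 1 (c / (2 * (C + 1)))), by positivity, min_le_left _ _, ?_⟩
  intro x hx hxr
  have xp : 0 < ‖x‖ := norm_pos_iff.2 hx
  have h1 : ‖x‖ < 1 := hxr.trans_le ((min_le_right _ _).trans (min_le_left _ _))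
  have h2 : ‖x‖ < c / (2 * (C + 1)) := hxr.trans_le ((min_le_right _ _).trans (min_le_right _ _))
  rw [lt_div_iff₀ (by positivity)] at h2
  have h3 : ‖x‖ ^ β ≤ ‖x‖ := pow_le_of_le_one xp.le h1.le (by omega)
  have h4 : C ≤ c / 2 * (‖x‖ ^ β)⁻¹ := by
    rw [le_mul_inv_iff₀ (by positivity)]
    nlinarith
  linarith

lemma lowa (h : Dat s ρ m0 U a b G) (i : Fin p) (ha : 0 < a i) : ∃ r, 0 < r ∧ r ≤ ρ / 2 ∧
    ∀ x : EE n, x ≠ 0 → ‖x‖ < r → a i / 2 * (‖x‖ ^ (n - 4))⁻¹ ≤ U i x := by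
  obtain ⟨C, C0, hC⟩ := h.lowk i
  obtain ⟨r, rp, hr, hh⟩ := half (n := n) (β := n - 4) (by have := h.hn; omega) ha (half_pos h.ρpos) C0
  refine ⟨r, rp, hr, fun x hx hxr => (hh x hx hxr).trans ?_⟩
  have h1 := hC x hx (by linarith)
  have : 0 ≤ b i * (rker x / ‖x‖ ^ 2) := mul_nonneg (h.b0 i) (div_nonneg (ker_nonneg x) (by positivity))
  have : rker x = (‖x‖ ^ (n - 4))⁻¹ := rfl
  rw [← this]
  linarith

lemma rker2 (hn : 5 ≤ n) (x : EE n) : rker x / ‖x‖ ^ 2 = (‖x‖ ^ (n - 2))⁻¹ := by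
  unfold rker
  rw [show n - 2 = (n - 4) + 2 by omega, pow_add, mul_inv]
  rfl

lemma lowb (h : Dat s ρ m0 U a b G) (i : Fin p) (hb : 0 < b i) : ∃ r, 0 < r ∧ r ≤ ρ / 2 ∧
    ∀ x : EE n, x ≠ 0 → ‖x‖ < r → b i / 2 * (‖x‖ ^ (n - 2))⁻¹ ≤ U i x := by
  obtain ⟨C, C0, hC⟩ := h.lowk i
  obtain ⟨r, rp, hr, hh⟩ := half (n := n) (β := n - 2) (by have := h.hn; omega) hb (half_pos h.ρpos) C0
  refine ⟨r, rp, hr, fun x hx hxr => (hh x hx hxr).trans ?_⟩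
  have h1 := hC x hx (by linarith)
  have : 0 ≤ a i * rker x := mul_nonneg (h.a0 i) (ker_nonneg x)
  rw [← rker2 h.hn]
  linarith

lemma sa (h : Dat s ρ m0 U a b G) (i : Fin p) (ha : 0 < a i) : s * ((n : ℝ) - 4) < n := by
  obtain ⟨r, rp, hr, hl⟩ := h.lowa i ha
  have := h.sβ i (half_pos ha) rp (by have := h.ρpos; linarith) hl
  rwa [Nat.cast_sub (by have := h.hn; omega)] at this

lemma sb (h : Dat s ρ m0 U a b G) (i : Fin p) (hb : 0 < b i) : s * ((n : ℝ) - 2) < n := by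
  obtain ⟨r, rp, hr, hl⟩ := h.lowb i hb
  have := h.sβ i (half_pos hb) rp (by have := h.ρpos; linarith) hl
  rwa [Nat.cast_sub (by have := h.hn; omega)] at this

lemma near (x y : EE n) (hy : y ∈ ball x (‖x‖ / 2)) : ‖x‖ / 2 ≤ ‖y‖ ∧ ‖y‖ ≤ 3 * ‖x‖ / 2 := by
  rw [mem_ball, dist_eq_norm] at hy
  have h1 := norm_sub_norm_le y x
  have h2 := norm_sub_norm_le x y
  rw [norm_sub_rev] at h2
  constructor <;> linarith

lemma caseB1 (h : Dat s ρ m0 U a b G) (i0 : Fin p) (hb : 0 < b i0) : Concl U := by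
  have hn := h.hn
  have hn' : (5 : ℝ) ≤ n := by exact_mod_cast h.hn
  have kp := kap_pos h.hn
  have c0 := c1_nonneg n
  have ρp := h.ρpos
  have s2 := h.sb i0 hb
  have s1 := h.hs1
  set A := ∑ i, (a i + b i) with hA
  have A0 : 0 ≤ A := Finset.sum_nonneg fun i _ => add_nonneg (h.a0 i) (h.b0 i)
  obtain ⟨C, C0, hC⟩ := h.ptbound (by nlinarith) (β := n - 2) (by omega) A0 (by
    intro i x hx _ hx1
    have xp : 0 < ‖x‖ := norm_pos_iff.2 hx
    rw [rker2 hn]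
    have : rker x ≤ (‖x‖ ^ (n - 2))⁻¹ := by
      unfold rker
      apply inv_anti₀ (by positivity)
      exact pow_le_pow_of_le_one xp.le hx1 (by omega)
    have h2 : a i + b i ≤ A := Finset.single_le_sum (f := fun i => a i + b i)
      (fun i _ => add_nonneg (h.a0 i) (h.b0 i)) (Finset.mem_univ i)
    have := h.a0 i
    calc _ ≤ a i * (‖x‖ ^ (n - 2))⁻¹ + b i * (‖x‖ ^ (n - 2))⁻¹ := by gcongr
      _ = (a i + b i) * (‖x‖ ^ (n - 2))⁻¹ := by ring
      _ ≤ _ := by gcongr)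
  obtain ⟨r, rp, hr, hl⟩ := h.lowb i0 hb
  set L := ∑ i, ∫ y, |G i y| with hL
  have Li : ∀ i, ∫ y, |G i y| ≤ L := fun i => Finset.single_le_sum (f := fun i => ∫ y, |G i y|)
      (fun i _ => integral_nonneg fun y => abs_nonneg _) (Finset.mem_univ i)
  have L0 : 0 ≤ L := Finset.sum_nonneg fun i _ => integral_nonneg fun y => abs_nonneg _
  set D := (kap n * C ^ s * c1 n + L) * 2 ^ (n - 4) with hD
  have D0 : 0 ≤ D := by positivity
  have pot : ∀ i, ∀ x : EE n, x ≠ 0 → ‖x‖ < min r (min (ρ / 4) (1 / 4)) →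
      |∫ y, rker (x - y) * G i y| ≤ D * (‖x‖ ^ (n - 4))⁻¹ := by
    intro i x hx hxr
    have xp : 0 < ‖x‖ := norm_pos_iff.2 hx
    have x1 : ‖x‖ < ρ / 4 := hxr.trans_le ((min_le_right _ _).trans (min_le_left _ _))
    have x2 : ‖x‖ < 1 / 4 := hxr.trans_le ((min_le_right _ _).trans (min_le_right _ _))
    set t := ‖x‖ / 2 with ht
    have tp : 0 < t := by positivity
    obtain ⟨_, bd⟩ := ker_mul_int hn (h.Gi i) (x := x) (σ := t) (B := kap n * C ^ s * (t ^ n)⁻¹) tp (by positivity)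
      (fun y hy y0 => by
        obtain ⟨v1, v2⟩ := near x y hy
        rw [abs_of_pos (h.Gpos i y0 (by linarith))]
        refine (h.Gle i y0 (by linarith)).trans ?_
        have v3 := hC y y0 (by linarith) (by linarith)
        have v0 := vnorm_nonneg U y
        rw [mul_assoc]
        gcongr
        calc vnorm U y ^ s ≤ (C * (t ^ (n - 2))⁻¹) ^ s := by
              refine Real.rpow_le_rpow v0 (v3.trans ?_) (by linarith)
              gcongr
          _ = C ^ s * t ^ (-(s * ((n : ℝ) - 2))) := by
              rw [Real.mul_rpow C0 (by positivity), ← Real.rpow_natCast, ← Real.rpow_neg tp.le, ← Real.rpow_mul tp.le,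
                Nat.cast_sub (by omega)]
              push_cast
              congr 2; ring
          _ ≤ C ^ s * t ^ (-(n : ℝ)) := by
              refine mul_le_mul_of_nonneg_left ?_ (by positivity)
              exact Real.rpow_le_rpow_of_exponent_ge tp (by linarith) (by linarith)
          _ = _ := by rw [Real.rpow_neg tp.le, Real.rpow_natCast])
    refine (abs_integral_le_integral_abs).trans (bd.trans ?_)
    have e1 : (t ^ n)⁻¹ * t ^ 4 = (t ^ (n - 4))⁻¹ := by
      have : t ^ n = t ^ (n - 4) * t ^ 4 := by rw [← pow_add]; congr 1; omega
      rw [this]; field_simp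
    have e2 : (t ^ (n - 4))⁻¹ = 2 ^ (n - 4) * (‖x‖ ^ (n - 4))⁻¹ := by
      rw [ht, div_pow]; field_simp
    calc _ = kap n * C ^ s * c1 n * ((t ^ n)⁻¹ * t ^ 4) + (t ^ (n - 4))⁻¹ * ∫ y, |G i y| := by ring
      _ ≤ kap n * C ^ s * c1 n * (t ^ (n - 4))⁻¹ + (t ^ (n - 4))⁻¹ * L := by
          rw [e1]; have := Li i; gcongr
      _ = D * (‖x‖ ^ (n - 4))⁻¹ := by rw [e2, hD]; ring
  refine concl_of (α := n - 4) (β := n - 2) (D := 2 * D) (c := b i0 / 2) (r0 := min r (min (ρ / 4) (1 / 4)))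
    (by omega) (by positivity) (by positivity) (by positivity) ?_ ?_
  · intro i x y hx hxy hxr
    have hy : y ≠ 0 := norm_pos_iff.1 (hxy ▸ norm_pos_iff.2 hx)
    have x1 : ‖x‖ < ρ / 4 := hxr.trans_le ((min_le_right _ _).trans (min_le_left _ _))
    have p1 := pot i x hx hxr
    have p2 := pot i y hy (hxy ▸ hxr)
    rw [(h.rep i x hx (by linarith)).2, (h.rep i y hy (by linarith)).2, rker_norm hxy, hxy]
    rw [← hxy] at p2 ⊢
    rw [abs_le] at p1 p2 ⊢
    constructor <;> linarith [p1.1, p1.2, p2.1, p2.2]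
  · intro y hy hyr
    exact (hl y hy (hyr.trans_le (min_le_left _ _))).trans (h.ule i0 y)

end Dat

open MeasureTheory Metric Filter Topology

lemma inv_pow_lip {A B : ℝ} (hA : 0 < A) (hB : 0 < B) (q : ℕ) :
    |(A ^ q)⁻¹ - (B ^ q)⁻¹| ≤ q * |A - B| * ((A ^ (q + 1))⁻¹ + (B ^ (q + 1))⁻¹) := by
  wlog h : A ≤ B generalizing A B
  · have := this hB hA (le_of_not_ge h)
    rw [abs_sub_comm, abs_sub_comm A B, add_comm (A ^ (q + 1))⁻¹]; exact this
  have h1 : (B ^ q)⁻¹ ≤ (A ^ q)⁻¹ := by gcongr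
  have key : B ^ q - A ^ q ≤ q * (B - A) * B ^ (q - 1) := by
    rcases Nat.eq_zero_or_pos q with h0 | h0
    · subst h0; simp
    have b := one_add_mul_le_pow (a := A / B - 1) (by have : 0 < A / B := by positivity
                                                      linarith) q
    have e : (1 + (A / B - 1)) ^ q = A ^ q / B ^ q := by rw [← div_pow]; ring_nf
    rw [e, le_div_iff₀ (by positivity)] at b
    have e2 : B ^ q = B ^ (q - 1) * B := by rw [← pow_succ]; congr 1; omega
    have e3 : (1 + q * (A / B - 1)) * B ^ q = B ^ q - q * (B - A) * B ^ (q - 1) := by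
      rw [e2]; field_simp; ring
    linarith
  rw [abs_of_nonneg (by linarith), abs_of_nonpos (by linarith)]
  have e : (A ^ q)⁻¹ - (B ^ q)⁻¹ = (B ^ q - A ^ q) * ((A ^ q)⁻¹ * (B ^ q)⁻¹) := by field_simp
  have k2 : B ^ (q - 1) * ((A ^ q)⁻¹ * (B ^ q)⁻¹) ≤ (A ^ (q + 1))⁻¹ ∨ q = 0 := by
    rcases Nat.eq_zero_or_pos q with h0 | h0
    · right; exact h0
    left
    have e2 : B ^ q = B ^ (q - 1) * B := by rw [← pow_succ]; congr 1; omega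
    have : B ^ (q - 1) * ((A ^ q)⁻¹ * (B ^ q)⁻¹) = (A ^ q)⁻¹ * B⁻¹ := by rw [e2]; field_simp
    rw [this, pow_succ, mul_inv]
    gcongr
  rcases k2 with k2 | k2
  · rw [e]
    calc (B ^ q - A ^ q) * ((A ^ q)⁻¹ * (B ^ q)⁻¹) ≤ (q * (B - A) * B ^ (q - 1)) * ((A ^ q)⁻¹ * (B ^ q)⁻¹) := by gcongr
      _ = q * (B - A) * (B ^ (q - 1) * ((A ^ q)⁻¹ * (B ^ q)⁻¹)) := by ring
      _ ≤ q * (B - A) * ((A ^ (q + 1))⁻¹ + (B ^ (q + 1))⁻¹) := by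
          apply mul_le_mul_of_nonneg_left _ (mul_nonneg (by positivity) (by linarith))
          have : 0 < (B ^ (q + 1))⁻¹ := by positivity
          linarith
      _ = _ := by ring
  · subst k2; simp

lemma pw3 {n : ℕ} (hn : 5 ≤ n) (z : EE n) : (‖z‖ ^ (n - 4 + 1))⁻¹ = pw 3 z := by
  unfold pw
  rw [show (3 : ℝ) - n = -((n - 4 + 1 : ℕ) : ℝ) by
    rw [Nat.cast_add, Nat.cast_sub (by omega)]; push_cast; ring, Real.rpow_neg (norm_nonneg _), Real.rpow_natCast]

lemma pw3_mul {n : ℕ} (hn : 5 ≤ n) {H : EE n → ℝ} (hH : Integrable H) {B : ℝ} (hB : 0 ≤ B)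
    (hb : ∀ y : EE n, y ≠ 0 → |H y| ≤ B) (x : EE n) : Integrable (fun y => pw 3 (x - y) * |H y|) ∧
    ∫ y, pw 3 (x - y) * |H y| ≤ B * (∫ z in ball (0 : EE n) 1, pw 3 z) + ∫ y, |H y| := by
  have I0 := (integrable_indicator_iff (isOpen_ball (x := (0 : EE n)) (ε := 1)).measurableSet).2
    (pw_int hn (α := 3) (by norm_num) 1)
  have I1 := (I0.comp_sub_left x).const_mul B
  have bd : ∀ᵐ y : EE n, pw 3 (x - y) * |H y| ≤ B * (ball (0 : EE n) 1).indicator (pw 3) (x - y) + |H y| := by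
    filter_upwards [ae_ne_zero hn, ae_ne hn x] with y hy hyx
    have h0 := pw_nonneg 3 (x - y)
    rcases lt_or_ge ‖x - y‖ 1 with h1 | h1
    · rw [Set.indicator_of_mem (by simpa using h1)]
      have := hb y hy
      nlinarith [abs_nonneg (H y)]
    · rw [Set.indicator_of_notMem (by simpa using h1)]
      have : pw 3 (x - y) ≤ 1 := by
        rw [← pw3 hn]
        apply inv_le_one_of_one_le₀
        exact one_le_pow₀ h1
      nlinarith [abs_nonneg (H y)]
  have I : Integrable (fun y => pw 3 (x - y) * |H y|) := by
    refine (I1.add hH.abs).mono' ?_ ?_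
    · exact (((pw_meas 3).comp (measurable_const.sub measurable_id)).aestronglyMeasurable).mul hH.abs.aestronglyMeasurable
    · filter_upwards [bd] with y hy
      rw [Real.norm_of_nonneg (mul_nonneg (pw_nonneg _ _) (abs_nonneg _))]; exact hy
  refine ⟨I, (integral_mono_ae I (I1.add hH.abs) bd).trans (le_of_eq ?_)⟩
  simp only [Pi.add_apply]
  rw [integral_add I1 hH.abs, integral_const_mul, integral_sub_left_eq_self (fun z => (ball (0 : EE n) 1).indicator (pw 3) z),
    integral_indicator measurableSet_ball]

lemma pot_int {n : ℕ} (hn : 5 ≤ n) {H : EE n → ℝ} (hH : Integrable H) {B : ℝ} (hB : 0 ≤ B)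
    (hb : ∀ y : EE n, y ≠ 0 → |H y| ≤ B) (x : EE n) : Integrable (fun y => rker (x - y) * H y) :=
  (ker_mul_int hn hH (x := x) (σ := 1) (B := B) one_pos hB (fun y _ h0 => hb y h0)).1

lemma pot_lip {n : ℕ} (hn : 5 ≤ n) {H : EE n → ℝ} (hH : Integrable H) {B : ℝ} (hB : 0 ≤ B)
    (hb : ∀ y : EE n, y ≠ 0 → |H y| ≤ B) : ∃ Λ, 0 ≤ Λ ∧ ∀ x x' : EE n,
      |(∫ y, rker (x - y) * H y) - ∫ y, rker (x' - y) * H y| ≤ Λ * ‖x - x'‖ := by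
  set K := B * (∫ z in ball (0 : EE n) 1, pw 3 z) + ∫ y, |H y| with hK
  have K0 : 0 ≤ K := add_nonneg (mul_nonneg hB (integral_nonneg fun z => pw_nonneg 3 z)) (integral_nonneg fun z => abs_nonneg _)
  refine ⟨(n - 4 : ℕ) * (2 * K), by positivity, ?_⟩
  intro x x'
  obtain ⟨I1, b1⟩ := pw3_mul hn hH hB hb x
  obtain ⟨I2, b2⟩ := pw3_mul hn hH hB hb x'
  have J1 := pot_int hn hH hB hb x
  have J2 := pot_int hn hH hB hb x'
  rw [← integral_sub J1 J2]
  refine abs_integral_le_integral_abs.trans ?_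
  calc ∫ y, |rker (x - y) * H y - rker (x' - y) * H y|
      ≤ ∫ y, (n - 4 : ℕ) * ‖x - x'‖ * (pw 3 (x - y) * |H y| + pw 3 (x' - y) * |H y|) := by
        refine integral_mono_ae (J1.sub J2).abs ((I1.add I2).const_mul _) ?_
        filter_upwards [ae_ne hn x, ae_ne hn x'] with y h1 h2
        have p1 : 0 < ‖x - y‖ := norm_pos_iff.2 (sub_ne_zero.2 h1.symm)
        have p2 : 0 < ‖x' - y‖ := norm_pos_iff.2 (sub_ne_zero.2 h2.symm)
        have := inv_pow_lip p1 p2 (n - 4)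
        rw [pw3 hn, pw3 hn] at this
        have t : |‖x - y‖ - ‖x' - y‖| ≤ ‖x - x'‖ := by
          refine (abs_norm_sub_norm_le _ _).trans (le_of_eq ?_); congr 1; abel
        rw [← sub_mul, abs_mul, ← add_mul, ← mul_assoc]
        refine mul_le_mul_of_nonneg_right (this.trans ?_) (abs_nonneg _)
        refine mul_le_mul_of_nonneg_right ?_ (add_nonneg (pw_nonneg _ _) (pw_nonneg _ _))
        gcongr
    _ = (n - 4 : ℕ) * ‖x - x'‖ * ((∫ y, pw 3 (x - y) * |H y|) + ∫ y, pw 3 (x' - y) * |H y|) := by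
        rw [integral_const_mul, integral_add I1 I2]
    _ ≤ (n - 4 : ℕ) * ‖x - x'‖ * (K + K) := by gcongr
    _ = _ := by ring

lemma Phi_lip {s A B v w S : ℝ} (hs : 1 < s) (hA : 0 < A) (hB : 0 < B) (hv : |v| ≤ A) (hw : |w| ≤ B)
    (h1 : |v - w| ≤ S) (h2 : |A - B| ≤ S) {D : ℝ} (hDA : A ≤ D) (hDB : B ≤ D) :
    |A ^ (s - 1) * v - B ^ (s - 1) * w| ≤ (1 + s) * D ^ (s - 1) * S := by
  wlog h : B ≤ A generalizing A B v w
  · have := this hB hA hw hv (by rwa [abs_sub_comm]) (by rwa [abs_sub_comm]) hDB hDA (le_of_not_ge h)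
    rwa [abs_sub_comm]
  have S0 : 0 ≤ S := (abs_nonneg _).trans h1
  have b := one_add_mul_self_le_rpow_one_add (s := B / A - 1) (p := s) (by
    have : 0 < B / A := by positivity
    linarith) hs.le
  rw [show 1 + (B / A - 1) = B / A by ring, Real.div_rpow hB.le hA.le, le_div_iff₀ (by positivity)] at b
  have eA : A ^ s = A ^ (s - 1) * A := by rw [← Real.rpow_add_one hA.ne']; congr 1; ring
  have eB : B ^ s = B ^ (s - 1) * B := by rw [← Real.rpow_add_one hB.ne']; congr 1; ring
  have e3 : (1 + s * (B / A - 1)) * A ^ s = A ^ s - s * A ^ (s - 1) * (A - B) := by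
    rw [eA]; field_simp; ring
  have m : B ^ (s - 1) ≤ A ^ (s - 1) := Real.rpow_le_rpow hB.le h (by linarith)
  have mD : A ^ (s - 1) ≤ D ^ (s - 1) := Real.rpow_le_rpow hA.le hDA (by linarith)
  have k1 : (A ^ (s - 1) - B ^ (s - 1)) * |w| ≤ s * A ^ (s - 1) * (A - B) := by
    calc (A ^ (s - 1) - B ^ (s - 1)) * |w| ≤ (A ^ (s - 1) - B ^ (s - 1)) * B :=
          mul_le_mul_of_nonneg_left hw (by linarith)
      _ ≤ A ^ s - B ^ s := by
          rw [eA, eB]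
          have : A ^ (s - 1) * B ≤ A ^ (s - 1) * A := by gcongr
          linarith
      _ ≤ _ := by linarith
  have e : A ^ (s - 1) * v - B ^ (s - 1) * w = A ^ (s - 1) * (v - w) + (A ^ (s - 1) - B ^ (s - 1)) * w := by ring
  have h2' : A - B ≤ S := (le_abs_self _).trans h2
  rw [e]
  calc _ ≤ |A ^ (s - 1) * (v - w)| + |(A ^ (s - 1) - B ^ (s - 1)) * w| := abs_add_le _ _
    _ = A ^ (s - 1) * |v - w| + (A ^ (s - 1) - B ^ (s - 1)) * |w| := by
        rw [abs_mul, abs_mul, abs_of_pos (by positivity : 0 < A ^ (s - 1)), abs_of_nonneg (a := A ^ (s - 1) - B ^ (s - 1)) (by linarith)]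
    _ ≤ A ^ (s - 1) * S + s * A ^ (s - 1) * S := by
        refine add_le_add (by gcongr) (k1.trans ?_)
        gcongr
    _ = (1 + s) * A ^ (s - 1) * S := by ring
    _ ≤ _ := by gcongr

open MeasureTheory Metric Filter Topology

namespace Dat
variable {n p : ℕ} {s ρ m0 : ℝ} {U : Fin p → EE n → ℝ} {a b : Fin p → ℝ} {G : Fin p → EE n → ℝ}

lemma supr (h : Dat s ρ m0 U a b G) {τ : ℝ} (hτ : 0 < τ) : ∃ M, 0 ≤ M ∧ ∀ i y, τ ≤ ‖y‖ → |G i y| ≤ M := by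
  choose B hB using fun i => h.Gb i τ hτ
  refine ⟨∑ i, B i, Finset.sum_nonneg fun i _ => (hB i).1, fun i y hy => ((hB i).2 y hy).trans ?_⟩
  exact Finset.single_le_sum (f := B) (fun i _ => (hB i).1) (Finset.mem_univ i)

/-- consequences of the kernel bound of the solution. -/
lemma caseB2_pre (h : Dat s ρ m0 U a b G) (hs : s * ((n : ℝ) - 4) < n) (hb : ∀ i, b i = 0) :
    ∃ C, 0 < C ∧ ∃ r, 0 < r ∧ r ≤ ρ ∧ (∀ x : EE n, x ≠ 0 → ‖x‖ < r → vnorm U x ≤ C * rker x) ∧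
      ∀ x : EE n, x ≠ 0 → (C * rker x) ^ (s - 1) = C ^ (s - 1) * ‖x‖ ^ ((4 - (s - 1) * ((n : ℝ) - 4)) - 4) := by
  have hn := h.hn
  set A := ∑ i, a i with hA
  have A0 : 0 ≤ A := Finset.sum_nonneg fun i _ => h.a0 i
  have ρp := h.ρpos
  obtain ⟨C, C0, hC⟩ := h.ptbound hs (β := n - 4) le_rfl A0 (by
    intro i x hx _ hx1
    have h2 : a i ≤ A := Finset.single_le_sum (f := a) (fun i _ => h.a0 i) (Finset.mem_univ i)
    have := ker_nonneg x
    change _ ≤ A * rker x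
    rw [hb i, zero_mul, add_zero]
    gcongr)
  refine ⟨C + 1, by positivity, min (ρ / 2) (1 / 2), by positivity, (min_le_left _ _).trans (by linarith), ?_, ?_⟩
  · intro x hx hxr
    have := hC x hx (hxr.trans_le (min_le_left _ _)) ((hxr.trans_le (min_le_right _ _)).le)
    refine this.trans ?_
    change C * rker x ≤ _
    have := ker_nonneg x
    gcongr
    linarith
  · intro x hx
    have xp : 0 < ‖x‖ := norm_pos_iff.2 hx
    rw [Real.mul_rpow (by positivity) (ker_nonneg x)]
    congr 1
    unfold rker
    rw [← Real.rpow_natCast, ← Real.rpow_neg xp.le, ← Real.rpow_mul xp.le, Nat.cast_sub (by omega)]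
    congr 1; push_cast; ring

lemma abs_pot {x : EE n} {H : EE n → ℝ} : |∫ y, rker (x - y) * H y| ≤ ∫ y, rker (x - y) * |H y| := by
  refine abs_integral_le_integral_abs.trans (le_of_eq ?_)
  congr 1; ext y
  rw [abs_mul, abs_of_nonneg (ker_nonneg _)]

lemma caseB2i (h : Dat s ρ m0 U a b G) (hs : s * ((n : ℝ) - 4) < n) (hb : ∀ i, b i = 0) (ha : ∀ i, a i = 0) :
    ∀ i, ∃ g : EE n → ℝ, Continuous g ∧ ∀ x : EE n, x ≠ 0 → ‖x‖ < ρ → g x = U i x := by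
  have hn := h.hn
  have hn' : (5 : ℝ) ≤ n := by exact_mod_cast h.hn
  have kp := kap_pos h.hn
  have s1 := h.hs1
  obtain ⟨C, Cp, r, rp, hr, hv, he⟩ := h.caseB2_pre hs hb
  set α := 4 - (s - 1) * ((n : ℝ) - 4) with hα
  obtain ⟨τ0, τp, hL⟩ := lemL (n := n) (p := p) hn (α := α) (B := kap n * C ^ (s - 1)) (by linarith) (by nlinarith)
    (by positivity)
  set τ := min τ0 r with hτ
  have τpos : 0 < τ := by positivity
  have τr : τ ≤ r := min_le_right _ _
  obtain ⟨M, M0, hM⟩ := h.supr τpos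
  set L := ∑ i, ∫ y, |G i y| with hLd
  have key := hL τ τpos (min_le_left _ _) L M (p * C) M0 U G h.Gi
    (fun i => Finset.single_le_sum (f := fun i => ∫ y, |G i y|)
      (fun i _ => integral_nonneg fun y => abs_nonneg _) (Finset.mem_univ i)) hM
    (fun i y hy hyτ => by
      have y1 : ‖y‖ < ρ := by linarith
      rw [abs_of_pos (h.Gpos i hy y1), h.Geq i y hy y1, mul_assoc, ← mul_assoc (C ^ (s - 1)), ← he y hy]
      have k0 := ker_nonneg y
      have v0 := vnorm_nonneg U y
      have u0 := h.upos i hy y1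
      have : U i y ≤ ∑ j, |U j y| := (le_abs_self _).trans
        (Finset.single_le_sum (f := fun j => |U j y|) (fun j _ => abs_nonneg _) (Finset.mem_univ i))
      have := hv y hy (by linarith)
      gcongr
      )
    (fun y hy hyτ => by
      have := hv y hy (by linarith)
      refine (Finset.sum_le_sum fun j _ => (abs_le_vnorm U j y).trans this).trans (le_of_eq ?_)
      simp [mul_assoc])
    (fun i x hx hxτ => by
      rw [(h.rep i x hx (by linarith)).2, ha i, hb i, zero_mul, zero_mul, zero_add, zero_add]
      exact abs_pot)
  intro i
  set Q := 2 * (p * (M * c1 n + L)) with hQ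
  have Q0 : ∀ x : EE n, x ≠ 0 → ‖x‖ < τ → vnorm U x ≤ Q := fun x hx hxτ => (vnorm_le_sum U x).trans (key x hx hxτ)
  obtain ⟨Λ, Λ0, hΛ⟩ := pot_lip hn (h.Gi i) (B := max M (kap n * |Q| ^ s)) (M0.trans (le_max_left _ _)) (by
    intro y hy
    rcases lt_or_ge ‖y‖ τ with h1 | h1
    · rw [abs_of_pos (h.Gpos i hy (by linarith))]
      refine (h.Gle i hy (by linarith)).trans (le_trans ?_ (le_max_right _ _))
      have v0 := vnorm_nonneg U y
      have := (Q0 y hy h1).trans (le_abs_self _)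
      gcongr
    · exact (hM i y h1).trans (le_max_left _ _))
  refine ⟨fun x => ∫ y, rker (x - y) * G i y, ?_, ?_⟩
  · refine LipschitzWith.continuous (K := ⟨Λ, Λ0⟩) (LipschitzWith.of_dist_le_mul fun x y => ?_)
    rw [dist_eq_norm, dist_eq_norm]; exact hΛ x y
  · intro x hx hxρ
    rw [(h.rep i x hx hxρ).2, ha i, hb i, zero_mul, zero_mul, zero_add, zero_add]

lemma caseB2ii (h : Dat s ρ m0 U a b G) (hs : s * ((n : ℝ) - 4) < n) (hb : ∀ i, b i = 0) (i0 : Fin p)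
    (ha : 0 < a i0) : Concl U := by
  have hn := h.hn
  have hn' : (5 : ℝ) ≤ n := by exact_mod_cast h.hn
  have kp := kap_pos h.hn
  have s1 := h.hs1
  obtain ⟨C, Cp, r, rp, hr, hv, he⟩ := h.caseB2_pre hs hb
  obtain ⟨r2, r2p, hr2, hlow⟩ := h.lowa i0 ha
  set α := 4 - (s - 1) * ((n : ℝ) - 4) with hα
  obtain ⟨τ0, τp, hL⟩ := lemL (n := n) (p := p) hn (α := α) (B := kap n * ((1 + s) * C ^ (s - 1))) (by linarith) (by nlinarith)
    (by positivity)
  set τ := min τ0 r with hτ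
  have τpos : 0 < τ := by positivity
  have τr : τ ≤ r := min_le_right _ _
  obtain ⟨M, M0, hM⟩ := h.supr τpos
  set L := ∑ i, ∫ y, |G i y| with hLd
  have L0 : 0 ≤ L := Finset.sum_nonneg fun i _ => integral_nonneg fun y => abs_nonneg _
  have Li : ∀ i, ∫ y, |G i y| ≤ L := fun i => Finset.single_le_sum (f := fun i => ∫ y, |G i y|)
      (fun i _ => integral_nonneg fun y => abs_nonneg _) (Finset.mem_univ i)
  have c0 := c1_nonneg n
  have key : ∀ T : EE n ≃ₗᵢ[ℝ] EE n, ∀ x ≠ 0, ‖x‖ < τ → ∑ j, |U j x - U j (T x)| ≤ 2 * (p * (2 * M * c1 n + 2 * L)) := by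
    intro T
    have mp := T.measurePreserving
    have me : MeasurableEmbedding T := T.toHomeomorph.measurableEmbedding
    have T0 : ∀ x : EE n, x ≠ 0 → T x ≠ 0 := fun x hx => by
      rw [← norm_pos_iff, T.norm_map]; exact norm_pos_iff.2 hx
    have GiT : ∀ i, Integrable (fun y => G i (T y)) := fun i => (mp.integrable_comp_emb me).2 (h.Gi i)
    refine hL τ τpos (min_le_left _ _) (2 * L) (2 * M) (2 * (p * C)) (by positivity) (fun i y => U i y - U i (T y))
      (fun i y => G i y - G i (T y)) (fun i => (h.Gi i).sub (GiT i)) ?_ ?_ ?_ ?_ ?_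
    · intro i
      have e : ∫ y, |G i (T y)| = ∫ y, |G i y| := mp.integral_comp me (fun y => |G i y|)
      have := Li i
      calc ∫ y, |G i y - G i (T y)| ≤ ∫ y, (|G i y| + |G i (T y)|) :=
            integral_mono ((h.Gi i).sub (GiT i)).abs ((h.Gi i).abs.add (GiT i).abs) fun y => abs_sub _ _
        _ = (∫ y, |G i y|) + ∫ y, |G i (T y)| := integral_add (h.Gi i).abs (GiT i).abs
        _ ≤ 2 * L := by rw [e]; linarith
    · intro i y hy
      have h1 := hM i y hy
      have h2 := hM i (T y) (by rwa [T.norm_map])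
      have := abs_sub (G i y) (G i (T y))
      show |G i y - G i (T y)| ≤ 2 * M
      linarith
    · intro i y hy hyτ
      have y1 : ‖y‖ < ρ := by linarith
      have Ty1 : ‖T y‖ < ρ := by rwa [T.norm_map]
      show |G i y - G i (T y)| ≤ _
      rw [h.Geq i y hy y1, h.Geq i _ (T0 y hy) Ty1, ← mul_sub, abs_mul, abs_of_pos kp, mul_assoc]
      refine mul_le_mul_of_nonneg_left ?_ kp.le
      have hh := vnorm_sub_le U y (T y)
      have := Phi_lip (v := U i y) (w := U i (T y)) (D := C * rker y) s1 (h.vpos hy y1) (h.vpos (T0 y hy) Ty1) (abs_le_vnorm U i y)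
        (abs_le_vnorm U i (T y)) (Finset.single_le_sum (f := fun j => |U j y - U j (T y)|) (fun j _ => abs_nonneg _) (Finset.mem_univ i)) hh
        (hv y hy (by linarith)) (by
          have := hv (T y) (T0 y hy) (by rw [T.norm_map]; linarith)
          rwa [rker_norm (T.norm_map y)] at this)
      rw [he y hy] at this
      refine this.trans (le_of_eq (by ring))
    · intro y hy hyτ
      have b1 := hv y hy (by linarith)
      have b2 := hv (T y) (T0 y hy) (by rw [T.norm_map]; linarith)
      rw [rker_norm (T.norm_map y)] at b2
      have : ∀ j, |U j y - U j (T y)| ≤ 2 * (C * rker y) := fun j => by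
        have := abs_sub (U j y) (U j (T y))
        have := abs_le_vnorm U j y
        have := abs_le_vnorm U j (T y)
        linarith
      refine (Finset.sum_le_sum fun j _ => this j).trans (le_of_eq ?_)
      simp; ring
    · intro i x hx hxτ
      obtain ⟨I1, e1⟩ := h.rep i x hx (by linarith)
      obtain ⟨I2, e2⟩ := h.rep i (T x) (T0 x hx) (by rw [T.norm_map]; linarith)
      have e3 : ∫ y, rker (T x - y) * G i y = ∫ y, rker (x - y) * G i (T y) := by
        rw [← mp.integral_comp me]
        congr 1; ext y
        rw [← map_sub, rker_norm (T.norm_map (x - y))]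
      have I3 : Integrable (fun y => rker (x - y) * G i (T y)) := by
        have := (mp.integrable_comp_emb me).2 I2
        refine this.congr (Eventually.of_forall fun y => ?_)
        simp only [Function.comp]
        rw [← map_sub, rker_norm (T.norm_map (x - y))]
      show |U i x - U i (T x)| ≤ _
      rw [e1, e2, e3, hb i, rker_norm (T.norm_map x), zero_mul, zero_mul, add_zero, add_sub_add_left_eq_sub, ← integral_sub I1 I3]
      simp_rw [← mul_sub]
      exact abs_pot
  refine concl_of (α := 0) (β := n - 4) (D := 2 * (p * (2 * M * c1 n + 2 * L))) (c := a i0 / 2) (r0 := min τ r2) (by omega)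
    (by positivity) (by positivity) (by positivity) ?_ ?_
  · intro i x y hx hxy hxr
    have hh := key ((ℝ ∙ (x - y))ᗮ.reflection) x hx (hxr.trans_le (min_le_left _ _))
    rw [Submodule.reflection_sub hxy] at hh
    rw [pow_zero, inv_one, mul_one]
    exact (Finset.single_le_sum (f := fun j => |U j x - U j y|) (fun j _ => abs_nonneg _) (Finset.mem_univ i)).trans hh
  · intro y hy hyr
    exact (hlow y hy (hyr.trans_le (min_le_right _ _))).trans (h.ule i0 y)

/-- Case B summary -/
lemma caseB (h : Dat s ρ m0 U a b G) (hs : s * ((n : ℝ) - 4) < n) :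
    Concl U ∨ ∀ i, ∃ g : EE n → ℝ, Continuous g ∧ ∀ x : EE n, x ≠ 0 → ‖x‖ < ρ → g x = U i x := by
  by_cases hb : ∀ i, b i = 0
  · by_cases ha : ∀ i, a i = 0
    · exact Or.inr (h.caseB2i hs hb ha)
    · push Not at ha
      obtain ⟨i, hi⟩ := ha
      exact Or.inl (h.caseB2ii hs hb i (lt_of_le_of_ne (h.a0 i) hi.symm))
  · push Not at hb
    obtain ⟨i, hi⟩ := hb
    exact Or.inl (h.caseB1 i (lt_of_le_of_ne (h.b0 i) hi.symm))

/-- Case A: no singular terms -/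
lemma caseA_ab (h : Dat s ρ m0 U a b G) (hs : (n : ℝ) ≤ s * ((n : ℝ) - 4)) (i : Fin p) : a i = 0 ∧ b i = 0 := by
  constructor
  · by_contra hi
    have := h.sa i (lt_of_le_of_ne (h.a0 i) (Ne.symm hi))
    linarith
  · by_contra hi
    have := h.sb i (lt_of_le_of_ne (h.b0 i) (Ne.symm hi))
    nlinarith [h.hs1]
end Dat

open MeasureTheory Metric Filter Topology

/-- volume of the unit ball -/
noncomputable def om (n : ℕ) : ℝ := (volume : Measure (EE n)).real (ball 0 1)

lemma om_pos (n : ℕ) : 0 < om n := by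
  unfold om
  rw [measureReal_def]
  exact ENNReal.toReal_pos (measure_ball_pos volume 0 one_pos).ne' measure_ball_lt_top.ne

lemma vol_ball {n : ℕ} (x : EE n) {ε : ℝ} (hε : 0 < ε) : (volume : Measure (EE n)).real (ball x ε) = ε ^ n * om n := by
  unfold om
  rw [measureReal_def, measureReal_def, Measure.addHaar_ball_of_pos volume x hε, ENNReal.toReal_mul,
    ENNReal.toReal_ofReal (by positivity)]
  simp

/-- averaging constant -/
noncomputable def CA (n : ℕ) : ℝ := (c1 n * 81 + om n) * 2 ^ (n - 4)

lemma CA_pos (n : ℕ) : 0 < CA n := by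
  have := om_pos n
  have := c1_nonneg n
  unfold CA; positivity

lemma ker_avg {n : ℕ} (hn : 5 ≤ n) {ε : ℝ} (hε : 0 < ε) {y : EE n} (hy : y ≠ 0) :
    IntegrableOn (fun x => rker (x - y)) (ball 0 ε) ∧
    ∫ x in ball (0 : EE n) ε, rker (x - y) ≤ CA n * ε ^ n * rker y := by
  have yp : 0 < ‖y‖ := norm_pos_iff.2 hy
  have om0 := om_pos n
  have c0 := c1_nonneg n
  have kp := ker_nonneg y
  have I : IntegrableOn (fun x => rker (x - y)) (ball 0 ε) := by
    have := ker_int_ball_sub hn y (ε + ‖y‖)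
    refine (this.mono_set ?_).congr_fun (fun x _ => ker_sub_comm _ _) measurableSet_ball
    intro x hx
    rw [mem_ball_zero_iff] at hx
    rw [mem_ball, dist_eq_norm]
    have := norm_sub_le x y
    linarith
  refine ⟨I, ?_⟩
  rcases le_or_gt (2 * ε) ‖y‖ with h | h
  · have : ∫ x in ball (0 : EE n) ε, rker (x - y) ≤ ∫ x in ball (0 : EE n) ε, 2 ^ (n - 4) * rker y := by
      refine setIntegral_mono_on I (integrableOn_const measure_ball_lt_top.ne) measurableSet_ball ?_
      intro x hx
      rw [mem_ball_zero_iff] at hx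
      have h1 : rker (x - y) ≤ ((‖y‖ / 2) ^ (n - 4))⁻¹ := by
        apply ker_le (by positivity)
        have := norm_sub_norm_le y x
        rw [norm_sub_rev] at this
        linarith
      refine h1.trans (le_of_eq ?_)
      unfold rker; rw [div_pow]; field_simp
    refine this.trans ?_
    rw [setIntegral_const, vol_ball _ hε, smul_eq_mul]
    have : 0 ≤ c1 n * 81 * 2 ^ (n - 4) * ε ^ n * rker y := by positivity
    unfold CA
    nlinarith
  · have e1 : ∫ x in ball (0 : EE n) ε, rker (x - y) ≤ ∫ x in ball y (3 * ε), rker (y - x) := by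
      have e : ∫ x in ball (0 : EE n) ε, rker (x - y) = ∫ x in ball (0 : EE n) ε, rker (y - x) := by
        congr 1; ext x; exact ker_sub_comm _ _
      rw [e]
      refine setIntegral_mono_set (ker_int_ball_sub hn y _) (Eventually.of_forall fun x => ker_nonneg _)
        (LE.le.eventuallyLE ?_)
      intro x hx
      rw [mem_ball_zero_iff] at hx
      rw [mem_ball, dist_eq_norm]
      have := norm_sub_le x y
      linarith
    refine e1.trans ?_
    rw [ker_integral_ball hn y (by positivity)]
    have e2 : ε ^ 4 = ε ^ n * (ε ^ (n - 4))⁻¹ := by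
      have : ε ^ n = ε ^ (n - 4) * ε ^ 4 := by rw [← pow_add]; congr 1; omega
      rw [this]; field_simp
    have e3 : (ε ^ (n - 4))⁻¹ ≤ 2 ^ (n - 4) * rker y := by
      unfold rker
      rw [← div_eq_mul_inv, le_div_iff₀ (by positivity), inv_mul_le_iff₀ (by positivity), ← mul_pow]
      exact pow_le_pow_left₀ yp.le (by linarith) _
    have e4 : ε ^ 4 ≤ ε ^ n * (2 ^ (n - 4) * rker y) := by rw [e2]; gcongr
    have : 0 ≤ om n * 2 ^ (n - 4) * ε ^ n * rker y := by positivity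
    unfold CA
    calc c1 n * (3 * ε) ^ 4 = c1 n * 81 * ε ^ 4 := by ring
      _ ≤ c1 n * 81 * (ε ^ n * (2 ^ (n - 4) * rker y)) := by gcongr
      _ ≤ _ := by linarith

lemma avg {n : ℕ} (hn : 5 ≤ n) {H : EE n → ℝ} (hH : Integrable H) (H0 : ∀ᵐ y, 0 ≤ H y)
    (hk : Integrable (fun y => rker y * H y)) {ε c : ℝ} (hε : 0 < ε) (hc0 : 0 ≤ c)
    (hc : ∀ x : EE n, x ≠ 0 → ‖x‖ < ε → Integrable (fun y => rker (x - y) * H y) ∧ c ≤ ∫ y, rker (x - y) * H y) :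
    c * om n ≤ CA n * ∫ y, rker y * H y := by
  have CAp := CA_pos n
  have om0 := om_pos n
  have kH0 : ∀ᵐ y, 0 ≤ rker y * H y := by
    filter_upwards [H0] with y hy using mul_nonneg (ker_nonneg _) hy
  have lower : ENNReal.ofReal (c * (ε ^ n * om n)) ≤
      ∫⁻ x in ball (0 : EE n) ε, ∫⁻ y, ENNReal.ofReal (rker (x - y)) * ENNReal.ofReal (H y) := by
    have : ENNReal.ofReal (c * (ε ^ n * om n)) = ∫⁻ x in ball (0 : EE n) ε, ENNReal.ofReal c := by
      rw [setLIntegral_const, ENNReal.ofReal_mul hc0, ← vol_ball (0 : EE n) hε, measureReal_def,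
        ENNReal.ofReal_toReal measure_ball_lt_top.ne]
    rw [this]
    refine setLIntegral_mono_ae' measurableSet_ball ?_
    filter_upwards [ae_ne_zero hn] with x hx hxε
    rw [mem_ball_zero_iff] at hxε
    obtain ⟨I, l⟩ := hc x hx hxε
    refine (ENNReal.ofReal_le_ofReal l).trans ?_
    rw [ofReal_integral_eq_lintegral_ofReal I (by
      filter_upwards [H0] with y hy using mul_nonneg (ker_nonneg _) hy)]
    exact le_of_eq (by congr 1; ext y; rw [ENNReal.ofReal_mul (ker_nonneg _)])
  have sw : ∫⁻ x in ball (0 : EE n) ε, ∫⁻ y, ENNReal.ofReal (rker (x - y)) * ENNReal.ofReal (H y) =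
      ∫⁻ y, ∫⁻ x in ball (0 : EE n) ε, ENNReal.ofReal (rker (x - y)) * ENNReal.ofReal (H y) := by
    apply lintegral_lintegral_swap
    have m1 : Measurable (fun z : EE n × EE n => ENNReal.ofReal (rker (z.1 - z.2))) :=
        (ker_meas.comp (measurable_fst.sub measurable_snd)).ennreal_ofReal
    have m2 : AEMeasurable (fun z : EE n × EE n => ENNReal.ofReal (H z.2)) ((volume.restrict (ball 0 ε)).prod volume) :=
      (hH.aestronglyMeasurable.aemeasurable.ennreal_ofReal).comp_snd
    exact m1.aemeasurable.mul m2
  have upper : ∫⁻ y, ∫⁻ x in ball (0 : EE n) ε, ENNReal.ofReal (rker (x - y)) * ENNReal.ofReal (H y) ≤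
      ENNReal.ofReal (CA n * ε ^ n * ∫ y, rker y * H y) := by
    rw [← integral_const_mul, ofReal_integral_eq_lintegral_ofReal (hk.const_mul _) (by
      filter_upwards [kH0] with y hy using mul_nonneg (by positivity) hy)]
    refine lintegral_mono_ae ?_
    filter_upwards [ae_ne_zero hn, H0] with y hy hH0
    rw [lintegral_mul_const' _ _ ENNReal.ofReal_ne_top]
    obtain ⟨I, l⟩ := ker_avg hn hε hy
    rw [← ofReal_integral_eq_lintegral_ofReal I (Eventually.of_forall fun x => ker_nonneg _), ← mul_assoc,
      ENNReal.ofReal_mul (mul_nonneg (by positivity) (ker_nonneg _))]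
    gcongr
  rw [sw] at lower
  have fin := lower.trans upper
  have i0 : 0 ≤ ∫ y, rker y * H y := integral_nonneg_of_ae kH0
  rw [ENNReal.ofReal_le_ofReal_iff (by positivity)] at fin
  have ep : 0 < ε ^ n := by positivity
  nlinarith

/-- part of `G` outside the ball of radius `τ` -/
noncomputable def Gout {n : ℕ} (G : EE n → ℝ) (τ : ℝ) : EE n → ℝ := (ball 0 τ)ᶜ.indicator G

/-- part of `G` inside the ball of radius `τ` -/
noncomputable def Gin {n : ℕ} (G : EE n → ℝ) (τ : ℝ) : EE n → ℝ := (ball 0 τ).indicator G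

/-- outer potential -/
noncomputable def hpot {n : ℕ} (G : EE n → ℝ) (τ : ℝ) (x : EE n) : ℝ := ∫ y, rker (x - y) * Gout G τ y

lemma Gsum {n : ℕ} (G : EE n → ℝ) (τ : ℝ) (y : EE n) : G y = Gin G τ y + Gout G τ y := by
  unfold Gin Gout
  rw [Set.indicator_self_add_compl_apply]

namespace Dat
variable {n p : ℕ} {s ρ m0 : ℝ} {U : Fin p → EE n → ℝ} {a b : Fin p → ℝ} {G : Fin p → EE n → ℝ}

lemma Gout_int (h : Dat s ρ m0 U a b G) (i : Fin p) (τ : ℝ) : Integrable (Gout (G i) τ) :=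
  (h.Gi i).indicator measurableSet_ball.compl

lemma Gin_int (h : Dat s ρ m0 U a b G) (i : Fin p) (τ : ℝ) : Integrable (Gin (G i) τ) :=
  (h.Gi i).indicator measurableSet_ball

lemma Gin_nonneg (h : Dat s ρ m0 U a b G) (i : Fin p) {τ : ℝ} (hτ : τ ≤ ρ) {y : EE n} (hy : y ≠ 0) :
    0 ≤ Gin (G i) τ y := by
  unfold Gin
  by_cases hb : y ∈ ball (0 : EE n) τ
  · rw [Set.indicator_of_mem hb]
    rw [mem_ball_zero_iff] at hb
    exact (h.Gpos i hy (by linarith)).le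
  · rw [Set.indicator_of_notMem hb]

lemma Gout_bd (h : Dat s ρ m0 U a b G) (i : Fin p) {τ : ℝ} (hτ : 0 < τ) : ∃ B, 0 ≤ B ∧ ∀ y, |Gout (G i) τ y| ≤ B := by
  obtain ⟨B, B0, hB⟩ := h.Gb i τ hτ
  refine ⟨B, B0, fun y => ?_⟩
  unfold Gout
  by_cases hb : y ∈ (ball (0 : EE n) τ)ᶜ
  · rw [Set.indicator_of_mem hb]
    exact hB y (by simpa using hb)
  · rw [Set.indicator_of_notMem hb]; simpa using B0

lemma hp_int (h : Dat s ρ m0 U a b G) (i : Fin p) {τ : ℝ} (hτ : 0 < τ) (x : EE n) :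
    Integrable (fun y => rker (x - y) * Gout (G i) τ y) := by
  obtain ⟨B, B0, hB⟩ := h.Gout_bd i hτ
  exact pot_int h.hn (h.Gout_int i τ) B0 (fun y _ => hB y) x

lemma hp_lip (h : Dat s ρ m0 U a b G) (i : Fin p) {τ : ℝ} (hτ : 0 < τ) : ∃ Λ, 0 ≤ Λ ∧ ∀ x x' : EE n,
    |hpot (G i) τ x - hpot (G i) τ x'| ≤ Λ * ‖x - x'‖ := by
  obtain ⟨B, B0, hB⟩ := h.Gout_bd i hτ
  exact pot_lip h.hn (h.Gout_int i τ) B0 (fun y _ => hB y)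

lemma hp_mono (h : Dat s ρ m0 U a b G) (i : Fin p) {τ τ' : ℝ} (hτ' : 0 < τ') (hle : τ' ≤ τ) (hτ : τ ≤ ρ) (x : EE n) :
    hpot (G i) τ x ≤ hpot (G i) τ' x := by
  unfold hpot
  refine integral_mono_ae (h.hp_int i (hτ'.trans_le hle) x) (h.hp_int i hτ' x) ?_
  filter_upwards [ae_ne_zero h.hn] with y hy
  refine mul_le_mul_of_nonneg_left ?_ (ker_nonneg _)
  unfold Gout
  by_cases h1 : y ∈ ball (0 : EE n) τ
  · rw [Set.indicator_of_notMem (by simpa using h1)]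
    apply Set.indicator_apply_nonneg
    intro _
    rw [mem_ball_zero_iff] at h1
    exact (h.Gpos i hy (by linarith)).le
  · have h2 : y ∉ ball (0 : EE n) τ' := fun hh => h1 (ball_subset_ball hle hh)
    rw [Set.indicator_of_mem h1, Set.indicator_of_mem h2]

lemma Uhp (h : Dat s ρ m0 U a b G) (i : Fin p) (ha : a i = 0) (hb : b i = 0) {τ : ℝ} (hτ : 0 < τ) {x : EE n} (hx : x ≠ 0)
    (hxρ : ‖x‖ < ρ) : Integrable (fun y => rker (x - y) * Gin (G i) τ y) ∧
      U i x = (∫ y, rker (x - y) * Gin (G i) τ y) + hpot (G i) τ x := by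
  obtain ⟨I, e⟩ := h.rep i x hx hxρ
  have I2 := h.hp_int i hτ x
  have I3 : Integrable (fun y => rker (x - y) * Gin (G i) τ y) := by
    refine (I.sub I2).congr (Eventually.of_forall fun y => ?_)
    simp only [Pi.sub_apply]
    rw [Gsum (G i) τ y]; ring
  refine ⟨I3, ?_⟩
  rw [e, ha, hb, zero_mul, zero_mul, zero_add, zero_add]
  unfold hpot
  rw [← integral_add I3 I2]
  congr 1; ext y; rw [Gsum (G i) τ y]; ring

lemma hp_pos (h : Dat s ρ m0 U a b G) (i : Fin p) (ha : a i = 0) (hb : b i = 0) :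
    ∃ τ, 0 < τ ∧ τ ≤ ρ ∧ 0 < hpot (G i) τ 0 := by
  by_contra hcon
  push Not at hcon
  have ρp := h.ρpos
  have hn := h.hn
  have CAp := CA_pos n
  have om0 := om_pos n
  have m0p := h.m0pos
  -- integrability of the kernel times G near zero
  have IK : IntegrableOn (fun y => rker y * G i y) (ball 0 ρ) := by
    have cov : AECover (volume.restrict (ball (0 : EE n) ρ)) atTop (fun m : ℕ => (ball (0 : EE n) (1 / ((m : ℝ) + 1)))ᶜ) := by
      constructor
      · filter_upwards [ae_restrict_of_ae (ae_ne_zero hn)] with y hy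
        have := (tendsto_one_div_add_atTop_nhds_zero_nat (𝕜 := ℝ)).eventually (gt_mem_nhds (norm_pos_iff.2 hy))
        filter_upwards [this] with m hm
        simp only [Set.mem_compl_iff, mem_ball_zero_iff, not_lt]
        exact hm.le
      · intro m; exact measurableSet_ball.compl
    refine cov.integrable_of_integral_bounded_of_nonneg_ae (-hpot (G i) ρ 0) ?_ ?_ ?_
    · intro m
      have := (h.hp_int i (τ := 1 / ((m : ℝ) + 1)) (by positivity) 0)
      have e : (fun y => rker ((0 : EE n) - y) * Gout (G i) (1 / ((m : ℝ) + 1)) y) =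
          (ball (0 : EE n) (1 / ((m : ℝ) + 1)))ᶜ.indicator (fun y => rker y * G i y) := by
        ext y
        unfold Gout
        rw [zero_sub, rker_norm (norm_neg y), ← Set.indicator_mul_right]
      rw [e, integrable_indicator_iff measurableSet_ball.compl] at this
      exact IntegrableOn.mono_measure this Measure.restrict_le_self
    · rw [ae_restrict_iff' measurableSet_ball]
      filter_upwards [ae_ne_zero hn] with y hy hyb
      rw [mem_ball_zero_iff] at hyb
      exact mul_nonneg (ker_nonneg _) (h.Gpos i hy hyb).le
    · have := (tendsto_one_div_add_atTop_nhds_zero_nat (𝕜 := ℝ)).eventually (gt_mem_nhds ρp)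
      filter_upwards [this] with m hm
      set t := 1 / ((m : ℝ) + 1) with ht
      have tp : 0 < t := by positivity
      have h1 := hcon t tp hm.le
      have e : hpot (G i) t 0 - hpot (G i) ρ 0 = ∫ y in (ball (0 : EE n) t)ᶜ, rker y * G i y ∂(volume.restrict (ball 0 ρ)) := by
        unfold hpot
        rw [← integral_sub (h.hp_int i tp 0) (h.hp_int i ρp 0), Measure.restrict_restrict measurableSet_ball.compl,
          ← integral_indicator (measurableSet_ball.compl.inter measurableSet_ball)]
        congr 1; ext y
        rw [zero_sub, rker_norm (norm_neg y)]
        unfold Gout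
        simp only [Set.indicator, Set.mem_compl_iff, Set.mem_inter_iff, mem_ball_zero_iff, not_lt]
        by_cases c1 : t ≤ ‖y‖ <;> by_cases c2 : ρ ≤ ‖y‖
        · simp [c1, c2]
        · simp [c1, c2, not_le.1 c2]
        · exfalso; linarith
        · simp [c1, c2]
      linarith
  have small : Tendsto (fun τ : ℝ => ∫ y in ball (0 : EE n) τ, rker y * G i y ∂(volume.restrict (ball 0 ρ))) (𝓝[>] 0) (𝓝 0) := by
    refine Integrable.tendsto_setIntegral_nhds_zero IK ?_
    have t1 : Tendsto (fun τ : ℝ => ENNReal.ofReal (τ ^ n * om n)) (𝓝[>] 0) (𝓝 0) := by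
      have : Tendsto (fun τ : ℝ => ENNReal.ofReal (τ ^ n * om n)) (𝓝 0) (𝓝 (ENNReal.ofReal ((0 : ℝ) ^ n * om n))) := by
        exact (ENNReal.continuous_ofReal.comp (by fun_prop : Continuous fun τ : ℝ => τ ^ n * om n)).tendsto 0
      rw [zero_pow (by omega), zero_mul, ENNReal.ofReal_zero] at this
      exact this.mono_left nhdsWithin_le_nhds
    refine tendsto_of_tendsto_of_tendsto_of_le_of_le' tendsto_const_nhds t1 (Eventually.of_forall fun _ => zero_le) ?_
    filter_upwards [self_mem_nhdsWithin] with τ hτ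
    simp only [Function.comp]
    refine (Measure.restrict_apply_le _ _).trans (le_of_eq ?_)
    rw [← vol_ball (0 : EE n) hτ, measureReal_def, ENNReal.ofReal_toReal measure_ball_lt_top.ne]
  have c4 : 0 < m0 / 4 * om n / CA n := by positivity
  obtain ⟨τ, hτ3, hτ1, hτ2⟩ := ((small.eventually (gt_mem_nhds c4)).and
    (Ioo_mem_nhdsGT ρp)).exists
  obtain ⟨Λ, Λ0, hΛ⟩ := h.hp_lip i hτ1
  have eIn : ∫ y, rker y * Gin (G i) τ y = ∫ y in ball (0 : EE n) τ, rker y * G i y ∂(volume.restrict (ball 0 ρ)) := by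
    rw [Measure.restrict_restrict measurableSet_ball, Set.inter_eq_left.2 (ball_subset_ball hτ2.le),
      ← integral_indicator measurableSet_ball]
    congr 1; ext y
    unfold Gin
    rw [← Set.indicator_mul_right]
  have IIn : Integrable (fun y => rker y * Gin (G i) τ y) := by
    have := IK.mono_set (ball_subset_ball hτ2.le)
    rw [← integrable_indicator_iff measurableSet_ball] at this
    refine this.congr (Eventually.of_forall fun y => ?_)
    simp only [Gin]
    rw [← Set.indicator_mul_right]
  have := avg hn (h.Gin_int i τ) (by
      filter_upwards [ae_ne_zero hn] with y hy using h.Gin_nonneg i hτ2.le hy) IIn (ε := min ρ (m0 / (2 * (Λ + 1)))) (c := m0 / 2) (by positivity) (by positivity) (by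
      intro x hx hxε
      have x1 := hxε.trans_le (min_le_left _ _)
      have x2 := hxε.trans_le (min_le_right _ _)
      obtain ⟨I, e⟩ := h.Uhp i ha hb hτ1 hx x1
      refine ⟨I, ?_⟩
      have l := h.low i x hx x1
      have h1 := (le_abs_self _).trans (hΛ x 0)
      have h2 := hcon τ hτ1 hτ2.le
      rw [sub_zero] at h1
      rw [lt_div_iff₀ (by positivity)] at x2
      have : 0 ≤ ‖x‖ := norm_nonneg _
      nlinarith)
  rw [eIn] at this
  rw [lt_div_iff₀ CAp] at hτ3
  nlinarith

lemma hdelta (h : Dat s ρ m0 U a b G) (hab : ∀ i, a i = 0 ∧ b i = 0) :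
    ∃ τ δ Λ : ℝ, 0 < τ ∧ τ ≤ ρ ∧ τ ≤ 1 ∧ 0 < δ ∧ 0 ≤ Λ ∧ (∀ i, ∀ x : EE n, ‖x‖ < τ → δ ≤ hpot (G i) τ x) ∧
      ∀ i, ∀ x x' : EE n, |hpot (G i) τ x - hpot (G i) τ x'| ≤ Λ * ‖x - x'‖ := by
  have ρp := h.ρpos
  choose t tp tρ ht using fun i => h.hp_pos i (hab i).1 (hab i).2
  choose L L0 hL using fun i => h.hp_lip i (tp i)
  haveI : Nonempty (Fin p) := ⟨⟨0, h.hp⟩⟩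
  obtain ⟨i1, hi1⟩ := Finite.exists_min t
  obtain ⟨i2, hi2⟩ := Finite.exists_min (fun i => hpot (G i) (t i) 0)
  obtain ⟨i3, hi3⟩ := Finite.exists_max L
  set τ := min (min (t i1) 1) (hpot (G i2) (t i2) 0 / (2 * (L i3 + 1))) with hτ
  have L30 := L0 i3
  have hpp := ht i2
  have τp : 0 < τ := lt_min (lt_min (tp i1) one_pos) (by positivity)
  have τ1 : τ ≤ t i1 := (min_le_left _ _).trans (min_le_left _ _)
  have τ2 : τ ≤ 1 := (min_le_left _ _).trans (min_le_right _ _)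
  have τ3 : τ ≤ hpot (G i2) (t i2) 0 / (2 * (L i3 + 1)) := min_le_right _ _
  choose Λ Λ0 hΛ using fun i => h.hp_lip i τp
  obtain ⟨i4, hi4⟩ := Finite.exists_max Λ
  refine ⟨τ, hpot (G i2) (t i2) 0 / 2, Λ i4, τp, τ1.trans (tρ i1), τ2, by positivity, Λ0 i4, ?_, ?_⟩
  · intro i x hx
    refine le_trans ?_ (h.hp_mono i τp (τ1.trans (hi1 i)) (tρ i) x)
    have h1 := hL i 0 x
    have h2 := hi2 i
    have h3 := hi3 i
    rw [zero_sub, norm_neg] at h1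
    have h4 := (le_abs_self _).trans h1
    rw [le_div_iff₀ (by positivity)] at τ3
    have := norm_nonneg x
    nlinarith
  · intro i x x'
    refine (hΛ i x x').trans ?_
    have := hi4 i
    gcongr

end Dat

open MeasureTheory Metric Filter Topology
open EuclideanGeometry

lemma iv_sub {n : ℕ} (x y : EE n) (l : ℝ) : inversion x l y - x = (l / ‖y - x‖) ^ 2 • (y - x) := by
  have := inversion_vsub_center x l y
  rwa [vsub_eq_sub, vsub_eq_sub, dist_eq_norm] at this

lemma iv_norm {n : ℕ} (x y : EE n) (l : ℝ) : ‖inversion x l y - x‖ = l ^ 2 / ‖y - x‖ := by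
  have := dist_inversion_center x y l
  rwa [dist_eq_norm, dist_eq_norm] at this

lemma iv_lt {n : ℕ} {x y : EE n} {l : ℝ} (hl : 0 < l) (hy : l < ‖y - x‖) : ‖inversion x l y - x‖ < l := by
  rw [iv_norm, div_lt_iff₀ (hl.trans hy)]; nlinarith

lemma Qle {l Y : ℝ} (hl : 0 ≤ l) (hy : l ≤ Y) : l / Y ≤ 1 := div_le_one_of_le₀ hy (hl.trans hy)

/-- basic inequality for the inversion -/
lemma iv_far {n : ℕ} {x y z : EE n} {l : ℝ} (hl : 0 < l) (hy : l ≤ ‖y - x‖) (hz : l ≤ ‖z - x‖) :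
    l / ‖y - x‖ * ‖y - z‖ ≤ ‖inversion x l y - z‖ := by
  have yp : 0 < ‖y - x‖ := hl.trans_le hy
  set Q := l / ‖y - x‖ with hQ
  have Qp : 0 < Q := by positivity
  have Q1 : Q ≤ 1 := Qle hl.le hy
  have QY : Q * ‖y - x‖ = l := by rw [hQ]; field_simp
  have e1 : inversion x l y - z = Q ^ 2 • (y - x) - (z - x) := by rw [hQ, ← iv_sub]; abel
  have e2 : y - z = (y - x) - (z - x) := by abel
  apply le_of_sq_le_sq _ (norm_nonneg _)
  rw [e1, e2, mul_pow, norm_sub_sq_real (y - x), norm_sub_sq_real (Q ^ 2 • (y - x)), norm_smul, inner_smul_left, Real.norm_of_nonneg (by positivity)]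
  simp only [conj_trivial]
  have : 0 ≤ (1 - Q ^ 2) * (‖z - x‖ ^ 2 - (Q * ‖y - x‖) ^ 2) := by
    rw [QY]; apply mul_nonneg <;> nlinarith
  nlinarith

/-- moving-sphere kernel -/
noncomputable def DD {n : ℕ} (x : EE n) (l : ℝ) (y z : EE n) : ℝ :=
  rker (y - z) - (l / ‖y - x‖) ^ (n - 4) * rker (inversion x l y - z)

lemma DD_nonneg {n : ℕ} {x y z : EE n} {l : ℝ} (hl : 0 < l) (hy : l ≤ ‖y - x‖) (hz : l ≤ ‖z - x‖) (hyz : z ≠ y) :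
    0 ≤ DD x l y z := by
  have yp : 0 < ‖y - x‖ := hl.trans_le hy
  have h := iv_far hl hy hz
  have d : 0 < ‖y - z‖ := norm_pos_iff.2 (sub_ne_zero.2 hyz.symm)
  have Qp : 0 < l / ‖y - x‖ := by positivity
  unfold DD rker
  rw [sub_nonneg]
  have : (l / ‖y - x‖ * ‖y - z‖) ^ (n - 4) ≤ ‖inversion x l y - z‖ ^ (n - 4) := by gcongr
  have p1 : 0 < ‖inversion x l y - z‖ := lt_of_lt_of_le (by positivity) h
  rw [← div_eq_mul_inv, div_le_iff₀ (by positivity), inv_mul_eq_div, le_div_iff₀ (by positivity), ← mul_pow]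
  exact this

lemma DD_refl {n : ℕ} {x y z : EE n} {l : ℝ} (hl : 0 < l) (hy : l < ‖y - x‖) (hz : l < ‖z - x‖) :
    DD x l y (inversion x l z) = - (‖z - x‖ / l) ^ (n - 4) * DD x l y z := by
  have yp : 0 < ‖y - x‖ := hl.trans hy
  have zp : 0 < ‖z - x‖ := hl.trans hz
  have yx : y ≠ x := sub_ne_zero.1 (norm_pos_iff.1 yp)
  have zx : z ≠ x := sub_ne_zero.1 (norm_pos_iff.1 zp)
  have e1 := dist_inversion_inversion yx zx l
  have ysx : inversion x l y ≠ x := by rw [Ne, inversion_eq_center hl.ne']; exact yx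
  have e2 := dist_inversion_inversion ysx zx l
  rw [inversion_inversion _ hl.ne', dist_inversion_center] at e2
  simp only [dist_eq_norm] at e1 e2
  unfold DD rker
  rw [e1, e2]
  have l0 := hl.ne'
  have a1 : l ^ 2 / (l ^ 2 / ‖y - x‖ * ‖z - x‖) * ‖inversion x l y - z‖ =
    ‖y - x‖ / ‖z - x‖ * ‖inversion x l y - z‖ := by field_simp
  rw [a1, mul_pow, mul_pow, mul_inv, mul_inv, div_pow, div_pow, div_pow, div_pow, mul_pow, ← pow_mul, mul_comm 2, pow_mul]
  field_simp
  ring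

lemma DD_tail {n : ℕ} {x y z : EE n} {l : ℝ} (hl : 0 < l) (hy : l ≤ ‖y - x‖) (hz : 2 * l ≤ ‖z - x‖) (hyz : z ≠ y) :
    DD x l y z ≤ (n - 4 : ℕ) * 3 * (1 - l / ‖y - x‖) * rker (y - z) := by
  have yp : 0 < ‖y - x‖ := hl.trans_le hy
  have zp : 0 < ‖z - x‖ := by linarith
  have h := iv_far hl hy (z := z) (by linarith)
  have d : 0 < ‖y - z‖ := norm_pos_iff.2 (sub_ne_zero.2 hyz.symm)
  set Q := l / ‖y - x‖ with hQ
  have Qp : 0 < Q := by positivity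
  have Q1 : Q ≤ 1 := Qle hl.le hy
  have QY : Q * ‖y - x‖ = l := by rw [hQ]; field_simp
  have p1 : 0 < ‖inversion x l y - z‖ := lt_of_lt_of_le (by positivity) h
  set θ := Q * ‖y - z‖ / ‖inversion x l y - z‖ with hθ
  have θ0 : 0 ≤ θ := by positivity
  have bern : 1 - θ ^ (n - 4) ≤ (n - 4 : ℕ) * (1 - θ) := by
    have := one_add_mul_le_pow (a := θ - 1) (by linarith) (n - 4)
    rw [add_sub_cancel] at this
    linarith
  have e : DD x l y z = (1 - θ ^ (n - 4)) * rker (y - z) := by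
    have e0 : θ ^ (n - 4) * rker (y - z) = Q ^ (n - 4) * rker (inversion x l y - z) := by
      unfold rker
      rw [hθ, div_pow, mul_pow]
      field_simp
    unfold DD
    rw [← hQ, ← e0]; ring
  have th : 1 - θ ≤ 3 * (1 - Q) := by
    have i1 : inversion x l y - z - Q • (y - z) = -((1 - Q) • (Q • (y - x) + (z - x))) := by
      have e1 : inversion x l y - z = Q ^ 2 • (y - x) - (z - x) := by rw [hQ, ← iv_sub]; abel
      have e2 : y - z = (y - x) - (z - x) := by abel
      rw [e1, e2]
      module
    have i2 : ‖inversion x l y - z‖ ≤ Q * ‖y - z‖ + (1 - Q) * (l + ‖z - x‖) := by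
      have : inversion x l y - z = Q • (y - z) + (inversion x l y - z - Q • (y - z)) := by abel
      rw [this]
      refine (norm_add_le _ _).trans ?_
      rw [i1, norm_neg, norm_smul, norm_smul, Real.norm_of_nonneg Qp.le, Real.norm_of_nonneg (by linarith)]
      have : ‖Q • (y - x) + (z - x)‖ ≤ l + ‖z - x‖ := by
        refine (norm_add_le _ _).trans ?_
        rw [norm_smul, Real.norm_of_nonneg Qp.le, QY]
      have := mul_le_mul_of_nonneg_left this (by linarith : 0 ≤ 1 - Q)
      linarith
    have i3 : ‖z - x‖ / 2 ≤ ‖inversion x l y - z‖ := by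
      have := norm_sub_norm_le (z - x) (inversion x l y - x)
      rw [sub_sub_sub_cancel_right, norm_sub_rev z (inversion x l y), iv_norm] at this
      have : l ^ 2 / ‖y - x‖ ≤ l := by rw [div_le_iff₀ yp]; nlinarith
      linarith
    rw [hθ, one_sub_div p1.ne', div_le_iff₀ p1]
    nlinarith [mul_le_mul_of_nonneg_left i3 (by linarith : 0 ≤ 1 - Q)]
  rw [e]
  have := ker_nonneg (y - z)
  have n0 : (0 : ℝ) ≤ (n - 4 : ℕ) := by positivity
  refine mul_le_mul_of_nonneg_right ?_ this
  have := mul_le_mul_of_nonneg_left th n0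
  linarith

open scoped RealInnerProductSpace in
lemma iv_det {n : ℕ} (c : ℝ) (K : Submodule ℝ (EE n)) :
    |((c • (K.reflection : EE n →L[ℝ] EE n)) : EE n →L[ℝ] EE n).det| = |c| ^ n := by
  have e : ((c • (K.reflection : EE n →L[ℝ] EE n)) : EE n →L[ℝ] EE n).det = c ^ n * LinearMap.det K.reflection.toLinearMap := by
    have := LinearMap.det_smul c (K.reflection.toLinearMap)
    rw [finrank_euclideanSpace, Fintype.card_fin] at this
    exact this
  rw [e, Submodule.det_reflection, abs_mul, abs_pow, abs_pow, abs_neg, abs_one, one_pow, mul_one]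

/-- change of variables by inversion -/
lemma iv_cov {n : ℕ} (hn : 5 ≤ n) (x : EE n) {l : ℝ} (hl : 0 < l) (F : EE n → ℝ) :
    (IntegrableOn F (ball x l) ↔ IntegrableOn (fun z => (l / ‖z - x‖) ^ (2 * n) * F (inversion x l z)) (closedBall x l)ᶜ) ∧
    ∫ z in ball x l, F z = ∫ z in (closedBall x l)ᶜ, (l / ‖z - x‖) ^ (2 * n) * F (inversion x l z) := by
  have him : inversion x l '' (closedBall x l)ᶜ = ball x l \ {x} := by
    ext z
    simp only [Set.mem_image, Set.mem_compl_iff, mem_closedBall, dist_eq_norm, not_le, Set.mem_sdiff, mem_ball, Set.mem_singleton_iff]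
    constructor
    · rintro ⟨w, hw, rfl⟩
      refine ⟨iv_lt hl hw, ?_⟩
      rw [inversion_eq_center hl.ne']
      rintro rfl
      simp at hw; linarith
    · rintro ⟨h1, h2⟩
      refine ⟨inversion x l z, ?_, inversion_inversion _ hl.ne' _⟩
      have : 0 < ‖z - x‖ := norm_pos_iff.2 (sub_ne_zero.2 h2)
      rw [iv_norm, lt_div_iff₀ this]; nlinarith
  have hms : MeasurableSet (closedBall x l)ᶜ := measurableSet_closedBall.compl
  have hd : ∀ z ∈ (closedBall x l)ᶜ, HasFDerivWithinAt (inversion x l)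
      ((l / dist z x) ^ 2 • ((Submodule.span ℝ {z - x})ᗮ.reflection : EE n →L[ℝ] EE n)) (closedBall x l)ᶜ z := by
    intro z hz
    refine (hasFDerivAt_inversion ?_).hasFDerivWithinAt
    rintro rfl
    simp at hz; linarith
  have hinj : Set.InjOn (inversion x l) (closedBall x l)ᶜ := (inversion_injective x hl.ne').injOn
  have key : ∀ z : EE n, |((l / dist z x) ^ 2 • ((Submodule.span ℝ {z - x})ᗮ.reflection : EE n →L[ℝ] EE n)).det| •
      F (inversion x l z) = (l / ‖z - x‖) ^ (2 * n) * F (inversion x l z) := by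
    intro z
    rw [iv_det, abs_of_nonneg (by positivity), ← pow_mul, dist_eq_norm, smul_eq_mul]
  have hae : (ball x l \ {x} : Set (EE n)) =ᵐ[volume] ball x l := by
    have := nontrivEE hn
    exact sdiff_null_ae_eq_self (measure_singleton x)
  constructor
  · have := integrableOn_image_iff_integrableOn_abs_det_fderiv_smul volume hms hd hinj F
    rw [him, integrableOn_congr_set_ae hae] at this
    simp only [key] at this
    exact this
  · have := integral_image_eq_integral_abs_det_fderiv_smul volume hms hd hinj F
    rw [him, setIntegral_congr_set hae] at this
    simp only [key] at this
    exact this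

open MeasureTheory Metric Filter Topology
open EuclideanGeometry

/-- tail weight -/
noncomputable def HT (n : ℕ) (τ : ℝ) : EE n → ℝ := (ball 0 τ)ᶜ.indicator (fun z => (‖z‖ ^ (n + 4))⁻¹)

lemma HT_nonneg {n : ℕ} (τ : ℝ) (z : EE n) : 0 ≤ HT n τ z := by
  unfold HT
  exact Set.indicator_nonneg (fun z _ => by positivity) z

lemma HT_le {n : ℕ} {τ : ℝ} (hτ : 0 < τ) (z : EE n) : HT n τ z ≤ (τ ^ (n + 4))⁻¹ := by
  unfold HT
  by_cases hb : z ∈ (ball (0 : EE n) τ)ᶜ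
  · rw [Set.indicator_of_mem hb]
    have : τ ≤ ‖z‖ := by simpa using hb
    gcongr
  · rw [Set.indicator_of_notMem hb]; positivity

lemma HT_int {n : ℕ} {τ : ℝ} (hτ : 0 < τ) (hτ1 : τ ≤ 1) : Integrable (HT n τ) := by
  have I : Integrable (fun z : EE n => (2 / τ) ^ (n + 4) * (1 + ‖z‖) ^ (-((n : ℝ) + 4))) := by
    refine (integrable_one_add_norm ?_).const_mul _
    rw [finrank_euclideanSpace, Fintype.card_fin]; linarith
  refine I.mono' ?_ (Eventually.of_forall fun z => ?_)
  · refine Measurable.aestronglyMeasurable ?_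
    exact Measurable.indicator (by fun_prop) measurableSet_ball.compl
  · rw [Real.norm_of_nonneg (HT_nonneg _ _)]
    unfold HT
    by_cases hb : z ∈ (ball (0 : EE n) τ)ᶜ
    · rw [Set.indicator_of_mem hb]
      have : τ ≤ ‖z‖ := by simpa using hb
      have zp : 0 < ‖z‖ := hτ.trans_le this
      have e : (1 + ‖z‖) ^ (-((n : ℝ) + 4)) = ((1 + ‖z‖) ^ (n + 4))⁻¹ := by
        rw [Real.rpow_neg (by positivity)]
        congr 1
        exact_mod_cast Real.rpow_natCast (1 + ‖z‖) (n + 4)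
      rw [e, ← div_eq_mul_inv, ← div_pow, div_eq_mul_inv, ← inv_pow]
      have : (‖z‖)⁻¹ ≤ 2 / τ / (1 + ‖z‖) := by
        rw [div_div, inv_le_comm₀ zp (by positivity), inv_div, div_le_iff₀ (by positivity)]
        nlinarith
      rw [← div_eq_mul_inv]
      gcongr
    · rw [Set.indicator_of_notMem hb]; positivity

lemma HT_pot {n : ℕ} (hn : 5 ≤ n) {τ : ℝ} (hτ : 0 < τ) (hτ1 : τ ≤ 1) : ∃ T, 0 < T ∧ ∀ y : EE n,
    Integrable (fun z => rker (y - z) * HT n τ z) ∧ ∫ z, rker (y - z) * HT n τ z ≤ T := by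
  have i0 : 0 ≤ ∫ z, |HT n τ z| := integral_nonneg fun z => abs_nonneg _
  have c0 := c1_nonneg n
  refine ⟨(τ ^ (n + 4))⁻¹ * (c1 n * 1 ^ 4) + (1 ^ (n - 4))⁻¹ * (∫ z, |HT n τ z|) + 1, by positivity, fun y => ?_⟩
  obtain ⟨h1, h2⟩ := ker_mul_int hn (HT_int (n := n) hτ hτ1) (x := y) (σ := 1) (B := (τ ^ (n + 4))⁻¹) one_pos (by positivity)
    (fun z _ _ => by rw [abs_of_nonneg (HT_nonneg _ _)]; exact HT_le hτ z)
  refine ⟨h1, ?_⟩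
  have : ∫ z, rker (y - z) * HT n τ z ≤ ∫ z, |rker (y - z) * HT n τ z| := integral_mono h1 h1.abs fun z => le_abs_self _
  linarith

/-- data in the supercritical-type case -/
structure DatA {n p : ℕ} (s ρ m0 : ℝ) (U : Fin p → EE n → ℝ) (a b : Fin p → ℝ) (G : Fin p → EE n → ℝ)
    (τ δ Λ T : ℝ) : Prop extends Dat s ρ m0 U a b G where
  hab : ∀ i, a i = 0 ∧ b i = 0
  τpos : 0 < τ
  τρ : τ ≤ ρ
  τ1 : τ ≤ 1
  δpos : 0 < δ
  Λ0 : 0 ≤ Λ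
  hδ : ∀ i, ∀ x : EE n, ‖x‖ < τ → δ ≤ hpot (G i) τ x
  hΛ : ∀ i, ∀ x x' : EE n, |hpot (G i) τ x - hpot (G i) τ x'| ≤ Λ * ‖x - x'‖
  Tpos : 0 < T
  hT : ∀ y : EE n, Integrable (fun z => rker (y - z) * HT n τ z) ∧ ∫ z, rker (y - z) * HT n τ z ≤ T

/-- the moving sphere inequality -/
def PP {n p : ℕ} (U : Fin p → EE n → ℝ) (τ : ℝ) (x : EE n) (l : ℝ) : Prop :=
  ∀ i, ∀ y : EE n, y ≠ 0 → ‖y‖ < τ → l < ‖y - x‖ → (l / ‖y - x‖) ^ (n - 4) * U i (inversion x l y) ≤ U i y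

/-- admissible centers and radii -/
structure Adm {n p : ℕ} (U : Fin p → EE n → ℝ) (τ δ Λ δ' : ℝ) (x : EE n) (l1 : ℝ) : Prop where
  x0 : x ≠ 0
  xτ : ‖x‖ ≤ τ / 4
  xΛ : 4 * Λ * ‖x‖ ≤ δ
  l1p : 0 < l1
  l1x : l1 ≤ ‖x‖
  hv : ∀ z : EE n, z ≠ 0 → ‖z - x‖ ≤ 2 * l1 ^ 2 / τ → l1 ^ (n - 4) * vnorm U z ≤ δ'

namespace Adm
variable {n p : ℕ} {U : Fin p → EE n → ℝ} {τ δ Λ δ' l1 : ℝ} {x : EE n}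

lemma iv_mem (A : Adm U τ δ Λ δ' x l1) {l : ℝ} (hl : 0 < l) (hll : l < l1) {y : EE n} (hy : l < ‖y - x‖) :
    inversion x l y ≠ 0 ∧ ‖inversion x l y‖ < 2 * ‖x‖ := by
  have h1 := iv_lt hl hy
  have := A.l1x
  constructor
  · intro h0
    rw [h0, zero_sub, norm_neg] at h1
    linarith
  · have := norm_sub_norm_le (inversion x l y) x
    linarith

end Adm

namespace DatA
variable {n p : ℕ} {s ρ m0 τ δ Λ T : ℝ} {U : Fin p → EE n → ℝ} {a b : Fin p → ℝ} {G : Fin p → EE n → ℝ}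

lemma Gscale (h : DatA s ρ m0 U a b G τ δ Λ T) (i : Fin p) {z w : EE n} (hz : z ≠ 0) (hzτ : ‖z‖ < τ) (hw : w ≠ 0)
    (hwτ : ‖w‖ < τ) {Q : ℝ} (Q0 : 0 < Q) (Q1 : Q ≤ 1) (hU : ∀ i, Q ^ (n - 4) * U i w ≤ U i z) :
    Q ^ (n + 4) * G i w ≤ G i z := by
  have hn := h.hn
  have hs1 := h.hs1
  have zρ := hzτ.trans_le h.τρ
  have wρ := hwτ.trans_le h.τρ
  have kp := kap_pos hn
  rw [h.Geq i z hz zρ, h.Geq i w hw wρ]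
  have qp : 0 < Q ^ (n - 4) := by positivity
  have hv : Q ^ (n - 4) * vnorm U w ≤ vnorm U z := by
    have e : Q ^ (n - 4) * vnorm U w = √(∑ i, (Q ^ (n - 4) * U i w) ^ 2) := by
      unfold vnorm
      simp only [mul_pow]
      rw [← Finset.mul_sum, Real.sqrt_mul (by positivity), Real.sqrt_sq qp.le]
    rw [e]
    unfold vnorm
    refine Real.sqrt_le_sqrt (Finset.sum_le_sum fun j _ => ?_)
    have := h.upos j hw wρ
    have := hU j
    gcongr
  have v1 := h.vpos hw wρ
  have v2 := h.vpos hz zρ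
  have u1 := h.upos i hw wρ
  have u2 := h.upos i hz zρ
  have m : (Q ^ (n - 4) * vnorm U w) ^ (s - 1) * (Q ^ (n - 4) * U i w) ≤ vnorm U z ^ (s - 1) * U i z := by
    have := hU i
    have : (Q ^ (n - 4) * vnorm U w) ^ (s - 1) ≤ vnorm U z ^ (s - 1) :=
      Real.rpow_le_rpow (by positivity) hv (by linarith)
    gcongr
  rw [Real.mul_rpow qp.le v1.le] at m
  have pw : Q ^ (n + 4) ≤ (Q ^ (n - 4)) ^ (s - 1) * Q ^ (n - 4) := by
    have e : (Q ^ (n - 4)) ^ (s - 1) * Q ^ (n - 4) = Q ^ (s * ((n : ℝ) - 4)) := by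
      have c : (Q ^ (n - 4) : ℝ) = Q ^ ((n : ℝ) - 4) := by
        rw [← Real.rpow_natCast, Nat.cast_sub (by omega)]; norm_num
      rw [c, ← Real.rpow_mul Q0.le, ← Real.rpow_add Q0]
      congr 1; ring
    have e2 : (Q ^ (n + 4) : ℝ) = Q ^ ((n : ℝ) + 4) := by
      rw [← Real.rpow_natCast]; push_cast; rfl
    rw [e, e2]
    exact Real.rpow_le_rpow_of_exponent_ge Q0 Q1 h.hs2.le
  have pos : 0 < vnorm U w ^ (s - 1) * U i w := by positivity
  have := mul_le_mul_of_nonneg_right pw pos.le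
  have : Q ^ (n + 4) * (vnorm U w ^ (s - 1) * U i w) ≤ vnorm U z ^ (s - 1) * U i z := by linarith
  nlinarith

lemma Gtail (h : DatA s ρ m0 U a b G τ δ Λ T) (i : Fin p) {w : EE n} (hw : w ≠ 0)
    (hwτ : ‖w‖ < τ) {l l1 δ' : ℝ} (l0 : 0 < l) (ll : l ≤ l1) (l1' : l1 ≤ 1) (hv : l1 ^ (n - 4) * vnorm U w ≤ δ') :
    l ^ (n + 4) * G i w ≤ kap n * δ' ^ s := by
  have hn := h.hn
  have hs1 := h.hs1
  have wρ := hwτ.trans_le h.τρ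
  have kp := kap_pos hn
  have v1 := h.vpos hw wρ
  have l1p := l0.trans_le ll
  have g1 := h.Gle i hw wρ
  have p1 : l ^ (n + 4) ≤ l1 ^ (n + 4) := by gcongr
  have e : (l1 ^ (n - 4)) ^ s = l1 ^ (s * ((n : ℝ) - 4)) := by
      have c : (l1 ^ (n - 4) : ℝ) = l1 ^ ((n : ℝ) - 4) := by
        rw [← Real.rpow_natCast, Nat.cast_sub (by omega)]; norm_num
      rw [c, ← Real.rpow_mul l1p.le]
      congr 1; ring
  have e2 : (l1 ^ (n + 4) : ℝ) = l1 ^ ((n : ℝ) + 4) := by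
      rw [← Real.rpow_natCast]; push_cast; rfl
  have p2 : l1 ^ (n + 4) ≤ (l1 ^ (n - 4)) ^ s := by
    rw [e, e2]
    exact Real.rpow_le_rpow_of_exponent_ge l1p l1' h.hs2.le
  have p3 : (l1 ^ (n - 4)) ^ s * vnorm U w ^ s ≤ δ' ^ s := by
    rw [← Real.mul_rpow (by positivity) v1.le]
    exact Real.rpow_le_rpow (by positivity) hv (by linarith)
  have vs : 0 < vnorm U w ^ s := by positivity
  calc l ^ (n + 4) * G i w ≤ (l1 ^ (n - 4)) ^ s * (kap n * vnorm U w ^ s) := by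
        apply mul_le_mul (p1.trans p2) g1 (h.Gpos i hw wρ).le (by positivity)
    _ = kap n * ((l1 ^ (n - 4)) ^ s * vnorm U w ^ s) := by ring
    _ ≤ _ := by gcongr

end DatA

open MeasureTheory Metric Filter Topology
open EuclideanGeometry

lemma cball_ae {n : ℕ} (hn : 5 ≤ n) (x : EE n) (l : ℝ) : ((closedBall x l)ᶜ : Set (EE n)) =ᵐ[volume] (ball x l)ᶜ := by
  have := nontrivEE hn
  have h : (ball x l : Set (EE n)) =ᵐ[volume] closedBall x l := by
    refine (LE.le.eventuallyLE ball_subset_closedBall).antisymm ?_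
    rw [ae_le_set]
    rw [closedBall_sdiff_ball]
    exact Measure.addHaar_sphere volume x l
  exact h.compl.symm

namespace DatA
variable {n p : ℕ} {s ρ m0 τ δ Λ T : ℝ} {U : Fin p → EE n → ℝ} {a b : Fin p → ℝ} {G : Fin p → EE n → ℝ}

lemma hgap (h : DatA s ρ m0 U a b G τ δ Λ T) (i : Fin p) {x y : EE n} {l : ℝ} (l0 : 0 < l) (hy : l < ‖y - x‖)
    (yτ : ‖y‖ < τ) (hΛl : 4 * Λ * l ≤ δ) :
    δ / 2 * (1 - l / ‖y - x‖) ≤ hpot (G i) τ y - (l / ‖y - x‖) ^ (n - 4) * hpot (G i) τ (inversion x l y) := by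
  have hn := h.hn
  have yp : 0 < ‖y - x‖ := l0.trans hy
  have e0 : ‖y - inversion x l y‖ = (1 - (l / ‖y - x‖) ^ 2) * ‖y - x‖ := by
    have : y - inversion x l y = (1 - (l / ‖y - x‖) ^ 2) • (y - x) := by
      rw [sub_smul, one_smul, ← iv_sub]; abel
    rw [this, norm_smul, Real.norm_of_nonneg]
    have : (l / ‖y - x‖) ^ 2 ≤ 1 := pow_le_one₀ (by positivity) (Qle l0.le hy.le)
    linarith
  set Q := l / ‖y - x‖ with hQ
  have Q0 : 0 < Q := by positivity
  have Q1 : Q ≤ 1 := Qle l0.le hy.le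
  have QY : Q * ‖y - x‖ = l := by rw [hQ]; field_simp
  have h1 := h.hδ i y yτ
  have h2 := (abs_le.1 (h.hΛ i y (inversion x l y))).1
  rw [e0] at h2
  have q1 : Q ^ (n - 4) ≤ Q := pow_le_of_le_one Q0.le Q1 (by omega)
  have qp : 0 < Q ^ (n - 4) := by positivity
  have L0 := h.Λ0
  have δp := h.δpos
  set A := hpot (G i) τ y
  set B := hpot (G i) τ (inversion x l y)
  have h3 : Q ^ (n - 4) * (Λ * ((1 - Q ^ 2) * ‖y - x‖)) ≤ Λ * (2 * (1 - Q)) * l := by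
    calc Q ^ (n - 4) * (Λ * ((1 - Q ^ 2) * ‖y - x‖)) ≤ Q * (Λ * ((2 * (1 - Q)) * ‖y - x‖)) := by
          have z1 : 1 - Q ^ 2 ≤ 2 * (1 - Q) := by nlinarith [sq_nonneg (1 - Q)]
          have z2 : 0 ≤ 1 - Q ^ 2 := by nlinarith
          gcongr
      _ = Λ * (2 * (1 - Q)) * (Q * ‖y - x‖) := by ring
      _ = _ := by rw [QY]
  have h4 : Q ^ (n - 4) * (-(Λ * ((1 - Q ^ 2) * ‖y - x‖))) ≤ Q ^ (n - 4) * (A - B) := mul_le_mul_of_nonneg_left h2 qp.le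
  have h5 : (1 - Q) * δ ≤ (1 - Q ^ (n - 4)) * A := by
    apply mul_le_mul _ h1 δp.le <;> linarith
  have h6 : (1 - Q) * (4 * Λ * l) ≤ (1 - Q) * δ := mul_le_mul_of_nonneg_left hΛl (by linarith)
  nlinarith

lemma gap (h : DatA s ρ m0 U a b G τ δ Λ T) {δ' : ℝ}
    (hδ' : ((n - 4 : ℕ) : ℝ) * 3 * (2 ^ (n + 4) * (kap n * δ' ^ s)) * T ≤ δ / 4) {x : EE n} {l l1 : ℝ} (A : Adm U τ δ Λ δ' x l1)
    (hdp0 : 0 ≤ δ')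
    (l0 : 0 < l) (ll : l < l1) (hP : PP U τ x l) (i : Fin p) {y : EE n} (y0 : y ≠ 0) (yτ : ‖y‖ < τ) (hy : l < ‖y - x‖) :
    δ / 4 * (1 - l / ‖y - x‖) ≤ U i y - (l / ‖y - x‖) ^ (n - 4) * U i (inversion x l y) := by
  have hn := h.hn
  have yp : 0 < ‖y - x‖ := l0.trans hy
  have lx : l < ‖x‖ := ll.trans_le A.l1x
  have xτ := A.xτ
  have τp := h.τpos
  have τρ := h.τρ
  have l11 : l1 ≤ 1 := by have := A.l1x; have := h.τ1; linarith
  have kp := kap_pos hn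
  have hg := h.hgap i l0 hy yτ (by
    have := A.xΛ; have := h.Λ0; nlinarith)
  obtain ⟨ys0, ysn⟩ := A.iv_mem l0 ll hy
  have ysρ : ‖inversion x l y‖ < ρ := by linarith
  obtain ⟨I1, e1⟩ := h.Uhp i (h.hab i).1 (h.hab i).2 τp y0 (yτ.trans_le τρ)
  obtain ⟨I2, e2⟩ := h.Uhp i (h.hab i).1 (h.hab i).2 τp ys0 ysρ
  set Q := l / ‖y - x‖ with hQ
  have Q1 : Q ≤ 1 := Qle l0.le hy.le
  have IF : Integrable (fun z => DD x l y z * Gin (G i) τ z) := by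
    refine (I1.sub (I2.const_mul (Q ^ (n - 4)))).congr (Eventually.of_forall fun z => ?_)
    simp only [Pi.sub_apply]
    unfold DD; ring
  have eF : ∫ z, DD x l y z * Gin (G i) τ z =
      (∫ z, rker (y - z) * Gin (G i) τ z) - Q ^ (n - 4) * ∫ z, rker (inversion x l y - z) * Gin (G i) τ z := by
    rw [← integral_const_mul, ← integral_sub I1 (I2.const_mul _)]
    congr 1; ext z; unfold DD; ring
  have split := integral_add_compl (measurableSet_ball (x := x) (ε := l)) IF
  obtain ⟨c1, c2⟩ := iv_cov hn x l0 (fun z => DD x l y z * Gin (G i) τ z)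
  have IB := c1.1 IF.integrableOn
  have IC : IntegrableOn (fun z => DD x l y z * Gin (G i) τ z) (closedBall x l)ᶜ := IF.integrableOn
  have c3 : ∫ z in (ball x l)ᶜ, DD x l y z * Gin (G i) τ z = ∫ z in (closedBall x l)ᶜ, DD x l y z * Gin (G i) τ z :=
    setIntegral_congr_set (cball_ae hn x l).symm
  rw [c2, c3, ← integral_add IB IC] at split
  obtain ⟨IT, hT⟩ := h.hT y
  set K := ((n - 4 : ℕ) : ℝ) * 3 * (2 ^ (n + 4) * (kap n * δ' ^ s)) with hK
  have dp : 0 ≤ δ' ^ s := Real.rpow_nonneg hdp0 _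
  have K0 : 0 ≤ K := by positivity
  have low : ∫ z in (closedBall x l)ᶜ, -(K * (1 - Q) * (rker (y - z) * HT n τ z)) ≤
      ∫ z in (closedBall x l)ᶜ, ((l / ‖z - x‖) ^ (2 * n) * (DD x l y (inversion x l z) * Gin (G i) τ (inversion x l z)) +
        DD x l y z * Gin (G i) τ z) := by
    refine setIntegral_mono_on_ae (IT.const_mul _).neg.integrableOn (IB.add IC) measurableSet_closedBall.compl ?_
    filter_upwards [ae_ne_zero hn, ae_ne hn y] with z z0 zy hz
    simp only [Set.mem_compl_iff, mem_closedBall, dist_eq_norm, not_le] at hz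
    have zp : 0 < ‖z - x‖ := l0.trans hz
    obtain ⟨zs0, zsn⟩ := A.iv_mem l0 ll hz
    have zsτ : ‖inversion x l z‖ < τ := by linarith
    have Dn := DD_nonneg l0 hy.le hz.le zy
    have gi : Gin (G i) τ (inversion x l z) = G i (inversion x l z) := by
      unfold Gin; rw [Set.indicator_of_mem]; rwa [mem_ball_zero_iff]
    have key : (l / ‖z - x‖) ^ (2 * n) * (DD x l y (inversion x l z) * Gin (G i) τ (inversion x l z)) +
        DD x l y z * Gin (G i) τ z = DD x l y z * (Gin (G i) τ z - (l / ‖z - x‖) ^ (n + 4) * G i (inversion x l z)) := by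
      rw [DD_refl l0 hy hz, gi]
      have : (l / ‖z - x‖) ^ (2 * n) = (l / ‖z - x‖) ^ (n + 4) * (l / ‖z - x‖) ^ (n - 4) := by
        rw [← pow_add]; congr 1; omega
      have t : (l / ‖z - x‖) ^ (n - 4) * (‖z - x‖ / l) ^ (n - 4) = 1 := by
        rw [← mul_pow, div_mul_div_comm, mul_comm, div_self (by positivity), one_pow]
      rw [this]
      linear_combination (-(l / ‖z - x‖) ^ (n + 4) * DD x l y z * G i (inversion x l z)) * t
    rw [key]
    by_cases hzτ : ‖z‖ < τ
    · have g1 : Gin (G i) τ z = G i z := by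
        unfold Gin; rw [Set.indicator_of_mem]; rwa [mem_ball_zero_iff]
      have g2 : HT n τ z = 0 := by
        unfold HT; rw [Set.indicator_of_notMem]; simpa using hzτ
      rw [g1, g2, mul_zero, mul_zero, neg_zero]
      refine mul_nonneg Dn (sub_nonneg.2 ?_)
      exact h.Gscale i z0 hzτ zs0 zsτ (by positivity) (Qle l0.le hz.le) (fun j => hP j z z0 hzτ hz)
    · push Not at hzτ
      have g1 : Gin (G i) τ z = 0 := by
        unfold Gin; rw [Set.indicator_of_notMem]; simpa using hzτ
      have g2 : HT n τ z = (‖z‖ ^ (n + 4))⁻¹ := by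
        unfold HT; rw [Set.indicator_of_mem]; simpa using hzτ
      have zx : ‖z‖ / 2 ≤ ‖z - x‖ := by
        have := norm_sub_norm_le z x
        linarith
      have zpp : 0 < ‖z‖ := norm_pos_iff.2 z0
      have D1 := DD_tail l0 hy.le (z := z) (by linarith) zy
      have G1 := h.Gtail i zs0 zsτ l0 ll.le l11 (A.hv _ zs0 (by
        rw [iv_norm, div_le_div_iff₀ zp τp]
        have : l ^ 2 ≤ l1 ^ 2 := by gcongr
        nlinarith))
      have Gp := h.Gpos i zs0 (zsτ.trans_le τρ)
      have G2 : (l / ‖z - x‖) ^ (n + 4) * G i (inversion x l z) ≤ 2 ^ (n + 4) * (kap n * δ' ^ s) * (‖z‖ ^ (n + 4))⁻¹ := by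
        have : (‖z - x‖ ^ (n + 4))⁻¹ ≤ 2 ^ (n + 4) * (‖z‖ ^ (n + 4))⁻¹ := by
          rw [← div_eq_mul_inv, ← div_pow, ← inv_pow]
          gcongr
          rw [inv_le_comm₀ zp (by positivity), inv_div]; exact zx
        calc (l / ‖z - x‖) ^ (n + 4) * G i (inversion x l z) = (‖z - x‖ ^ (n + 4))⁻¹ * (l ^ (n + 4) * G i (inversion x l z)) := by
              rw [div_pow]; ring
          _ ≤ (2 ^ (n + 4) * (‖z‖ ^ (n + 4))⁻¹) * (kap n * δ' ^ s) := by
              apply mul_le_mul this G1 (by positivity) (by positivity)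
          _ = _ := by ring
      rw [g1, g2, zero_sub]
      have := mul_le_mul D1 G2 (by positivity) (by
        have := ker_nonneg (y - z)
        have : 0 ≤ 1 - Q := by linarith
        positivity)
      rw [hK]
      linarith
  have low2 : -(K * (1 - Q) * T) ≤ ∫ z in (closedBall x l)ᶜ, -(K * (1 - Q) * (rker (y - z) * HT n τ z)) := by
    rw [integral_neg, integral_const_mul]
    have : ∫ z in (closedBall x l)ᶜ, (rker (y - z) * HT n τ z) ≤ T :=
      (setIntegral_le_integral IT (Eventually.of_forall fun z => mul_nonneg (ker_nonneg _) (HT_nonneg _ _))).trans hT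
    have : K * (1 - Q) * ∫ z in (closedBall x l)ᶜ, (rker (y - z) * HT n τ z) ≤ K * (1 - Q) * T :=
      mul_le_mul_of_nonneg_left this (mul_nonneg K0 (by linarith))
    linarith
  have low3 : -(δ / 4 * (1 - Q)) ≤ ∫ z, DD x l y z * Gin (G i) τ z := by
    rw [← split]
    refine le_trans ?_ (low2.trans low)
    have := mul_le_mul_of_nonneg_right hδ' (by linarith : 0 ≤ 1 - Q)
    linarith
  rw [eF] at low3
  rw [e1, e2]
  linarith

end DatA

open MeasureTheory Metric Filter Topology
open EuclideanGeometry

lemma deriv_nonneg_of_right {k : ℝ → ℝ} {k' t0 : ℝ} (hk : HasDerivAt k k' t0) (h0 : k t0 = 0)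
    (hp : ∀ᶠ t in 𝓝[>] t0, 0 ≤ k t) : 0 ≤ k' := by
  have h1 : Tendsto (slope k t0) (𝓝[>] t0) (𝓝 k') :=
    (hasDerivAt_iff_tendsto_slope.1 hk).mono_left (nhdsWithin_mono t0 (fun t (ht : t0 < t) => ht.ne'))
  refine ge_of_tendsto h1 ?_
  filter_upwards [hp, self_mem_nhdsWithin] with t ht ht2
  have : t0 < t := ht2
  rw [slope_def_field, h0, sub_zero]
  exact div_nonneg ht (by linarith)

namespace DatA
variable {n p : ℕ} {s ρ m0 τ δ Λ T : ℝ} {U : Fin p → EE n → ℝ} {a b : Fin p → ℝ} {G : Fin p → EE n → ℝ}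

/-- Euler type quantity -/
noncomputable def EQ {n : ℕ} (u : EE n → ℝ) (x y : EE n) : ℝ := ((n - 4 : ℕ) : ℝ) / 2 * u y + fderiv ℝ u y (y - x)

lemma EQ_cont {u : EE n → ℝ} {x y : EE n} (hu : ContDiffAt ℝ 1 u y) : ContinuousAt (EQ u x) y := by
  have h1 : ContinuousAt (fderiv ℝ u) y := hu.continuousAt_fderiv (by norm_num)
  have h2 : ContinuousAt u y := hu.continuousAt
  unfold EQ
  exact (continuousAt_const.mul h2).add (h1.clm_apply (by fun_prop))

lemma ray_mono {u : EE n → ℝ} {x y : EE n} {Q : ℝ} (Q0 : 0 < Q) (Q1 : Q ≤ 1)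
    (hd : ∀ t ∈ Set.Icc Q 1, DifferentiableAt ℝ u (x + t ^ 2 • (y - x)))
    (hE : ∀ t ∈ Set.Icc Q 1, 0 ≤ EQ u x (x + t ^ 2 • (y - x))) :
    Q ^ (n - 4) * u (x + Q ^ 2 • (y - x)) ≤ u y := by
  have D : ∀ t ∈ Set.Icc Q 1, HasDerivAt (fun t : ℝ => t ^ (n - 4) * u (x + t ^ 2 • (y - x)))
      (((n - 4 : ℕ) : ℝ) * t ^ (n - 4 - 1) * u (x + t ^ 2 • (y - x)) +
        t ^ (n - 4) * fderiv ℝ u (x + t ^ 2 • (y - x)) ((2 * t) • (y - x))) t := by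
    intro t ht
    have h1 : HasDerivAt (fun t : ℝ => x + t ^ 2 • (y - x)) ((2 * t) • (y - x)) t := by
      have := ((hasDerivAt_pow 2 t).smul_const (y - x)).const_add x
      refine this.congr_deriv ?_
      norm_num
    have h2 := (hd t ht).hasFDerivAt.comp_hasDerivAt t h1
    exact (hasDerivAt_pow (n - 4) t).mul h2
  have M : MonotoneOn (fun t : ℝ => t ^ (n - 4) * u (x + t ^ 2 • (y - x))) (Set.Icc Q 1) := by
    refine monotoneOn_of_deriv_nonneg (convex_Icc _ _) (fun t ht => (D t ht).continuousAt.continuousWithinAt)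
      (fun t ht => (D t (interior_subset ht)).differentiableAt.differentiableWithinAt) ?_
    intro t ht
    have ht := interior_subset ht
    rw [(D t ht).deriv]
    have tp : 0 < t := Q0.trans_le ht.1
    have e := hE t ht
    unfold EQ at e
    rw [add_sub_cancel_left, map_smul, smul_eq_mul] at e
    rw [map_smul, smul_eq_mul]
    rcases Nat.eq_zero_or_pos (n - 4) with hz | hz
    · rw [hz] at e ⊢
      simp only [Nat.cast_zero, zero_div, zero_mul, zero_add, pow_zero, one_mul] at e ⊢
      have : 0 ≤ t * (t * ((fderiv ℝ u (x + t ^ 2 • (y - x))) (y - x))) := by nlinarith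
      have := nonneg_of_mul_nonneg_right this tp
      linarith
    · have e3 : t ^ (n - 4) = t ^ (n - 4 - 1) * t := by rw [← pow_succ]; congr 1; omega
      have : 0 ≤ 2 * t ^ (n - 4 - 1) * (((n - 4 : ℕ) : ℝ) / 2 * u (x + t ^ 2 • (y - x)) +
        t ^ 2 * ((fderiv ℝ u (x + t ^ 2 • (y - x))) (y - x))) := by positivity
      rw [e3]
      linarith
  have := M (Set.left_mem_Icc.2 Q1) (Set.right_mem_Icc.2 Q1) Q1
  simpa using this

lemma iv_mem' {δ' l1 : ℝ} {x : EE n} (A : Adm U τ δ Λ δ' x l1) {l : ℝ} (hl : 0 ≤ l) (hll : l < l1) {y : EE n}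
    (hy : l < ‖y - x‖) : inversion x l y ≠ 0 ∧ ‖inversion x l y‖ < 2 * ‖x‖ := by
  rcases hl.eq_or_lt with h0 | h0
  · rw [← h0, inversion_zero_radius]
    have := norm_pos_iff.2 A.x0
    exact ⟨A.x0, by linarith⟩
  · exact A.iv_mem h0 hll hy

lemma F_cont (h : DatA s ρ m0 U a b G τ δ Λ T) {δ' l1 : ℝ} {x : EE n} (A : Adm U τ δ Λ δ' x l1) {l : ℝ} (hl : 0 ≤ l)
    (hll : l < l1) {y : EE n} (hy : l < ‖y - x‖) (i : Fin p) :
    ContinuousAt (fun z : ℝ × EE n => (z.1 / ‖z.2 - x‖) ^ (n - 4) * U i (inversion x z.1 z.2)) (l, y) := by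
  have yp : 0 < ‖y - x‖ := hl.trans_lt hy
  have yx : y ≠ x := sub_ne_zero.1 (norm_pos_iff.1 yp)
  obtain ⟨h1, h2⟩ := iv_mem' A hl hll hy
  have xτ := A.xτ
  have τρ := h.τρ
  have τp := h.τpos
  refine ContinuousAt.mul ?_ ?_
  · have cc : ContinuousAt (fun z : ℝ × EE n => ‖z.2 - x‖) (l, y) := by fun_prop
    exact (continuousAt_fst.div cc yp.ne').pow _
  · have c1 : ContinuousAt (fun z : ℝ × EE n => inversion x z.1 z.2) (l, y) :=
      ContinuousAt.inversion continuousAt_const continuousAt_fst continuousAt_snd yx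
    exact ContinuousAt.comp (f := fun z : ℝ × EE n => inversion x z.1 z.2) (g := U i) (h.ucont i h1 (by linarith)) c1

lemma gap0 (h : DatA s ρ m0 U a b G τ δ Λ T) {δ' : ℝ}
    (hδ' : ((n - 4 : ℕ) : ℝ) * 3 * (2 ^ (n + 4) * (kap n * δ' ^ s)) * T ≤ δ / 4) {x : EE n} {l l1 : ℝ} (A : Adm U τ δ Λ δ' x l1)
    (hdp0 : 0 ≤ δ') (l0 : 0 ≤ l) (ll : l < l1) (hP : PP U τ x l) : ∃ c > 0, ∀ i, ∀ y : EE n, y ≠ 0 → ‖y‖ < τ → l < ‖y - x‖ →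
    c * (1 - l / ‖y - x‖) ≤ U i y - (l / ‖y - x‖) ^ (n - 4) * U i (inversion x l y) := by
  rcases l0.eq_or_lt with h0 | h0
  · refine ⟨m0, h.m0pos, fun i y y0 yτ hy => ?_⟩
    have hn := h.hn
    rw [← h0, zero_div, zero_pow (by omega), zero_mul, sub_zero, sub_zero, mul_one]
    exact h.low i y y0 (yτ.trans_le h.τρ)
  · exact ⟨δ / 4, by have := h.δpos; positivity, fun i y y0 yτ hy => h.gap hδ' A hdp0 h0 ll hP i y0 yτ hy⟩

lemma sph_mem {δ' l1 : ℝ} {x : EE n} (A : Adm U τ δ Λ δ' x l1) {l : ℝ} (hll : l < l1) {y : EE n}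
    (hy : ‖y - x‖ = l) : y ≠ 0 ∧ ‖y‖ < 2 * ‖x‖ := by
  have := A.l1x
  constructor
  · intro h0
    rw [h0, zero_sub, norm_neg] at hy
    linarith
  · have := norm_sub_norm_le y x
    linarith

lemma EQ_pos (h : DatA s ρ m0 U a b G τ δ Λ T) {δ' : ℝ}
    (hδ' : ((n - 4 : ℕ) : ℝ) * 3 * (2 ^ (n + 4) * (kap n * δ' ^ s)) * T ≤ δ / 4) {x : EE n} {l l1 : ℝ} (A : Adm U τ δ Λ δ' x l1)
    (hdp0 : 0 ≤ δ') (l0 : 0 ≤ l) (ll : l < l1) (hP : PP U τ x l) (i : Fin p) {y : EE n} (hy : ‖y - x‖ = l) :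
    0 < EQ (U i) x y := by
  have hn := h.hn
  obtain ⟨y0, yn⟩ := sph_mem A ll hy
  have xτ := A.xτ
  have τρ := h.τρ
  have τp := h.τpos
  have yτ : ‖y‖ < τ := by linarith
  rcases l0.eq_or_lt with h0 | h0
  · rw [← h0, norm_eq_zero, sub_eq_zero] at hy
    subst hy
    unfold EQ
    rw [sub_self, map_zero, add_zero]
    have := h.upos i A.x0 (by linarith)
    have : 0 < ((n - 4 : ℕ) : ℝ) := by exact_mod_cast (by omega : 0 < n - 4)
    positivity
  have δp := h.δpos
  set v := y - x with hv
  have ey : y = x + (1 : ℝ) • v := by rw [hv]; simp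
  have hd : DifferentiableAt ℝ (U i) y := (h.cd i y y0 (by linarith)).differentiableAt (by norm_num)
  have d1 : HasDerivAt (fun t : ℝ => U i (x + t • v)) (fderiv ℝ (U i) y v) 1 := by
    have h1 : HasDerivAt (fun t : ℝ => x + t • v) v 1 := by
      have := ((hasDerivAt_id (1 : ℝ)).smul_const v).const_add x
      simpa using this
    have h2 : HasFDerivAt (U i) (fderiv ℝ (U i) y) (x + (1 : ℝ) • v) := by rw [← ey]; exact hd.hasFDerivAt
    exact h2.comp_hasDerivAt 1 h1
  have d2 : HasDerivAt (fun t : ℝ => t⁻¹) (-1) 1 := by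
    have := hasDerivAt_inv (one_ne_zero (α := ℝ)); simpa using this
  have d3 : HasDerivAt (fun t : ℝ => U i (x + t⁻¹ • v)) (fderiv ℝ (U i) y v * (-1)) 1 := by
    have d1' : HasDerivAt (fun t : ℝ => U i (x + t • v)) (fderiv ℝ (U i) y v) ((1 : ℝ)⁻¹) := by rwa [inv_one]
    exact d1'.comp (1 : ℝ) d2
  have d4 : HasDerivAt (fun t : ℝ => (t⁻¹) ^ (n - 4)) (-((n - 4 : ℕ) : ℝ)) 1 := by
    have := d2.pow (n - 4)
    refine this.congr_deriv ?_
    simp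
  have d5 := (d1.sub (d4.mul d3)).sub ((d2.const_sub 1).const_mul (δ / 4))
  have nn := deriv_nonneg_of_right d5 (by simp) (by
    have nb : ∀ᶠ t : ℝ in 𝓝 1, x + t • v ≠ 0 ∧ ‖x + t • v‖ < τ := by
      have c : ContinuousAt (fun t : ℝ => x + t • v) 1 := by fun_prop
      have c' : Tendsto (fun t : ℝ => x + t • v) (𝓝 1) (𝓝 y) := by
        have := c.tendsto; rwa [← ey] at this
      exact (c'.eventually_ne y0).and (c'.norm.eventually (gt_mem_nhds yτ))
    filter_upwards [nb.filter_mono nhdsWithin_le_nhds, self_mem_nhdsWithin] with t ht ht1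
    have t1 : 1 < t := ht1
    have tp : 0 < t := by linarith
    have nt : ‖x + t • v - x‖ = t * l := by
      rw [add_sub_cancel_left, norm_smul, Real.norm_of_nonneg tp.le, hy]
    have Q : l / (t * l) = t⁻¹ := by field_simp
    have g := h.gap hδ' A hdp0 h0 ll hP i ht.1 ht.2 (by rw [nt]; nlinarith)
    have iv : inversion x l (x + t • v) = x + t⁻¹ • v := by
      have := iv_sub x (x + t • v) l
      rw [nt, Q, add_sub_cancel_left, smul_smul] at this
      have e : t⁻¹ ^ 2 * t = t⁻¹ := by field_simp
      rw [e, sub_eq_iff_eq_add] at this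
      rw [this]; abel
    rw [nt, Q, iv] at g
    simp only [Pi.sub_apply, Pi.mul_apply]
    linarith)
  unfold EQ
  simp only [inv_one, one_pow, one_smul] at nn
  have : x + v = y := by rw [hv]; abel
  rw [this] at nn
  linarith

end DatA

open MeasureTheory Metric Filter Topology
open EuclideanGeometry

namespace DatA
variable {n p : ℕ} {s ρ m0 τ δ Λ T : ℝ} {U : Fin p → EE n → ℝ} {a b : Fin p → ℝ} {G : Fin p → EE n → ℝ}

lemma open_pt (h : DatA s ρ m0 U a b G τ δ Λ T) {δ' : ℝ}
    (hδ' : ((n - 4 : ℕ) : ℝ) * 3 * (2 ^ (n + 4) * (kap n * δ' ^ s)) * T ≤ δ / 4) {x : EE n} {l l1 : ℝ} (A : Adm U τ δ Λ δ' x l1)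
    (hdp0 : 0 ≤ δ') (l0 : 0 ≤ l) (ll : l < l1) (hP : PP U τ x l) (i : Fin p) (y : EE n) :
    ∀ᶠ z : ℝ × EE n in 𝓝 (l, y), 0 < z.1 → z.2 ≠ 0 → ‖z.2‖ < τ → z.1 < ‖z.2 - x‖ →
      (z.1 / ‖z.2 - x‖) ^ (n - 4) * U i (inversion x z.1 z.2) ≤ U i z.2 := by
  have hn := h.hn
  have xτ := A.xτ
  have τρ := h.τρ
  have τp := h.τpos
  have cN : ContinuousAt (fun z : ℝ × EE n => ‖z.2 - x‖) (l, y) := by fun_prop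
  have cF : ContinuousAt (fun z : ℝ × EE n => z.1) (l, y) := continuousAt_fst
  rcases lt_trichotomy ‖y - x‖ l with hy | hy | hy
  · filter_upwards [cN.eventually_lt cF hy] with z hz _ _ _ hz2
    exact absurd hz (not_lt.2 hz2.le)
  · -- on the sphere
    obtain ⟨y0, yn⟩ := sph_mem A ll hy
    have yρ : ‖y‖ < ρ := by linarith
    have Ep := h.EQ_pos hδ' A hdp0 l0 ll hP i hy
    have cd := h.cd i y y0 yρ
    have e1 : ∀ᶠ w in 𝓝 y, 0 ≤ EQ (U i) x w := ((EQ_cont cd).eventually (lt_mem_nhds Ep)).mono fun w hw => le_of_lt hw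
    have e2 : ∀ᶠ w in 𝓝 y, w ≠ 0 ∧ ‖w‖ < ρ := (eventually_ne_nhds y0).and (continuousAt_id.norm.eventually (gt_mem_nhds yρ))
    obtain ⟨η, ηp, hη⟩ := Metric.eventually_nhds_iff_ball.1 (e1.and e2)
    have c2 : ContinuousAt (fun z : ℝ × EE n => 2 * (‖z.2 - x‖ - z.1)) (l, y) := by fun_prop
    have v2 : ∀ᶠ z : ℝ × EE n in 𝓝 (l, y), 2 * (‖z.2 - x‖ - z.1) < η / 2 := by
      refine c2.eventually (gt_mem_nhds ?_)
      simp only [hy, sub_self, mul_zero]; positivity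
    have v3 : ∀ᶠ z : ℝ × EE n in 𝓝 (l, y), ‖z.2 - y‖ < η / 2 := by
      have c3 : ContinuousAt (fun z : ℝ × EE n => ‖z.2 - y‖) (l, y) := by fun_prop
      refine c3.eventually (gt_mem_nhds ?_)
      simp only [sub_self, norm_zero]; positivity
    filter_upwards [v2, v3] with z h2 h3 zp z0 zτ hz
    set L := z.1
    set w := z.2
    have wp : 0 < ‖w - x‖ := zp.trans hz
    have eI : inversion x L w = x + (L / ‖w - x‖) ^ 2 • (w - x) := by
      rw [← iv_sub]; abel
    rw [eI]
    have Q0 : 0 < L / ‖w - x‖ := by positivity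
    have mem : ∀ t ∈ Set.Icc (L / ‖w - x‖) 1, x + t ^ 2 • (w - x) ∈ ball y η := by
      intro t ht
      rw [mem_ball, dist_eq_norm]
      have tp : 0 < t := Q0.trans_le ht.1
      have e : x + t ^ 2 • (w - x) - y = (w - y) - (1 - t ^ 2) • (w - x) := by module
      have t2 : t ^ 2 ≤ 1 := pow_le_one₀ tp.le ht.2
      rw [e]
      refine (norm_sub_le _ _).trans_lt ?_
      rw [norm_smul, Real.norm_of_nonneg (by linarith)]
      have q1 : L ≤ t * ‖w - x‖ := by rw [← div_le_iff₀ wp]; exact ht.1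
      have : (1 - t ^ 2) * ‖w - x‖ ≤ 2 * (‖w - x‖ - L) := by
        have : (1 - t ^ 2) * ‖w - x‖ ≤ 2 * (1 - t) * ‖w - x‖ := by
          gcongr; nlinarith [sq_nonneg (1 - t)]
        linarith
      linarith
    refine ray_mono Q0 (Qle zp.le hz.le) (fun t ht => ?_) (fun t ht => ?_)
    · have := (hη _ (mem t ht)).2
      exact (h.cd i _ this.1 this.2).differentiableAt (by norm_num)
    · exact (hη _ (mem t ht)).1
  · -- off the sphere
    obtain ⟨c, cp, hc⟩ := h.gap0 hδ' A hdp0 l0 ll hP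
    have yp : 0 < ‖y - x‖ := l0.trans_lt hy
    have c1 := h.F_cont A l0 ll hy i
    have c2 : ContinuousAt (fun z : ℝ × EE n => (l / ‖z.2 - x‖) ^ (n - 4) * U i (inversion x l z.2) + c * (1 - l / ‖z.2 - x‖)) (l, y) := by
      refine ContinuousAt.add ?_ ?_
      · have c3 : ContinuousAt (fun z : ℝ × EE n => ((l, z.2) : ℝ × EE n)) (l, y) := by fun_prop
        exact ContinuousAt.comp (f := fun z : ℝ × EE n => ((l, z.2) : ℝ × EE n)) (x := (l, y))
          (g := fun z : ℝ × EE n => (z.1 / ‖z.2 - x‖) ^ (n - 4) * U i (inversion x z.1 z.2)) c1 c3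
      · exact continuousAt_const.mul (continuousAt_const.sub (continuousAt_const.div cN yp.ne'))
    have lt := c1.eventually_lt c2 (by
      simp only
      have : l / ‖y - x‖ < 1 := by rw [div_lt_one yp]; exact hy
      have : 0 < c * (1 - l / ‖y - x‖) := mul_pos cp (by linarith)
      linarith)
    have lt2 : ∀ᶠ z : ℝ × EE n in 𝓝 (l, y), l < ‖z.2 - x‖ := cN.eventually (lt_mem_nhds hy)
    filter_upwards [lt, lt2] with z hz1 hz2 _ z0 zτ _
    have := hc i z.2 z0 zτ hz2
    linarith

lemma MS (h : DatA s ρ m0 U a b G τ δ Λ T) {δ' : ℝ}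
    (hδ' : ((n - 4 : ℕ) : ℝ) * 3 * (2 ^ (n + 4) * (kap n * δ' ^ s)) * T ≤ δ / 4) {x : EE n} {l2 l1 : ℝ} (A : Adm U τ δ Λ δ' x l1)
    (hdp0 : 0 ≤ δ') (l20 : 0 ≤ l2) (ll : l2 < l1) : PP U τ x l2 := by
  have hn := h.hn
  have key : Set.Icc 0 l2 ⊆ {l | PP U τ x l} := by
    refine IsClosed.Icc_subset_of_forall_exists_gt ?_ ?_ ?_
    · apply IsSeqClosed.isClosed
      intro L l hL hl
      have hl1 : l ∈ Set.Icc 0 l2 := isClosed_Icc.mem_of_tendsto hl (Eventually.of_forall fun k => (hL k).2)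
      refine ⟨?_, hl1⟩
      intro i y y0 yτ hy
      have c := (h.F_cont A hl1.1 (hl1.2.trans_lt ll) hy i).tendsto
      have t : Tendsto (fun k => ((L k, y) : ℝ × EE n)) atTop (𝓝 (l, y)) := hl.prodMk_nhds tendsto_const_nhds
      refine le_of_tendsto (c.comp t) ?_
      filter_upwards [hl.eventually (gt_mem_nhds hy)] with k hk
      exact (hL k).1 i y y0 yτ hk
    · intro i y y0 yτ hy
      rw [zero_div, zero_pow (by omega), zero_mul]
      exact (h.upos i y0 (yτ.trans_le h.τρ)).le
    · rintro l ⟨hl, hl0, hl2⟩ l' hl'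
      have ev : ∀ᶠ L in 𝓝 l, ∀ y ∈ closedBall (0 : EE n) τ, ∀ i, 0 < L → y ≠ 0 → ‖y‖ < τ → L < ‖y - x‖ →
          (L / ‖y - x‖) ^ (n - 4) * U i (inversion x L y) ≤ U i y := by
        refine (isCompact_closedBall (0 : EE n) τ).eventually_forall_of_forall_eventually (fun y _ => ?_)
        rw [eventually_all]
        intro i
        exact h.open_pt hδ' A hdp0 hl0 (hl2.trans ll) hl i y
      have ev2 := (ev.filter_mono nhdsWithin_le_nhds : ∀ᶠ L in 𝓝[>] l, _)
      obtain ⟨L, hL1, hL2⟩ := (ev2.and (Ioc_mem_nhdsGT hl')).exists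
      refine ⟨L, ?_, hL2⟩
      intro i y y0 yτ hy
      exact hL1 y (by rw [mem_closedBall_zero_iff]; exact yτ.le) i (hl0.trans_lt hL2.1) y0 yτ hy
  exact key ⟨l20, le_rfl⟩

/-- Harnack type inequality -/
lemma harn (h : DatA s ρ m0 U a b G τ δ Λ T) {δ' : ℝ}
    (hδ' : ((n - 4 : ℕ) : ℝ) * 3 * (2 ^ (n + 4) * (kap n * δ' ^ s)) * T ≤ δ / 4) (hdp0 : 0 ≤ δ') {c d : EE n} {t l1 : ℝ}
    (hcd : c ≠ d) (tp : 0 < t) (A : Adm U τ δ Λ δ' (c + (t / ‖c - d‖) • (c - d)) l1)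
    (hl : t * (t + ‖c - d‖) < l1 ^ 2) (d0 : d ≠ 0) (dτ : ‖d‖ < τ) (i : Fin p) :
    (t / (t + ‖c - d‖)) ^ (n - 4) * U i c ≤ U i d := by
  have hn := h.hn
  have dp : 0 < ‖c - d‖ := norm_pos_iff.2 (sub_ne_zero.2 hcd)
  set e := ‖c - d‖ with he
  set x := c + (t / e) • (c - d) with hx
  set l := √(t * (t + e)) with hldef
  have lsq : l ^ 2 = t * (t + e) := Real.sq_sqrt (by positivity)
  have lp : 0 < l := Real.sqrt_pos.2 (by positivity)
  have l1p := A.l1p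
  have ll : l < l1 := by
    refine lt_of_pow_lt_pow_left₀ 2 l1p.le ?_
    rwa [lsq]
  have M := h.MS hδ' A hdp0 lp.le ll
  have dx : d - x = -(((t + e) / e) • (c - d)) := by
    have : (t + e) / e = t / e + 1 := by field_simp
    rw [this, hx]; module
  have ndx : ‖d - x‖ = t + e := by
    rw [dx, norm_neg, norm_smul, ← he, Real.norm_of_nonneg (by positivity)]; field_simp
  have ld : l < ‖d - x‖ := by
    rw [ndx]
    refine lt_of_pow_lt_pow_left₀ 2 (by positivity) ?_
    rw [lsq]; nlinarith
  have m := M i d d0 dτ ld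
  have iv : inversion x l d = c := by
    have := iv_sub x d l
    rw [ndx, dx, div_pow, lsq, smul_neg, smul_smul] at this
    have e2 : t * (t + e) / (t + e) ^ 2 * ((t + e) / e) = t / e := by field_simp
    rw [e2, sub_eq_iff_eq_add] at this
    rw [this, hx]; abel
  rw [iv, ndx] at m
  refine le_trans ?_ m
  have : c ≠ 0 ∧ ‖c‖ < 2 * ‖x‖ := by rw [← iv]; exact A.iv_mem lp ll ld
  have cu := h.upos i this.1 (by have := A.xτ; have := h.τρ; have := h.τpos; linarith)
  have : t ≤ l := by
    refine le_of_sq_le_sq ?_ lp.le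
    rw [lsq]; nlinarith
  gcongr

end DatA

open MeasureTheory Metric Filter Topology
open EuclideanGeometry

lemma pow_lin (q : ℕ) {u : ℝ} (u0 : 0 ≤ u) (u1 : u ≤ 1) : (1 + u) ^ q ≤ 1 + 3 ^ q * u := by
  induction q with
  | zero => simpa using u0
  | succ q ih =>
    have h3 : (1 : ℝ) ≤ 3 ^ q := one_le_pow₀ (by norm_num)
    rw [pow_succ, pow_succ]
    have := mul_le_mul_of_nonneg_right ih (by linarith : 0 ≤ 1 + u)
    have h4 : 3 ^ q * u * u ≤ 3 ^ q * u * 1 := by gcongr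
    nlinarith

lemma vnorm_scale {n p : ℕ} {U : Fin p → EE n → ℝ} {c d : EE n} {k : ℝ} (k0 : 0 ≤ k) (hc : ∀ i, 0 ≤ U i c)
    (hU : ∀ i, k * U i c ≤ U i d) : k * vnorm U c ≤ vnorm U d := by
  have e : k * vnorm U c = √(∑ i, (k * U i c) ^ 2) := by
    unfold vnorm
    simp only [mul_pow]
    rw [← Finset.mul_sum, Real.sqrt_mul (by positivity), Real.sqrt_sq k0]
  rw [e]
  unfold vnorm
  refine Real.sqrt_le_sqrt (Finset.sum_le_sum fun j _ => ?_)
  have := hU j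
  have := hc j
  gcongr

namespace Dat
variable {n p : ℕ} {s ρ m0 : ℝ} {U : Fin p → EE n → ℝ} {a b : Fin p → ℝ} {G : Fin p → EE n → ℝ}

lemma small_int (h : Dat s ρ m0 U a b G) {c : ℝ} (cp : 0 < c) : ∃ r0 > 0, ∀ r, 0 < r → r < r0 →
    ∫ y in ball (0 : EE n) r, ∑ i, G i y < c := by
  have hn := h.hn
  have I : Integrable (fun y => ∑ i, G i y) := integrable_finsetSum _ fun i _ => h.Gi i
  have small : Tendsto (fun τ : ℝ => ∫ y in ball (0 : EE n) τ, ∑ i, G i y) (𝓝[>] 0) (𝓝 0) := by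
    refine Integrable.tendsto_setIntegral_nhds_zero I ?_
    have t1 : Tendsto (fun τ : ℝ => ENNReal.ofReal (τ ^ n * om n)) (𝓝[>] 0) (𝓝 0) := by
      have : Tendsto (fun τ : ℝ => ENNReal.ofReal (τ ^ n * om n)) (𝓝 0) (𝓝 (ENNReal.ofReal ((0 : ℝ) ^ n * om n))) := by
        exact (ENNReal.continuous_ofReal.comp (by fun_prop : Continuous fun τ : ℝ => τ ^ n * om n)).tendsto 0
      rw [zero_pow (by omega), zero_mul, ENNReal.ofReal_zero] at this
      exact this.mono_left nhdsWithin_le_nhds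
    refine t1.congr' ?_
    filter_upwards [self_mem_nhdsWithin] with τ hτ
    simp only [Function.comp]
    rw [← vol_ball (0 : EE n) hτ, measureReal_def, ENNReal.ofReal_toReal measure_ball_lt_top.ne]
  have := small.eventually (gt_mem_nhds cp)
  rw [eventually_nhdsWithin_iff, Metric.eventually_nhds_iff] at this
  obtain ⟨r0, r0p, hr0⟩ := this
  refine ⟨r0, r0p, fun r rp rr => hr0 ?_ rp⟩
  rw [Real.dist_eq, sub_zero, abs_of_pos rp]; exact rr

end Dat

namespace DatA
variable {n p : ℕ} {s ρ m0 τ δ Λ T : ℝ} {U : Fin p → EE n → ℝ} {a b : Fin p → ℝ} {G : Fin p → EE n → ℝ}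

lemma vharn (h : DatA s ρ m0 U a b G τ δ Λ T) {δ' : ℝ}
    (hδ' : ((n - 4 : ℕ) : ℝ) * 3 * (2 ^ (n + 4) * (kap n * δ' ^ s)) * T ≤ δ / 4) (hdp0 : 0 ≤ δ') {c d : EE n} {t l1 : ℝ}
    (hcd : c ≠ d) (tp : 0 < t) (A : Adm U τ δ Λ δ' (c + (t / ‖c - d‖) • (c - d)) l1)
    (hl : t * (t + ‖c - d‖) < l1 ^ 2) (c0 : c ≠ 0) (cτ : ‖c‖ < τ) (d0 : d ≠ 0) (dτ : ‖d‖ < τ) :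
    (t / (t + ‖c - d‖)) ^ (n - 4) * vnorm U c ≤ vnorm U d :=
  vnorm_scale (by positivity) (fun i => (h.upos i c0 (cτ.trans_le h.τρ)).le)
    (fun i => h.harn hδ' hdp0 hcd tp A hl d0 dτ i)

set_option maxHeartbeats 1600000 in
lemma spike (h : DatA s ρ m0 U a b G τ δ Λ T) {δ' : ℝ}
    (hδ' : ((n - 4 : ℕ) : ℝ) * 3 * (2 ^ (n + 4) * (kap n * δ' ^ s)) * T ≤ δ / 4) (hdp0 : 0 < δ') (hs : (n : ℝ) ≤ s * ((n : ℝ) - 4))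
    {δ₂ : ℝ} (δ₂p : 0 < δ₂) :
    ∃ r1 > 0, ∀ z : EE n, z ≠ 0 → ‖z‖ < r1 → ‖z‖ ^ (n - 4) * vnorm U z ≤ δ₂ := by
  have hn := h.hn
  have q0 : n - 4 ≠ 0 := by omega
  have τp := h.τpos
  have τρ := h.τρ
  have τ1 := h.τ1
  have δp := h.δpos
  have Λ0 := h.Λ0
  have kp := kap_pos hn
  have om0 := om_pos n
  have hs1 := h.hs1
  set δ1 := min δ' (δ₂ / 16 ^ (n - 4)) with hδ1
  have dpos1 : 0 < δ1 := lt_min hdp0 (by positivity)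
  set c := kap n * (om n * (4⁻¹) ^ n) * (δ1 / 4 ^ (n - 4)) ^ s with hc
  have cp : 0 < c := by positivity
  obtain ⟨r0, r0p, hr0⟩ := h.toDat.small_int cp
  refine ⟨min (r0 / 2) (min (τ / 8) (δ / (8 * (Λ + 1)))), by positivity, fun z1 z10 hz1 => ?_⟩
  by_contra hcon
  push Not at hcon
  set r := ‖z1‖ with hr
  have rp : 0 < r := norm_pos_iff.2 z10
  have rr0 : r < r0 / 2 := hz1.trans_le (min_le_left _ _)
  have rτ : r < τ / 8 := hz1.trans_le ((min_le_right _ _).trans (min_le_left _ _))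
  have rΛ : r < δ / (8 * (Λ + 1)) := hz1.trans_le ((min_le_right _ _).trans (min_le_right _ _))
  rw [lt_div_iff₀ (by positivity)] at rΛ
  -- geometry of the closed ball
  have geo : ∀ z : EE n, ‖z - z1‖ ≤ r / 2 → r / 2 ≤ ‖z‖ ∧ ‖z‖ ≤ 3 / 2 * r := by
    intro z hz
    have i1 := norm_sub_norm_le z1 z
    have i2 := norm_sub_norm_le z z1
    rw [norm_sub_rev] at i1
    constructor <;> linarith
  have ne0 : ∀ z : EE n, r / 2 ≤ ‖z‖ → z ≠ 0 := by
    intro z hz h0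
    rw [h0, norm_zero] at hz; linarith
  obtain ⟨z0, z0m, hmax⟩ := (isCompact_closedBall z1 (r / 2)).exists_isMaxOn ⟨z1, by simp; positivity⟩
    (f := fun z => vnorm U z * (r / 2 - ‖z - z1‖) ^ (n - 4)) (by
      intro z hz
      rw [mem_closedBall, dist_eq_norm] at hz
      obtain ⟨g1, g2⟩ := geo z hz
      have c1 : ContinuousAt (vnorm U) z := h.vcont (ne0 z g1) (by linarith)
      have c2 : ContinuousAt (fun z : EE n => (r / 2 - ‖z - z1‖) ^ (n - 4)) z := by fun_prop
      exact (c1.mul c2).continuousWithinAt)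
  rw [mem_closedBall, dist_eq_norm] at z0m
  obtain ⟨g1, g2⟩ := geo z0 z0m
  have z00 := ne0 z0 g1
  set M := vnorm U z0 with hM
  have Mp : 0 < M := h.vpos z00 (by linarith)
  set σ := r / 2 - ‖z0 - z1‖ with hσ
  have hmax' : ∀ z : EE n, ‖z - z1‖ ≤ r / 2 → vnorm U z * (r / 2 - ‖z - z1‖) ^ (n - 4) ≤ M * σ ^ (n - 4) := by
    intro z hz
    have := hmax (show z ∈ closedBall z1 (r / 2) by rwa [mem_closedBall, dist_eq_norm])
    exact this
  have big : δ₂ / 2 ^ (n - 4) < M * σ ^ (n - 4) := by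
    have := hmax' z1 (by rw [sub_self, norm_zero]; positivity)
    rw [sub_self, norm_zero, sub_zero, div_pow] at this
    refine lt_of_lt_of_le ?_ this
    rw [← mul_div_assoc]
    gcongr
    linarith
  have σ0 : 0 ≤ σ := by rw [hσ]; linarith
  have σp : 0 < σ := by
    rcases σ0.eq_or_lt with h0 | h0
    · rw [← h0, zero_pow q0, mul_zero] at big
      have : 0 < δ₂ / 2 ^ (n - 4) := by positivity
      linarith
    · exact h0
  have nv0 := norm_nonneg (z0 - z1)
  have σr : σ ≤ r / 2 := by rw [hσ]; linarith
  have near : ∀ z : EE n, ‖z - z0‖ ≤ σ / 2 → ‖z - z1‖ ≤ r / 2 ∧ vnorm U z ≤ 2 ^ (n - 4) * M := by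
    intro z hz
    have t1 : ‖z - z1‖ ≤ ‖z - z0‖ + ‖z0 - z1‖ := norm_sub_le_norm_sub_add_norm_sub _ _ _
    have a1 : ‖z - z1‖ ≤ r / 2 := by linarith
    refine ⟨a1, ?_⟩
    have a2 := hmax' z a1
    have a3 : (σ / 2) ^ (n - 4) ≤ (r / 2 - ‖z - z1‖) ^ (n - 4) := by
      gcongr; linarith
    have a4 : vnorm U z * (σ / 2) ^ (n - 4) ≤ M * σ ^ (n - 4) :=
      (mul_le_mul_of_nonneg_left a3 (vnorm_nonneg U z)).trans a2
    rw [div_pow] at a4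
    have sp : 0 < σ ^ (n - 4) := by positivity
    rw [← mul_div_assoc, div_le_iff₀ (by positivity)] at a4
    have : vnorm U z * σ ^ (n - 4) ≤ (2 ^ (n - 4) * M) * σ ^ (n - 4) := by linarith
    exact le_of_mul_le_mul_right this sp
  -- the scale l1
  obtain ⟨l1, l1p, hl1⟩ : ∃ l1 : ℝ, 0 < l1 ∧ (2 * l1) ^ (n - 4) * M = δ1 := by
    refine ⟨(δ1 / M) ^ (((n - 4 : ℕ) : ℝ)⁻¹) / 2, by positivity, ?_⟩
    rw [mul_div_cancel₀ _ (two_ne_zero), Real.rpow_inv_natCast_pow (by positivity) q0]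
    field_simp
  have l1σ : l1 ≤ σ / 16 := by
    have : (16 * l1) ^ (n - 4) ≤ σ ^ (n - 4) := by
      have e : (16 * l1) ^ (n - 4) = 8 ^ (n - 4) * (2 * l1) ^ (n - 4) := by rw [← mul_pow]; congr 1; ring
      have i1 : (2 * l1) ^ (n - 4) * M ≤ δ₂ / 16 ^ (n - 4) := by rw [hl1]; exact min_le_right _ _
      have e16 : (16 : ℝ) ^ (n - 4) = 8 ^ (n - 4) * 2 ^ (n - 4) := by rw [← mul_pow]; norm_num
      rw [e16, ← div_div, div_right_comm, le_div_iff₀ (by positivity)] at i1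
      rw [e]
      have : (8 ^ (n - 4) * (2 * l1) ^ (n - 4)) * M ≤ σ ^ (n - 4) * M := by linarith
      exact le_of_mul_le_mul_right this Mp
    have := (pow_le_pow_iff_left₀ (by positivity) σ0 q0).1 this
    linarith
  have l1r : l1 ≤ r / 32 := by linarith
  have adm : ∀ x : EE n, ‖x - z0‖ ≤ l1 → Adm U τ δ Λ δ' x l1 := by
    intro x hx
    have x1 : ‖x - z1‖ ≤ r / 2 := (near x (by linarith)).1
    obtain ⟨x2, x3⟩ := geo x x1
    refine ⟨ne0 x x2, by linarith, ?_, l1p, by linarith, ?_⟩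
    · nlinarith
    · intro z zz hz
      have : 2 * l1 ^ 2 / τ ≤ l1 := by
        rw [div_le_iff₀ τp]; nlinarith
      have t1 : ‖z - z0‖ ≤ ‖z - x‖ + ‖x - z0‖ := norm_sub_le_norm_sub_add_norm_sub _ _ _
      have := (near z (by linarith)).2
      calc l1 ^ (n - 4) * vnorm U z ≤ l1 ^ (n - 4) * (2 ^ (n - 4) * M) := by gcongr
        _ = (2 * l1) ^ (n - 4) * M := by rw [mul_pow]; ring
        _ ≤ δ' := by rw [hl1]; exact min_le_left _ _
  have lowv : ∀ d : EE n, ‖d - z0‖ < l1 / 4 → (2⁻¹) ^ (n - 4) * M ≤ vnorm U d := by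
    intro d hd
    obtain ⟨d1, _⟩ := near d (by linarith)
    obtain ⟨d2, d3⟩ := geo d d1
    by_cases hdz : z0 = d
    · rw [← hdz]
      have : ((2 : ℝ)⁻¹) ^ (n - 4) ≤ 1 := pow_le_one₀ (by norm_num) (by norm_num)
      nlinarith
    · have ep : 0 < ‖z0 - d‖ := norm_pos_iff.2 (sub_ne_zero.2 hdz)
      have el : ‖z0 - d‖ < l1 / 4 := by rwa [norm_sub_rev]
      have hA := adm (z0 + (l1 / 2 / ‖z0 - d‖) • (z0 - d)) (by
        rw [add_sub_cancel_left, norm_smul, Real.norm_of_nonneg (by positivity), div_mul_cancel₀ _ ep.ne']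
        linarith)
      have := h.vharn hδ' hdp0.le hdz (by positivity : 0 < l1 / 2) hA (by nlinarith) z00 (by linarith) (ne0 d d2) (by linarith)
      refine le_trans ?_ this
      gcongr
      rw [inv_eq_one_div, div_le_div_iff₀ (by norm_num) (by positivity)]
      linarith
  -- integral lower bound
  have I : Integrable (fun y => ∑ i, G i y) := integrable_finsetSum _ fun i _ => h.Gi i
  have sub : ball z0 (l1 / 4) ⊆ ball (0 : EE n) (2 * r) := by
    intro d hd
    rw [mem_ball, dist_eq_norm] at hd
    obtain ⟨d1, _⟩ := near d (by linarith)
    obtain ⟨d2, d3⟩ := geo d d1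
    rw [mem_ball_zero_iff]; linarith
  have up := hr0 (2 * r) (by positivity) (by linarith)
  have m1 : ∫ y in ball z0 (l1 / 4), ∑ i, G i y ≤ ∫ y in ball (0 : EE n) (2 * r), ∑ i, G i y := by
    refine setIntegral_mono_set I.integrableOn ?_ (LE.le.eventuallyLE sub)
    rw [EventuallyLE, ae_restrict_iff' measurableSet_ball]
    filter_upwards [ae_ne_zero hn] with y hy hyb
    rw [mem_ball_zero_iff] at hyb
    exact Finset.sum_nonneg fun i _ => (h.Gpos i hy (by linarith)).le
  have m2 : ∫ y in ball z0 (l1 / 4), kap n * ((2⁻¹) ^ (n - 4) * M) ^ s ≤ ∫ y in ball z0 (l1 / 4), ∑ i, G i y := by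
    refine setIntegral_mono_on (integrableOn_const measure_ball_lt_top.ne) I.integrableOn measurableSet_ball ?_
    intro d hd
    rw [mem_ball, dist_eq_norm] at hd
    obtain ⟨d1, _⟩ := near d (by linarith)
    obtain ⟨d2, d3⟩ := geo d d1
    have d0 := ne0 d d2
    have dρ : ‖d‖ < ρ := by linarith
    have vp := h.vpos d0 dρ
    have e : ∑ i, G i d = kap n * (vnorm U d ^ (s - 1) * ∑ i, U i d) := by
      rw [Finset.mul_sum, Finset.mul_sum]
      exact Finset.sum_congr rfl fun i _ => h.Geq i d d0 dρ
    have e2 : vnorm U d ^ s = vnorm U d ^ (s - 1) * vnorm U d := by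
      rw [← Real.rpow_add_one vp.ne']; congr 1; ring
    rw [e]
    refine mul_le_mul_of_nonneg_left ?_ kp.le
    calc ((2⁻¹) ^ (n - 4) * M) ^ s ≤ vnorm U d ^ s := Real.rpow_le_rpow (by positivity) (lowv d hd) (by linarith)
      _ = vnorm U d ^ (s - 1) * vnorm U d := e2
      _ ≤ _ := by
        have := h.vle d0 dρ
        gcongr
  rw [setIntegral_const, vol_ball _ (by positivity), smul_eq_mul] at m2
  have m3 : c ≤ (l1 / 4) ^ n * om n * (kap n * ((2⁻¹) ^ (n - 4) * M) ^ s) := by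
    have l1' : l1 ≤ 1 := by linarith
    have e : (l1 ^ (n - 4)) ^ s = l1 ^ (s * ((n : ℝ) - 4)) := by
      have c : (l1 ^ (n - 4) : ℝ) = l1 ^ ((n : ℝ) - 4) := by
        rw [← Real.rpow_natCast, Nat.cast_sub (by omega)]; norm_num
      rw [c, ← Real.rpow_mul l1p.le]
      congr 1; ring
    have p2 : (l1 ^ (n - 4)) ^ s ≤ l1 ^ n := by
      rw [e, ← Real.rpow_natCast]
      exact Real.rpow_le_rpow_of_exponent_ge l1p l1' hs
    have p3 : (δ1 / 4 ^ (n - 4)) ^ s ≤ l1 ^ n * ((2⁻¹) ^ (n - 4) * M) ^ s := by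
      have : δ1 / 4 ^ (n - 4) = l1 ^ (n - 4) * ((2⁻¹) ^ (n - 4) * M) := by
        have e4 : (4 : ℝ) ^ (n - 4) = 2 ^ (n - 4) * 2 ^ (n - 4) := by rw [← mul_pow]; norm_num
        rw [← hl1, e4, mul_pow, inv_pow]; field_simp
      rw [this, Real.mul_rpow (by positivity) (by positivity)]
      gcongr
    have : c ≤ kap n * (om n * (4⁻¹) ^ n) * (l1 ^ n * ((2⁻¹) ^ (n - 4) * M) ^ s) := by
      rw [hc]; gcongr
    refine this.trans (le_of_eq ?_)
    rw [div_eq_mul_inv, mul_pow]; ring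
  linarith

end DatA

open MeasureTheory Metric Filter Topology
open EuclideanGeometry

namespace Dat
variable {n p : ℕ} {s ρ m0 : ℝ} {U : Fin p → EE n → ℝ} {a b : Fin p → ℝ} {G : Fin p → EE n → ℝ}

lemma caseA (h : Dat s ρ m0 U a b G) (hs : (n : ℝ) ≤ s * ((n : ℝ) - 4)) : Concl U := by
  have hn := h.hn
  have q0 : n - 4 ≠ 0 := by omega
  have kp := kap_pos hn
  have hab := fun i => h.caseA_ab hs i
  obtain ⟨τ, δ, Λ, τp, τρ, τ1, δp, Λ0, hδ, hΛ⟩ := h.hdelta hab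
  obtain ⟨T, Tp, hT⟩ := HT_pot hn τp τ1
  have H : DatA s ρ m0 U a b G τ δ Λ T := ⟨h, hab, τp, τρ, τ1, δp, Λ0, hδ, hΛ, Tp, hT⟩
  set X : ℝ := ((n - 4 : ℕ) : ℝ) * 3 * (2 ^ (n + 4) * kap n) * T with hX
  have X0 : 0 ≤ X := by positivity
  obtain ⟨δ', δ'p, hδ'⟩ : ∃ δ' : ℝ, 0 < δ' ∧
      ((n - 4 : ℕ) : ℝ) * 3 * (2 ^ (n + 4) * (kap n * δ' ^ s)) * T ≤ δ / 4 := by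
    refine ⟨min 1 (δ / (4 * (X + 1))), by positivity, ?_⟩
    set d := min 1 (δ / (4 * (X + 1))) with hd
    have dp : 0 < d := by positivity
    have d1 : d ≤ 1 := min_le_left _ _
    have d2 : d ≤ δ / (4 * (X + 1)) := min_le_right _ _
    rw [le_div_iff₀ (by positivity)] at d2
    have d3 : d ^ s ≤ d := by
      simpa using Real.rpow_le_rpow_of_exponent_ge dp d1 h.hs1.le
    have e : ((n - 4 : ℕ) : ℝ) * 3 * (2 ^ (n + 4) * (kap n * d ^ s)) * T = X * d ^ s := by rw [hX]; ring
    rw [e]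
    have : X * d ^ s ≤ X * d := by gcongr
    nlinarith
  obtain ⟨r1, r1p, hr1⟩ := H.spike hδ' δ'p hs (δ₂ := δ' / 2 ^ (n - 4)) (by positivity)
  obtain ⟨t, tp, tτ, tΛ, tr⟩ : ∃ t : ℝ, 0 < t ∧ 2 * t ≤ τ / 4 ∧ 4 * Λ * (2 * t) ≤ δ ∧ 2 * t ≤ r1 / 2 := by
    refine ⟨min (τ / 8) (min (δ / (8 * (Λ + 1))) (r1 / 4)), by positivity, ?_, ?_, ?_⟩
    · have := min_le_left (τ / 8) (min (δ / (8 * (Λ + 1))) (r1 / 4)); linarith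
    · have := (min_le_right (τ / 8) (min (δ / (8 * (Λ + 1))) (r1 / 4))).trans (min_le_left _ _)
      have p0 : 0 < min (τ / 8) (min (δ / (8 * (Λ + 1))) (r1 / 4)) := by positivity
      rw [le_div_iff₀ (by positivity)] at this
      nlinarith
    · have := (min_le_right (τ / 8) (min (δ / (8 * (Λ + 1))) (r1 / 4))).trans (min_le_right _ _); linarith
  refine ⟨3 ^ (n - 4) * (2 / t), by positivity, t / 2, by positivity, fun c d c0 hcd cr => ?_⟩
  have rp : 0 < ‖c‖ := norm_pos_iff.2 c0
  have d0 : d ≠ 0 := norm_pos_iff.1 (hcd ▸ rp)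
  have vd : 0 ≤ vnorm U d := vnorm_nonneg U d
  by_cases hE : c = d
  · rw [hE]
    have : 0 ≤ 3 ^ (n - 4) * (2 / t) * ‖d‖ := by positivity
    nlinarith
  have ep : 0 < ‖c - d‖ := norm_pos_iff.2 (sub_ne_zero.2 hE)
  set e := ‖c - d‖ with he
  have e2 : e ≤ 2 * ‖c‖ := by
    have := norm_sub_le c d
    rw [← hcd] at this; linarith
  set x : EE n := c + (t / e) • (c - d) with hx
  have hx2 : ‖x‖ ^ 2 = ‖c‖ ^ 2 + t * (t + e) := by
    have i1 : 2 * inner ℝ c (c - d) = e ^ 2 := by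
      have := norm_sub_sq_real c d
      rw [← hcd] at this
      rw [inner_sub_right, real_inner_self_eq_norm_sq, he, this]; ring
    rw [hx, norm_add_sq_real, inner_smul_right, norm_smul, Real.norm_of_nonneg (by positivity), ← he,
      div_mul_cancel₀ _ ep.ne', mul_left_comm, i1]
    field_simp
    ring
  have xn := norm_nonneg x
  have xt : ‖x‖ ≤ 2 * t := by
    refine abs_le_of_sq_le_sq' ?_ (by positivity) |>.2
    rw [hx2]; nlinarith
  have xp : 0 < ‖x‖ := by
    have : 0 < ‖x‖ ^ 2 := by rw [hx2]; positivity
    exact lt_of_le_of_ne xn fun h0 => by rw [← h0] at this; norm_num at this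
  have A : Adm U τ δ Λ δ' x ‖x‖ := by
    refine ⟨norm_pos_iff.1 xp, by linarith, ?_, xp, le_rfl, ?_⟩
    · have : 4 * Λ * ‖x‖ ≤ 4 * Λ * (2 * t) := by gcongr
      linarith
    · intro z z0 hz
      have b1 : 2 * ‖x‖ ^ 2 / τ ≤ ‖x‖ / 2 := by
        rw [div_le_iff₀ τp]; nlinarith
      have i1 := norm_sub_norm_le x z
      have i2 := norm_sub_norm_le z x
      rw [norm_sub_rev] at i1
      have := hr1 z z0 (by linarith)
      rw [le_div_iff₀ (by positivity)] at this
      have vz := vnorm_nonneg U z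
      calc ‖x‖ ^ (n - 4) * vnorm U z ≤ (2 * ‖z‖) ^ (n - 4) * vnorm U z := by gcongr; linarith
        _ = ‖z‖ ^ (n - 4) * vnorm U z * 2 ^ (n - 4) := by rw [mul_pow]; ring
        _ ≤ δ' := this
  have key := H.vharn hδ' δ'p.le hE tp A (by rw [hx2]; have : 0 < ‖c‖ ^ 2 := by positivity
                                             linarith) c0 (by linarith) d0 (by linarith)
  rw [← he] at key
  have f1 : vnorm U c ≤ (1 + e / t) ^ (n - 4) * vnorm U d := by
    have e1 : (1 + e / t) ^ (n - 4) * (t / (t + e)) ^ (n - 4) = 1 := by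
      rw [← mul_pow]
      have : (1 + e / t) * (t / (t + e)) = 1 := by field_simp
      rw [this, one_pow]
    have := mul_le_mul_of_nonneg_left key (by positivity : 0 ≤ (1 + e / t) ^ (n - 4))
    rw [← mul_assoc, e1, one_mul] at this
    exact this
  have f2 : (1 + e / t) ^ (n - 4) ≤ 1 + 3 ^ (n - 4) * (2 * ‖c‖ / t) := by
    refine le_trans ?_ (pow_lin (n - 4) (by positivity : 0 ≤ 2 * ‖c‖ / t) ?_)
    · gcongr
    · rw [div_le_one tp]; linarith
  refine f1.trans ?_
  have f3 : 1 + 3 ^ (n - 4) * (2 / t) * ‖c‖ = 1 + 3 ^ (n - 4) * (2 * ‖c‖ / t) := by ring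
  rw [f3]
  gcongr

end Dat

open MeasureTheory Metric Filter Topology
open EuclideanGeometry

open scoped RealInnerProductSpace in
lemma finrank_orth {n : ℕ} (hn : 5 ≤ n) {v : EE n} (hv : v ≠ 0) :
    ((Module.finrank ℝ ((Submodule.span ℝ {v})ᗮ : Submodule ℝ (EE n)) : ℕ) : ℝ) = (n : ℝ) - 1 := by
  have : Fact (Module.finrank ℝ (EE n) = (n - 1) + 1) := ⟨by rw [finrank_euclideanSpace_fin]; omega⟩
  rw [Submodule.finrank_orthogonal_span_singleton (n := n - 1) hv, Nat.cast_sub (by omega)]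
  norm_num

lemma sphere_pos {n : ℕ} (hn : 5 ≤ n) {r : ℝ} (hr : 0 < r) : 0 < (μH[(n : ℝ) - 1] : Measure (EE n)) (sphere 0 r) := by
  have hn' : (5 : ℝ) ≤ n := by exact_mod_cast hn
  have := nontrivEE hn
  obtain ⟨v, hv1⟩ := exists_norm_eq (EE n) (zero_le_one)
  have hv : v ≠ 0 := norm_pos_iff.1 (by rw [hv1]; norm_num)
  let K : Submodule ℝ (EE n) := (Submodule.span ℝ {v})ᗮ
  have hd := finrank_orth hn hv
  have i1 := hausdorffMeasure_orthogonalProjectionOnto_le K ((n : ℝ) - 1) (sphere (0 : EE n) r) (by linarith)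
  refine lt_of_lt_of_le ?_ i1
  have sub : ball (0 : K) r ⊆ K.orthogonalProjectionOnto '' sphere (0 : EE n) r := by
    intro w hw
    rw [mem_ball_zero_iff] at hw
    have w2 : ‖w‖ ^ 2 ≤ r ^ 2 := by gcongr
    refine ⟨(w : EE n) + √(r ^ 2 - ‖w‖ ^ 2) • v, ?_, ?_⟩
    · rw [mem_sphere_zero_iff_norm]
      have o : inner ℝ (w : EE n) v = 0 := Submodule.mem_orthogonal_singleton_iff_inner_left.1 w.2
      have : ‖(w : EE n) + √(r ^ 2 - ‖w‖ ^ 2) • v‖ ^ 2 = r ^ 2 := by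
        rw [norm_add_sq_real, inner_smul_right, o, norm_smul, hv1, Real.norm_of_nonneg (Real.sqrt_nonneg _), mul_one,
          Real.sq_sqrt (by linarith), Submodule.coe_norm]
        ring
      exact (pow_left_inj₀ (norm_nonneg _) hr.le two_ne_zero).1 this
    · have e0 : K.orthogonalProjectionOnto v = 0 :=
        Submodule.orthogonalProjectionOnto_orthogonalComplement_singleton_eq_zero v
      rw [map_add, map_smul, e0, smul_zero, add_zero, Submodule.orthogonalProjectionOnto_mem_subspace_eq_self]
  refine lt_of_lt_of_le ?_ (measure_mono sub)
  rw [← hd]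
  exact isOpen_ball.measure_pos _ ⟨0, mem_ball_self hr⟩

lemma sphere_fin {n : ℕ} (hn : 5 ≤ n) {r : ℝ} (hr : 0 < r) : (μH[(n : ℝ) - 1] : Measure (EE n)) (sphere 0 r) < ⊤ := by
  have hn' : (5 : ℝ) ≤ n := by exact_mod_cast hn
  refine (isCompact_sphere (0 : EE n) r).measure_lt_top_of_nhdsWithin fun v hvs => ?_
  rw [mem_sphere_zero_iff_norm] at hvs
  have hv : v ≠ 0 := norm_pos_iff.1 (by rw [hvs]; exact hr)
  let K : Submodule ℝ (EE n) := (Submodule.span ℝ {v})ᗮ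
  have hd := finrank_orth hn hv
  have orth : ∀ w : K, inner ℝ v (w : EE n) = 0 := fun w => Submodule.mem_orthogonal_singleton_iff_inner_right.1 w.2
  have ne : ∀ w : K, v + (w : EE n) ≠ 0 := by
    intro w h0
    have : inner ℝ v (v + (w : EE n)) = 0 := by rw [h0, inner_zero_right]
    rw [inner_add_right, orth, add_zero, real_inner_self_eq_norm_sq, hvs] at this
    have : 0 < r ^ 2 := by positivity
    linarith
  let f : K → EE n := fun w => (r / ‖v + (w : EE n)‖) • (v + (w : EE n))
  have fc : ContDiff ℝ 1 f := by
    have c1 : ContDiff ℝ 1 (fun w : K => v + (w : EE n)) := contDiff_const.add K.subtypeL.contDiff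
    have c2 : ContDiff ℝ 1 (fun w : K => ‖v + (w : EE n)‖) := c1.norm ℝ ne
    exact (contDiff_const.div c2 fun w => norm_ne_zero_iff.2 (ne w)).smul c1
  obtain ⟨L, hL⟩ := (fc.locallyLipschitz.locallyLipschitzOn (s := closedBall (0 : K) (3 * r))).exists_lipschitzOnWith_of_compact
    (isCompact_closedBall _ _)
  have i1 := hL.hausdorffMeasure_image_le (d := (n : ℝ) - 1) (by linarith)
  have fin : (μH[(n : ℝ) - 1] : Measure (EE n)) (f '' closedBall (0 : K) (3 * r)) < ⊤ := by
    refine i1.trans_lt (ENNReal.mul_lt_top ?_ ?_)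
    · exact ENNReal.rpow_lt_top_of_nonneg (by linarith) ENNReal.coe_ne_top
    · rw [← hd]; exact (isCompact_closedBall _ _).measure_lt_top
  refine ⟨f '' closedBall (0 : K) (3 * r), ?_, fin⟩
  have op : {z : EE n | r ^ 2 / 2 < inner ℝ v z} ∈ 𝓝 v := by
    refine IsOpen.mem_nhds (isOpen_lt continuous_const (by fun_prop)) ?_
    change r ^ 2 / 2 < inner ℝ v v
    rw [real_inner_self_eq_norm_sq, hvs]
    have : 0 < r ^ 2 := by positivity
    linarith
  filter_upwards [self_mem_nhdsWithin, mem_nhdsWithin_of_mem_nhds op] with z hz1 hz2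
  rw [mem_sphere_zero_iff_norm] at hz1
  set k := inner ℝ v z with hk
  have r2 : 0 < r ^ 2 := by positivity
  have kp : 0 < k := by linarith
  have mem : (r ^ 2 / k) • z - v ∈ K := by
    refine Submodule.mem_orthogonal_singleton_iff_inner_right.2 ?_
    rw [inner_sub_right, inner_smul_right, real_inner_self_eq_norm_sq, hvs, ← hk]
    field_simp
    ring
  have dk : r ^ 2 / k ≤ 2 := by rw [div_le_iff₀ kp]; linarith
  refine ⟨⟨(r ^ 2 / k) • z - v, mem⟩, ?_, ?_⟩
  · rw [mem_closedBall_zero_iff, Submodule.coe_norm]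
    refine (norm_sub_le _ _).trans ?_
    rw [norm_smul, hz1, hvs, Real.norm_of_nonneg (by positivity)]
    nlinarith
  · change (r / ‖v + ((r ^ 2 / k) • z - v)‖) • (v + ((r ^ 2 / k) • z - v)) = z
    rw [add_sub_cancel, norm_smul, hz1, Real.norm_of_nonneg (by positivity), smul_smul]
    have : r / (r ^ 2 / k * r) * (r ^ 2 / k) = 1 := by field_simp
    rw [this, one_smul]

/-- From the pointwise comparison to the spherical average -/
lemma avg_of {n p : ℕ} (hn : 5 ≤ n) {U : Fin p → EE n → ℝ} {r k : ℝ} (hr : 0 < r) (k0 : 0 ≤ k)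
    (hc : ∀ x : EE n, ‖x‖ = r → ContinuousAt (vnorm U) x)
    (hk : ∀ x y : EE n, ‖x‖ = r → ‖y‖ = r → vnorm U x ≤ (1 + k) * vnorm U y) {x : EE n} (hx : ‖x‖ = r) :
    |vnorm U x - sphAvg U r| ≤ k * (1 + k) * sphAvg U r := by
  set μ : Measure (EE n) := (μH[(n : ℝ) - 1] : Measure (EE n)).restrict (sphere (0 : EE n) r) with hμ
  have p0 := sphere_pos hn hr
  have p1 := sphere_fin hn hr
  have : IsFiniteMeasure μ := ⟨by rw [hμ, Measure.restrict_apply_univ]; exact p1⟩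
  have : NeZero μ := ⟨by
    intro h0
    have : μ Set.univ = 0 := by rw [h0]; simp
    rw [hμ, Measure.restrict_apply_univ] at this
    exact p0.ne' this⟩
  have cont : ContinuousOn (vnorm U) (sphere (0 : EE n) r) := fun y hy =>
    (hc y (mem_sphere_zero_iff_norm.1 hy)).continuousWithinAt
  have I : Integrable (vnorm U) μ := by
    obtain ⟨B, hB⟩ := (isCompact_sphere (0 : EE n) r).exists_bound_of_continuousOn cont
    refine Integrable.of_bound (cont.aestronglyMeasurable isClosed_sphere.measurableSet) B ?_
    exact ae_restrict_of_forall_mem isClosed_sphere.measurableSet hB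
  have mono : ∀ f g : EE n → ℝ, Integrable f μ → Integrable g μ → (∀ y : EE n, ‖y‖ = r → f y ≤ g y) →
      ⨍ y, f y ∂μ ≤ ⨍ y, g y ∂μ := by
    intro f g hf hg hfg
    rw [average_eq, average_eq, smul_eq_mul, smul_eq_mul]
    refine mul_le_mul_of_nonneg_left ?_ (by positivity)
    exact integral_mono_ae hf hg (ae_restrict_of_forall_mem isClosed_sphere.measurableSet
      fun y hy => hfg y (mem_sphere_zero_iff_norm.1 hy))
  have cst : ∀ c : ℝ, ⨍ _y : EE n, c ∂μ = c := fun c => average_const μ c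
  have e : sphAvg U r = ⨍ y, vnorm U y ∂μ := rfl
  have u1 : vnorm U x ≤ (1 + k) * sphAvg U r := by
    have := mono (fun _ => vnorm U x) (fun y => (1 + k) * vnorm U y) (integrable_const _) (I.const_mul _)
      (fun y hy => hk x y hx hy)
    rw [cst, average_eq, integral_const_mul, smul_eq_mul, mul_left_comm, ← smul_eq_mul (μ.real Set.univ)⁻¹, ← average_eq] at this
    exact this
  have u2 : sphAvg U r ≤ (1 + k) * vnorm U x := by
    have := mono (vnorm U) (fun _ => (1 + k) * vnorm U x) I (integrable_const _) (fun y hy => hk y x hy hx)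
    rwa [cst] at this
  have v0 := vnorm_nonneg U x
  have s0 : 0 ≤ sphAvg U r := by
    by_contra hneg
    push Not at hneg
    nlinarith
  rw [abs_le]
  constructor
  · have : k * vnorm U x ≤ k * ((1 + k) * sphAvg U r) := by gcongr
    nlinarith
  · nlinarith [mul_nonneg (mul_nonneg k0 k0) s0]

open MeasureTheory Metric Filter Topology
open EuclideanGeometry

lemma exDat {n p : ℕ} (hn : 5 ≤ n) (hp : 1 ≤ p) {s : ℝ}
    (hs1 : 1 < s) (hs2 : s < ((n : ℝ) + 4) / ((n : ℝ) - 4))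
    {R : ℝ} (hR : 0 < R) {U : Fin p → EE n → ℝ}
    (hnonneg : ∀ i, ∀ x ∈ ball (0 : EE n) R \ {0}, 0 ≤ U i x)
    (hC4 : ∀ i, ContDiffOn ℝ 4 (U i) (ball (0 : EE n) R \ {0}))
    (hsuper : ∀ i, ∀ x ∈ ball (0 : EE n) R \ {0}, 0 < -lap (U i) x)
    (hpde : ∀ i, ∀ x ∈ ball (0 : EE n) R \ {0}, bilap (U i) x = (vnorm U x) ^ (s - 1) * U i x) :
    ∃ m0 a b G, Dat s (R / 2) m0 U a b G := by
  have hn' : (5 : ℝ) ≤ n := by exact_mod_cast hn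
  have mem : ∀ x : EE n, x ≠ 0 → ‖x‖ < R / 2 → x ∈ ball (0 : EE n) R \ {0} := by
    intro x x0 hx
    refine ⟨by rw [mem_ball_zero_iff]; linarith, x0⟩
  have hbi : ∀ i, ∀ x ∈ ball (0 : EE n) R \ {0}, 0 ≤ bilap (U i) x := by
    intro i x hx
    rw [hpde i x hx]
    exact mul_nonneg (Real.rpow_nonneg (vnorm_nonneg U x) _) (hnonneg i x hx)
  choose a b ha hb G hGi hGc hGe hGb hrep using fun i => RT hn hR (hnonneg i) (hC4 i) (hsuper i) (hbi i)
  choose m mp hm using fun i => minp hn hR (hnonneg i) (hC4 i) (hsuper i)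
  have : Nonempty (Fin p) := ⟨⟨0, hp⟩⟩
  obtain ⟨i0, hi0⟩ := Finite.exists_min m
  have op : IsOpen (ball (0 : EE n) R \ {0}) := isOpen_ball.sdiff isClosed_singleton
  refine ⟨m i0, a, b, G, ⟨hn, hp, hs1, ?_, by positivity, mp i0, ?_, ?_, ha, hb, hGi, hGc, ?_, hGb, hrep⟩⟩
  · exact (lt_div_iff₀ (by linarith)).1 hs2
  · intro i x x0 hx
    exact (hi0 i).trans (hm i x x0 hx.le)
  · intro i x x0 hx
    exact ((hC4 i).contDiffAt (op.mem_nhds (mem x x0 hx))).of_le (by norm_num)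
  · intro i x x0 hx
    rw [hGe i x x0 hx, hpde i x (mem x x0 hx)]

open MeasureTheory Metric Filter Topology

/-- asymptotic radial symmetry near a non-removable isolated
singularity: `|U(x)| = (1 + O(|x|)) m(|x|)` as `x → 0`, where `m` is the
spherical average of `|U|`. -/
theorem statement3 (n p : ℕ) (hn : 5 ≤ n) (hp : 1 ≤ p) (s : ℝ)
    (hs1 : 1 < s) (hs2 : s < ((n : ℝ) + 4) / ((n : ℝ) - 4))
    (R : ℝ) (hR : 0 < R)
    (U : Fin p → EuclideanSpace ℝ (Fin n) → ℝ)
    (hnonneg : ∀ i, ∀ x ∈ Metric.ball (0 : EuclideanSpace ℝ (Fin n)) R \ {0}, 0 ≤ U i x)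
    (hC4 : ∀ i, ContDiffOn ℝ 4 (U i)
      (Metric.ball (0 : EuclideanSpace ℝ (Fin n)) R \ {0}))
    (hsuper : ∀ i, ∀ x ∈ Metric.ball (0 : EuclideanSpace ℝ (Fin n)) R \ {0},
      0 < -lap (U i) x)
    (hpde : ∀ i, ∀ x ∈ Metric.ball (0 : EuclideanSpace ℝ (Fin n)) R \ {0},
      bilap (U i) x = (vnorm U x) ^ (s - 1) * U i x)
    (hsing : ∃ i, ¬ ∃ g : EuclideanSpace ℝ (Fin n) → ℝ,
      ContinuousOn g (Metric.ball (0 : EuclideanSpace ℝ (Fin n)) R) ∧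
      ∀ x ∈ Metric.ball (0 : EuclideanSpace ℝ (Fin n)) R \ {0}, g x = U i x) :
    ∃ C > (0 : ℝ), ∃ r₀ : ℝ, 0 < r₀ ∧ r₀ < R ∧
      ∀ x : EuclideanSpace ℝ (Fin n), 0 < ‖x‖ → ‖x‖ < r₀ →
        |vnorm U x - sphAvg U ‖x‖| ≤ C * ‖x‖ * sphAvg U ‖x‖ := by
  obtain ⟨m0, a, b, G, h⟩ := exDat hn hp hs1 hs2 hR hnonneg hC4 hsuper hpde
  have con : Concl U := by
    rcases lt_or_ge (s * ((n : ℝ) - 4)) n with hlt | hge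
    · rcases h.caseB hlt with hc | hc
      · exact hc
      · exfalso
        obtain ⟨i, hi⟩ := hsing
        obtain ⟨g, gc, hg⟩ := hc i
        refine hi ⟨fun x => if x = 0 then g 0 else U i x, ?_, fun x hx => if_neg hx.2⟩
        intro x hx
        by_cases x0 : x = 0
        · subst x0
          refine ContinuousAt.continuousWithinAt ?_
          refine gc.continuousAt.congr ?_
          filter_upwards [ball_mem_nhds (0 : EE n) h.ρpos] with y hy
          rw [mem_ball_zero_iff] at hy
          split_ifs with y0
          · rw [y0]
          · exact hg y y0 hy
        · have op : IsOpen (ball (0 : EE n) R \ {0}) := isOpen_ball.sdiff isClosed_singleton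
          have xm : x ∈ ball (0 : EE n) R \ {0} := ⟨hx, x0⟩
          have c := (hC4 i).continuousOn.continuousAt (op.mem_nhds xm)
          refine ContinuousAt.continuousWithinAt (c.congr ?_)
          filter_upwards [op.mem_nhds xm] with y hy
          exact (if_neg hy.2).symm
    · exact h.caseA hge
  obtain ⟨C, C0, r0, r0p, hC⟩ := con
  refine ⟨C * (1 + C) + 1, by positivity, min (min r0 1) (R / 2), by positivity, ?_, fun x xp hx => ?_⟩
  · exact (min_le_right _ _).trans_lt (by linarith)
  have x1 : ‖x‖ < r0 := hx.trans_le ((min_le_left _ _).trans (min_le_left _ _))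
  have x2 : ‖x‖ < 1 := hx.trans_le ((min_le_left _ _).trans (min_le_right _ _))
  have x3 : ‖x‖ < R / 2 := hx.trans_le (min_le_right _ _)
  have key := avg_of hn (U := U) (k := C * ‖x‖) xp (by positivity)
    (fun y hy => h.vcont (norm_pos_iff.1 (hy ▸ xp)) (hy ▸ x3))
    (fun y z hy hz => by
      have := hC y z (norm_pos_iff.1 (hy ▸ xp)) (hy.trans hz.symm) (hy ▸ x1)
      rwa [hy] at this) (x := x) rfl
  have s0 : 0 ≤ sphAvg U ‖x‖ := by
    by_contra hneg
    push Not at hneg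
    have i1 := abs_nonneg (vnorm U x - sphAvg U ‖x‖)
    have i2 := vnorm_nonneg U x
    have i3 := le_abs_self (vnorm U x - sphAvg U ‖x‖)
    have i4 : C * ‖x‖ * (1 + C * ‖x‖) * sphAvg U ‖x‖ ≤ 0 :=
      mul_nonpos_of_nonneg_of_nonpos (by positivity) hneg.le
    linarith
  refine key.trans ?_
  refine mul_le_mul_of_nonneg_right ?_ s0
  have : C * ‖x‖ * (1 + C * ‖x‖) ≤ C * ‖x‖ * (1 + C * 1) := by gcongr
  nlinarith
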